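/- arXiv:0811.0886 — 2 statements merged into one kernel-verified Lean document; each statement's English description precedes it below -/
import Mathlib

section
/- (Lysko) Let X be a connected, compact, homogeneous metric ANR of finite covering dimension n. Then X is an n-dimensional Cantor manifold and X possesses the invariance of domain property. -/
open Set Metric Topology unitInterval

/-- Covering dimension at most `n`: every finite open cover admits an open
refinement in which each point lies in at most `n+1` members. -/
def CovDimLE (X : Type*) [TopologicalSpace X] (n : ℕ) : Prop :=
  ∀ (ι : Type) (_ : Finite ι) (U : ι → Set X), (∀ i, IsOpen (U i)) → (⋃ i, U i) = univ →
    ∃ (κ : Type) (V : κ → Set X), (∀ j, IsOpen (V j)) ∧ (⋃ j, V j) = univ ∧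
      (∀ j, ∃ i, V j ⊆ U i) ∧ ∀ x : X, {j | x ∈ V j}.encard ≤ (n + 1 : ℕ)

/-- Covering dimension exactly `n`. -/
def CovDimEq (X : Type*) [TopologicalSpace X] (n : ℕ) : Prop :=
  CovDimLE X n ∧ ∀ m : ℕ, m < n → ¬ CovDimLE X m

/-- A topological space is homogeneous if any point can be carried to any other
point by a self-homeomorphism. -/
def IsHomogeneousSpace (X : Type*) [TopologicalSpace X] : Prop :=
  ∀ x y : X, ∃ h : X ≃ₜ X, h x = y

/-- Absolute neighborhood retract: every closed embedding into a metric space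
admits a retraction of an open neighborhood of the image onto the image. -/
def IsANR (Y : Type*) [MetricSpace Y] : Prop :=
  ∀ (Z : Type*) [MetricSpace Z] (e : Y → Z), Topology.IsClosedEmbedding e →
    ∃ (U : Set Z) (r : U → Z), IsOpen U ∧ Set.range e ⊆ U ∧ Continuous r ∧
      Set.range r ⊆ Set.range e ∧ ∀ z : U, (z : Z) ∈ Set.range e → r z = z

/-- An `n`-dimensional compact metric space is an `n`-dimensional Cantor
manifold if whenever it is the union of two proper closed subsets, their
intersection has covering dimension at least `n - 1`. -/
def IsCantorManifold (n : ℕ) (X : Type*) [MetricSpace X] : Prop :=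
  CompactSpace X ∧ CovDimEq X n ∧
  ∀ X₁ X₂ : Set X, IsClosed X₁ → IsClosed X₂ → X₁ ≠ univ → X₂ ≠ univ →
    X₁ ∪ X₂ = univ →
    (X₁ ∩ X₂).Nonempty ∧ ∀ m : ℕ, m + 1 < n → ¬ CovDimLE (↥(X₁ ∩ X₂)) m

/-- The invariance of domain property: for every pair of homeomorphic subsets,
one is open iff the other is. -/
def InvarianceOfDomain (X : Type*) [TopologicalSpace X] : Prop :=
  ∀ U V : Set X, Nonempty (U ≃ₜ V) → (IsOpen U ↔ IsOpen V)

theorem exists_minimal_closed {X : Type*} [TopologicalSpace X] [CompactSpace X]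
    {P : Set X → Prop}
    (hP : ∀ K, IsClosed K → P K → ∃ O, IsOpen O ∧ K ⊆ O ∧ ∀ K', IsClosed K' → K' ⊆ O → P K')
    {K₀ : Set X} (hK₀ : IsClosed K₀) (h₀ : ¬ P K₀) :
    ∃ K ⊆ K₀, IsClosed K ∧ ¬ P K ∧ ∀ K' ⊂ K, IsClosed K' → P K' := by
  obtain ⟨K, hKK, hmin⟩ := zorn_superset_nonempty {K : Set X | IsClosed K ∧ ¬ P K} (by
    intro c hc hchain hne
    have hcl : IsClosed (⋂₀ c) := isClosed_sInter fun s hs => (hc hs).1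
    refine ⟨⋂₀ c, ⟨hcl, fun hPc => ?_⟩, fun s hs => sInter_subset_of_mem hs⟩
    obtain ⟨O, hO, hsub, hall⟩ := hP _ hcl hPc
    have : Nonempty c := hne.to_subtype
    rw [sInter_eq_iInter] at hsub
    obtain ⟨s, hs⟩ := exists_subset_nhds_of_isCompact' (V := fun s : c => (s : Set X))
      (fun a b => (hchain.total a.2 b.2).elim (fun h => ⟨a, subset_rfl, h⟩)
        fun h => ⟨b, h, subset_rfl⟩)
      (fun s => (hc s.2).1.isCompact)
      (fun s => (hc s.2).1) (U := O) (fun x hx => hO.mem_nhds (hsub hx))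
    exact (hc s.2).2 (hall _ (hc s.2).1 hs)) K₀ ⟨hK₀, h₀⟩
  refine ⟨K, hKK, hmin.prop.1, hmin.prop.2, fun K' hK' hcl => ?_⟩
  by_contra hn
  exact hK'.2 (hmin.le_of_le ⟨hcl, hn⟩ hK'.1)

section Effros

variable {X : Type*} [MetricSpace X] [CompactSpace X]

/-- The set of points to which `x` is carried by homeomorphisms moving no point by `ε` or more. -/
def pushOrbit (ε : ℝ) (x : X) : Set X :=
  {y | ∃ h : X ≃ₜ X, (∀ z, dist (h z) z < ε) ∧ h x = y}

theorem exists_countable_pushes (ε : ℝ) (hε : 0 < ε) :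
    ∃ D : Set (X ≃ₜ X), D.Countable ∧ ∀ h : X ≃ₜ X, ∃ g ∈ D, ∀ z, dist (h z) (g z) < ε := by
  let F : (X ≃ₜ X) → C(X, X) := fun h => (h : C(X, X))
  obtain ⟨t, hts, htc, hd⟩ := (TopologicalSpace.IsSeparable.of_subtype
    (range F)).exists_countable_dense_subset
  choose! G hG using fun f (hf : f ∈ t) => hts hf
  refine ⟨G '' t, htc.image G, fun h => ?_⟩
  obtain ⟨f, hf, hlt⟩ := Metric.mem_closure_iff.1 (hd (mem_range_self h)) ε hε
  refine ⟨G f, mem_image_of_mem _ hf, fun z => ?_⟩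
  have := (ContinuousMap.dist_apply_le_dist (f := F h) (g := f) z).trans_lt hlt
  rw [← hG f hf] at this
  exact this

theorem closure_pushOrbit_mem_nhds (hhom : ∀ x y : X, ∃ h : X ≃ₜ X, h x = y) {ε : ℝ}
    (hε : 0 < ε) (y : X) : closure (pushOrbit ε y) ∈ 𝓝 y := by
  obtain ⟨D, hDc, hD⟩ := exists_countable_pushes (X := X) (ε / 2) (half_pos hε)
  have : Nonempty X := ⟨y⟩
  have hcov : (⋃ g : D, g.1.symm '' closure (pushOrbit (ε / 2) y)) = univ := by
    refine eq_univ_of_forall fun x => ?_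
    obtain ⟨h, hh⟩ := hhom y x
    obtain ⟨g, hg, hgd⟩ := hD h.symm
    refine mem_iUnion.2 ⟨⟨g, hg⟩, g x, subset_closure ⟨h.trans g, fun z => ?_, by simp [hh]⟩,
      by simp⟩
    have := hgd (h z)
    simpa [dist_comm] using this
  have := hDc.to_subtype
  obtain ⟨⟨g, hg⟩, hne⟩ := nonempty_interior_of_iUnion_of_closed
    (fun g : D => g.1.symm.isClosedMap _ isClosed_closure) hcov
  obtain ⟨w, hw⟩ : (interior (closure (pushOrbit (ε / 2) y))).Nonempty := by
    rw [← g.symm.image_interior] at hne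
    exact hne.of_image
  obtain ⟨_, hvO, v, hv, rfl⟩ := mem_closure_iff.1 (interior_subset hw) _ isOpen_interior hw
  have hsub : v ⁻¹' interior (closure (pushOrbit (ε / 2) y)) ⊆ closure (pushOrbit ε y) := by
    intro z hz
    have h1 : v z ∈ closure (pushOrbit (ε / 2) y) := interior_subset hz
    have h2 : z ∈ v.symm '' closure (pushOrbit (ε / 2) y) := ⟨v z, h1, by simp⟩
    rw [v.symm.image_closure] at h2
    refine closure_mono ?_ h2
    rintro _ ⟨_, ⟨k, hk, rfl⟩, rfl⟩
    refine ⟨k.trans v.symm, fun z => ?_, rfl⟩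
    have h3 := hv (v.symm (k z))
    have h4 := hk z
    have h5 := dist_triangle (v.symm (k z)) (k z) z
    simp only [Homeomorph.apply_symm_apply, dist_comm (k z) (v.symm (k z))] at h3
    simp only [Homeomorph.trans_apply]
    linarith
  exact Filter.mem_of_superset ((isOpen_interior.preimage v.continuous).mem_nhds hvO) hsub

/-- A sequence of homeomorphisms converging geometrically, together with its inverses, converges
to a homeomorphism. -/
theorem exists_homeomorph_of_geometric (a : ℕ → X ≃ₜ X) (η : ℝ)
    (h₁ : ∀ k z, dist (a k z) (a (k + 1) z) ≤ η / 2 / 2 ^ k)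
    (h₂ : ∀ k z, dist ((a k).symm z) ((a (k + 1)).symm z) ≤ η / 2 / 2 ^ k) :
    ∃ h : X ≃ₜ X, (∀ z, Filter.Tendsto (fun k => a k z) Filter.atTop (𝓝 (h z))) ∧
      ∀ z, dist (a 0 z) (h z) ≤ η := by
  cases isEmpty_or_nonempty X with
  | inl h => exact ⟨Homeomorph.refl X, fun z => h.elim z, fun z => h.elim z⟩
  | inr hne =>
  let F : ℕ → C(X, X) := fun k => (a k : C(X, X))
  let G : ℕ → C(X, X) := fun k => ((a k).symm : C(X, X))
  have hF : ∀ k, dist (F k) (F (k + 1)) ≤ η / 2 / 2 ^ k := fun k =>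
    (ContinuousMap.dist_le_iff_of_nonempty).2 (h₁ k)
  have hG : ∀ k, dist (G k) (G (k + 1)) ≤ η / 2 / 2 ^ k := fun k =>
    (ContinuousMap.dist_le_iff_of_nonempty).2 (h₂ k)
  obtain ⟨f, hf⟩ := cauchySeq_tendsto_of_complete (cauchySeq_of_le_geometric_two hF)
  obtain ⟨g, hg⟩ := cauchySeq_tendsto_of_complete (cauchySeq_of_le_geometric_two hG)
  have hfg : f.comp g = ContinuousMap.id X := by
    refine tendsto_nhds_unique (hf.compCM hg) ?_
    refine tendsto_const_nhds.congr fun k => ?_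
    ext z; simp [F, G]
  have hgf : g.comp f = ContinuousMap.id X := by
    refine tendsto_nhds_unique (hg.compCM hf) ?_
    refine tendsto_const_nhds.congr fun k => ?_
    ext z; simp [F, G]
  refine ⟨⟨⟨f, g, fun z => DFunLike.congr_fun hgf z, fun z => DFunLike.congr_fun hfg z⟩,
    f.continuous, g.continuous⟩, fun z => ?_, fun z => ?_⟩
  · exact ((ContinuousEvalConst.continuous_eval_const z).tendsto f).comp hf
  · exact (ContinuousMap.dist_apply_le_dist (f := F 0) (g := f) z).trans
      (dist_le_of_le_geometric_two_of_tendsto₀ hF hf)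

theorem exists_push_of_mem_closure (hhom : ∀ x y : X, ∃ h : X ≃ₜ X, h x = y) {η η' : ℝ}
    (hη' : 0 < η') {p q : X} (h : p ∈ closure (pushOrbit η q)) :
    ∃ v : X ≃ₜ X, (∀ z, dist (v z) z < η) ∧ v q ∈ closure (pushOrbit η' p) ∧
      dist (v q) p < η' := by
  obtain ⟨_, ⟨hO, hd⟩, v, hv, rfl⟩ := mem_closure_iff_nhds.1 h _
    (Filter.inter_mem (closure_pushOrbit_mem_nhds hhom hη' p) (ball_mem_nhds p hη'))
  exact ⟨v, hv, hO, hd⟩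

/-- `η` is at most `θ` and is a modulus of continuity of the inverse of `a` at scale `θ`. -/
def IsInvModulus (a : X ≃ₜ X) (η θ : ℝ) : Prop :=
  η ≤ θ ∧ ∀ u v, dist u v < η → dist (a.symm u) (a.symm v) ≤ θ

theorem exists_isInvModulus (a : X ≃ₜ X) {θ : ℝ} (hθ : 0 < θ) :
    ∃ η > 0, IsInvModulus a η θ := by
  obtain ⟨δ, hδ, h⟩ := Metric.uniformContinuous_iff.1
    (CompactSpace.uniformContinuous_of_continuous a.symm.continuous) θ hθ
  exact ⟨min δ θ, lt_min hδ hθ, min_le_right _ _, fun u v huv =>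
    (h (huv.trans_le (min_le_left _ _))).le⟩

omit [CompactSpace X] in
theorem IsInvModulus.dist_symm_le {a v : X ≃ₜ X} {η θ : ℝ} (h : IsInvModulus a η θ)
    (hv : ∀ z, dist (v z) z < η) (z : X) :
    dist (a z) ((a.trans v) z) ≤ θ ∧ dist (a.symm z) ((a.trans v).symm z) ≤ θ := by
  refine ⟨?_, h.2 _ _ ?_⟩
  · rw [dist_comm]; exact (hv (a z)).le.trans h.1
  · simpa using hv (v.symm z)

theorem pushOrbit_mem_nhds (hhom : ∀ x y : X, ∃ h : X ≃ₜ X, h x = y) {ε : ℝ}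
    (hε : 0 < ε) (y : X) : pushOrbit ε y ∈ 𝓝 y := by
  set θ : ℕ → ℝ := fun k => ε / 4 / 2 / 2 ^ k with hθ
  have hθ0 : ∀ k, 0 < θ k := fun k => by positivity
  obtain ⟨η₀, hη₀, hm₀⟩ := exists_isInvModulus (Homeomorph.refl X) (hθ0 0)
  refine Filter.mem_of_superset (closure_pushOrbit_mem_nhds hhom hη₀ y) fun x hx => ?_
  let S := (X ≃ₜ X) × (X ≃ₜ X) × ℝ
  let Inv : ℕ → S → Prop := fun k s => 0 < s.2.2 ∧ IsInvModulus s.2.1 s.2.2 (θ k) ∧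
    s.1 x ∈ closure (pushOrbit s.2.2 (s.2.1 y))
  have step : ∀ k (s : {s : S // Inv k s}), ∃ s' : {s : S // Inv (k + 1) s},
      (∀ z, dist (s.1.1 z) (s'.1.1 z) ≤ θ k ∧ dist (s.1.1.symm z) (s'.1.1.symm z) ≤ θ k) ∧
      (∀ z, dist (s.1.2.1 z) (s'.1.2.1 z) ≤ θ k ∧
        dist (s.1.2.1.symm z) (s'.1.2.1.symm z) ≤ θ k) ∧
      dist (s'.1.1 x) (s'.1.2.1 y) ≤ θ (k + 1) := by
    rintro k ⟨⟨a, b, η⟩, hη, hb, hmem⟩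
    obtain ⟨η', hη', ha⟩ := exists_isInvModulus a (hθ0 k)
    obtain ⟨v, hv, hvm, -⟩ := exists_push_of_mem_closure hhom hη' hmem
    obtain ⟨η'', hη'', hb'⟩ := exists_isInvModulus (b.trans v) (hθ0 (k + 1))
    obtain ⟨w, hw, hwm, hd⟩ := exists_push_of_mem_closure hhom hη'' hvm
    exact ⟨⟨(a.trans w, b.trans v, η''), hη'', hb', hwm⟩, ha.dist_symm_le hw,
      hb.dist_symm_le hv, hd.le.trans hb'.1⟩
  choose F hFa hFb hFd using step
  let s : (k : ℕ) → {s : S // Inv k s} := fun k =>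
    Nat.rec ⟨(Homeomorph.refl X, Homeomorph.refl X, η₀), hη₀, hm₀, hx⟩ F k
  obtain ⟨a, ha, ha0⟩ := exists_homeomorph_of_geometric (fun k => (s k).1.1) (ε / 4)
    (fun k z => (hFa k (s k) z).1) (fun k z => (hFa k (s k) z).2)
  obtain ⟨b, hb, hb0⟩ := exists_homeomorph_of_geometric (fun k => (s k).1.2.1) (ε / 4)
    (fun k z => (hFb k (s k) z).1) (fun k z => (hFb k (s k) z).2)
  have hab : a x = b y := by
    refine eq_of_dist_eq_zero (le_antisymm ?_ dist_nonneg)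
    have hθlim : Filter.Tendsto (fun k => θ (k + 1)) Filter.atTop (𝓝 0) := by
      have : Filter.Tendsto θ Filter.atTop (𝓝 0) := by
        have := (tendsto_pow_atTop_nhds_zero_of_lt_one (r := (1 / 2 : ℝ)) (by norm_num)
          (by norm_num)).const_mul (ε / 4 / 2)
        simpa [hθ, div_eq_mul_inv] using this
      exact this.comp (Filter.tendsto_add_atTop_nat 1)
    exact le_of_tendsto_of_tendsto (((ha x).comp (Filter.tendsto_add_atTop_nat 1)).dist
      ((hb y).comp (Filter.tendsto_add_atTop_nat 1))) hθlim
      (Filter.Eventually.of_forall fun k => hFd k (s k))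
  refine ⟨b.trans a.symm, fun z => ?_, by simp [← hab]⟩
  have h1 := ha0 (a.symm (b z))
  have h2 := hb0 z
  have h3 := dist_triangle (a.symm (b z)) (b z) z
  change dist (a.symm (b z)) (a (a.symm (b z))) ≤ _ at h1
  change dist z (b z) ≤ _ at h2
  rw [dist_comm] at h2
  simp only [Homeomorph.apply_symm_apply] at h1
  simp only [Homeomorph.trans_apply]
  linarith

/-- The Effros theorem for compact homogeneous metric spaces: nearby points are carried to one
another by homeomorphisms close to the identity. -/
theorem exists_small_homeomorph (hhom : ∀ x y : X, ∃ h : X ≃ₜ X, h x = y) {ε : ℝ}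
    (hε : 0 < ε) :
    ∃ δ > 0, ∀ x y : X, dist x y < δ → ∃ h : X ≃ₜ X, h x = y ∧ ∀ z, dist (h z) z < ε := by
  obtain ⟨δ, hδ, h⟩ := lebesgue_number_lemma_of_metric (s := (univ : Set X))
    (c := fun y : X => interior (pushOrbit (ε / 2) y)) isCompact_univ (fun _ => isOpen_interior)
    (fun y _ => mem_iUnion.2 ⟨y, mem_interior_iff_mem_nhds.2
      (pushOrbit_mem_nhds hhom (half_pos hε) y)⟩)
  refine ⟨δ, hδ, fun x y hxy => ?_⟩
  obtain ⟨w, hw⟩ := h x (mem_univ x)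
  obtain ⟨f, hf, hfx⟩ := interior_subset (hw (mem_ball_self hδ))
  obtain ⟨g, hg, hgy⟩ := interior_subset (hw (mem_ball'.2 hxy))
  refine ⟨f.symm.trans g, by simp [← hfx, hgy], fun z => ?_⟩
  have h1 := hf (f.symm z)
  have h2 := hg (f.symm z)
  have h3 := dist_triangle_right (g (f.symm z)) z (f.symm z)
  simp only [Homeomorph.apply_symm_apply] at h1
  simp only [Homeomorph.trans_apply]
  linarith

end Effros

universe u v

/-- The identity and `g` are joined by finite chains of maps with arbitrarily small steps, all of
whose members move points by less than `ε`. -/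
def IsChainJoined {X : Type*} [MetricSpace X] (ε : ℝ) (g : X → X) : Prop :=
  ∀ η > 0, ∃ (N : ℕ) (h : ℕ → X → X), h 0 = id ∧ h N = g ∧ (∀ i, Continuous (h i)) ∧
    (∀ i z, dist (h i z) z < ε) ∧ ∀ i z, dist (h i z) (h (i + 1) z) < η

theorem exists_isChainJoined_of_retraction {X Z : Type*} [MetricSpace X] [CompactSpace X]
    [NormedAddCommGroup Z] [NormedSpace ℝ Z] {e : X → Z} (he : Isometry e) {U : Set Z}
    {r : U → Z} (hU : IsOpen U) (heU : range e ⊆ U) (hr : Continuous r)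
    (hre : range r ⊆ range e) (hrU : ∀ z : U, (z : Z) ∈ range e → r z = z)
    {ε : ℝ} (hε : 0 < ε) :
    ∃ δ > 0, ∀ g : X → X, Continuous g → (∀ z, dist (g z) z < δ) → IsChainJoined ε g := by
  let O : X → Set Z := fun x => Subtype.val '' (r ⁻¹' ball (e x) (ε / 2)) ∩ ball (e x) (ε / 2)
  obtain ⟨δ, hδ, hleb⟩ := lebesgue_number_lemma_of_metric (s := range e) (c := O)
    (isCompact_range he.continuous)
    (fun x => (hU.isOpenMap_subtype_val _ (isOpen_ball.preimage hr)).inter isOpen_ball) (by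
      rintro _ ⟨x, rfl⟩
      refine mem_iUnion.2 ⟨x, ⟨⟨e x, heU ⟨x, rfl⟩⟩, ?_, rfl⟩, mem_ball_self (half_pos hε)⟩
      rw [mem_preimage, hrU _ ⟨x, rfl⟩]
      exact mem_ball_self (half_pos hε))
  have key : ∀ x, ∀ z ∈ ball (e x) δ, ∃ hz : z ∈ U, dist (r ⟨z, hz⟩) (e x) < ε := by
    intro x z hz
    obtain ⟨y, hy⟩ := hleb (e x) ⟨x, rfl⟩
    obtain ⟨⟨⟨w, hwU⟩, hw, rfl⟩, -⟩ := hy hz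
    have h2 := (hy (mem_ball_self hδ)).2
    refine ⟨hwU, ?_⟩
    have h3 := dist_triangle_right (r ⟨w, hwU⟩) (e x) (e y)
    rw [mem_preimage, mem_ball] at hw
    rw [mem_ball] at h2
    linarith
  refine ⟨δ, hδ, fun g hg hgd => ?_⟩
  let p : I × X → Z := fun q => e q.2 + (q.1 : ℝ) • (e (g q.2) - e q.2)
  have hp : Continuous p := by
    have := he.continuous
    fun_prop
  have hpδ : ∀ q, p q ∈ ball (e q.2) δ := by
    intro q
    rw [mem_ball, dist_eq_norm, add_sub_cancel_left, norm_smul, ← dist_eq_norm, he.dist_eq,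
      Real.norm_of_nonneg q.1.2.1]
    exact (mul_le_of_le_one_left dist_nonneg q.1.2.2).trans_lt (hgd q.2)
  choose hpU hpr using fun q => key q.2 (p q) (hpδ q)
  choose H hH using fun q => hre (mem_range_self (f := r) ⟨p q, hpU q⟩)
  have hHc : Continuous H := by
    rw [he.isEmbedding.continuous_iff]
    have : e ∘ H = fun q => r ⟨p q, hpU q⟩ := funext hH
    rw [this]
    exact hr.comp (hp.subtype_mk _)
  have hH0 : ∀ x, H (0, x) = x := fun x => he.injective <| by
    rw [hH, hrU _ ⟨x, by simp [p]⟩]; simp [p]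
  have hH1 : ∀ x, H (1, x) = g x := fun x => he.injective <| by
    rw [hH, hrU _ ⟨g x, by simp [p]⟩]; simp [p]
  have hHd : ∀ q, dist (H q) q.2 < ε := fun q => by
    rw [← he.dist_eq, hH]; exact hpr q
  intro η hη
  obtain ⟨θ, hθ, hu⟩ := Metric.uniformContinuous_iff.1
    (CompactSpace.uniformContinuous_of_continuous hHc) η hη
  obtain ⟨N, hN⟩ := exists_nat_one_div_lt hθ
  let t : ℕ → I := fun i => projIcc 0 1 zero_le_one ((i : ℝ) / (N + 1))
  refine ⟨N + 1, fun i x => H (t i, x), ?_, ?_, fun i => by fun_prop, fun i z => hHd _,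
    fun i z => hu ?_⟩
  · funext x
    have : t 0 = 0 := by simp [t]
    simp [this, hH0]
  · funext x
    have : t (N + 1) = 1 := by
      have h : (((N + 1 : ℕ) : ℝ) / (N + 1)) = 1 := by
        push_cast; exact div_self (by positivity)
      simp only [t, h]; simp
    simp [this, hH1]
  · rw [Prod.dist_eq, dist_self, max_eq_left dist_nonneg]
    refine lt_of_le_of_lt ?_ hN
    rw [Subtype.dist_eq]
    have := abs_projIcc_sub_projIcc (a := (0 : ℝ)) (b := 1) zero_le_one
      (c := (i : ℝ) / (N + 1)) (d := ((i + 1 : ℕ) : ℝ) / (N + 1))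
    rw [Real.dist_eq]
    refine this.trans ?_
    rw [← sub_div]
    push_cast
    rw [abs_div, abs_of_pos (by positivity : (0 : ℝ) < N + 1)]
    simp

theorem IsANR.exists_isChainJoined {X : Type u} [MetricSpace X] [CompactSpace X]
    (hanr : IsANR.{u, v} X) {ε : ℝ} (hε : 0 < ε) :
    ∃ δ > 0, ∀ g : X → X, Continuous g → (∀ z, dist (g z) z < δ) → IsChainJoined ε g := by
  have he : Isometry fun x : X => ULift.up.{v} (kuratowskiEmbedding X x) :=
    fun x y => kuratowskiEmbedding.isometry X x y
  obtain ⟨U, r, hU, heU, hr, hre, hrU⟩ := hanr _ _ he.isClosedEmbedding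
  exact exists_isChainJoined_of_retraction he hU heU hr hre hrU hε

section Extension

variable {X E : Type*} [TopologicalSpace X] [NormedAddCommGroup E] [InnerProductSpace ℝ E]

/-- `g` has no zeros on `K` and, on `A ∩ K`, points into the same open half-space as `f`. -/
def IsNullDeformation (f : C(X, E)) (A K : Set X) (g : C(X, E)) : Prop :=
  (∀ x ∈ K, g x ≠ 0) ∧ ∀ x ∈ A ∩ K, 0 < inner ℝ (f x) (g x)

/-- The restriction of `f` to `A ∩ K` is homotopic, through maps avoiding `0`, to a map which
extends over `K` without zeros. -/
def IsInessential (f : C(X, E)) (A K : Set X) : Prop :=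
  ∃ g : C(X, E), IsNullDeformation f A K g

theorem IsInessential.exists_isOpen {f : C(X, E)} {A : Set X} (hA : IsClosed A) {K : Set X}
    (h : IsInessential f A K) :
    ∃ O, IsOpen O ∧ K ⊆ O ∧ ∀ K', IsClosed K' → K' ⊆ O → IsInessential f A K' := by
  obtain ⟨g, hg, hfg⟩ := h
  refine ⟨{x | g x ≠ 0} ∩ (Aᶜ ∪ {x | 0 < inner ℝ (f x) (g x)}), ?_, ?_, ?_⟩
  · exact (isOpen_ne_fun g.continuous continuous_const).inter
      (hA.isOpen_compl.union (isOpen_lt continuous_const (by fun_prop)))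
  · exact fun x hx => ⟨hg x hx, (em (x ∈ A)).symm.imp id fun hxA => hfg x ⟨hxA, hx⟩⟩
  · exact fun K' _ hK' => ⟨g, fun x hx => (hK' hx).1,
      fun x hx => (hK' hx.2).2.resolve_left (not_not.2 hx.1)⟩

theorem IsInessential.exists_eqOn [NormalSpace X] {f : C(X, E)} {A : Set X} (hA : IsClosed A)
    (h : IsInessential f A univ) :
    ∃ g : C(X, E), (∀ x, g x ≠ 0) ∧ EqOn g f A := by
  obtain ⟨g, hg, hfg⟩ := h
  have hpos : IsClosed {x | inner ℝ (f x) (g x) ≤ 0} :=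
    isClosed_le (by fun_prop) continuous_const
  obtain ⟨θ, hθ0, hθ1, hθ⟩ := exists_continuous_zero_one_of_isClosed hpos hA
    (disjoint_left.2 fun x hx hxA => (hfg x ⟨hxA, mem_univ x⟩).not_ge hx)
  refine ⟨⟨fun x => (1 - θ x) • g x + θ x • f x, by fun_prop⟩, fun x hx => ?_, fun x hx => ?_⟩
  · simp only [ContinuousMap.coe_mk] at hx
    by_cases h0 : inner ℝ (f x) (g x) ≤ 0
    · have := hθ0 h0
      simp only [Pi.zero_apply] at this
      simp [this, hg x (mem_univ x)] at hx
    · have h1 : inner ℝ (f x) ((1 - θ x) • g x + θ x • f x) = 0 := by rw [hx, inner_zero_right]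
      rw [inner_add_right, inner_smul_right, inner_smul_right] at h1
      have hfx : f x ≠ 0 := fun h => h0 (by simp [h])
      have h2 : 0 < inner ℝ (f x) (f x) := real_inner_self_pos.2 hfx
      have := (hθ x).1
      have := (hθ x).2
      push Not at h0
      nlinarith [mul_nonneg (sub_nonneg.2 (hθ x).2) h0.le, mul_nonneg (hθ x).1 h2.le]
  · have := hθ1 hx
    simp only [Pi.one_apply] at this
    simp [this]

end Extension

section Shrinking

variable {X : Type*} [TopologicalSpace X] [NormalSpace X]

theorem exists_shrinking_of_isInessential {m : ℕ}
    (H : ∀ (f : C(X, EuclideanSpace ℝ (Fin (m + 1)))) (A : Set X), IsClosed A →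
      (∀ x ∈ A, f x ≠ 0) → IsInessential f A univ)
    (W : Fin (m + 2) → Set X) (hW : ∀ i, IsOpen (W i)) (hcov : (⋃ i, W i) = univ) :
    ∃ W' : Fin (m + 2) → Set X, (∀ i, IsOpen (W' i)) ∧ (∀ i, W' i ⊆ W i) ∧
      (⋃ i, W' i) = univ ∧ (⋂ i, W' i) = ∅ := by
  obtain ⟨φ, hφ⟩ := PartitionOfUnity.exists_isSubordinate_of_locallyFinite isClosed_univ W hW
    (locallyFinite_of_finite W) hcov.ge
  have hφW : ∀ i x, 0 < φ i x → x ∈ W i := fun i x hx =>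
    hφ i (subset_tsupport _ hx.ne')
  have hφsum : ∀ x, ∑ i, φ i x = 1 := fun x => by
    rw [← finsum_eq_sum_of_fintype]; exact φ.sum_eq_one (mem_univ x)
  let f : C(X, EuclideanSpace ℝ (Fin (m + 1))) :=
    ⟨fun x => WithLp.toLp 2 fun i => φ i.succ x - φ 0 x, by fun_prop⟩
  set ε : ℝ := 1 / (2 * (m + 2)) with hε
  have hε0 : 0 < ε := by positivity
  obtain ⟨g, hg0, hgf⟩ := (H f {x | ε ≤ ‖f x‖} (isClosed_le continuous_const (by fun_prop))
    (fun x hx h0 => by simp [h0] at hx; linarith)).exists_eqOn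
    (isClosed_le continuous_const (by fun_prop))
  let ψ : Fin (m + 2) → X → ℝ := fun i x => (Fin.cons 0 (g x) : Fin (m + 2) → ℝ) i
  have hψ : ∀ i, Continuous (ψ i) := by
    intro i
    refine Fin.cases ?_ (fun j => ?_) i
    · simpa [ψ] using continuous_const
    · simp only [ψ, Fin.cons_succ]; fun_prop
  refine ⟨fun i => {x | ∃ k, ψ k x < ψ i x}, fun i => ?_, fun i x hx => ?_, ?_, ?_⟩
  · simp only [Set.ofPred_exists]
    exact isOpen_iUnion fun k => isOpen_lt (hψ k) (hψ i)
  · obtain ⟨k, hk⟩ := hx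
    by_cases hxA : ε ≤ ‖f x‖
    · have h1 : ∀ i, ψ i x = φ i x - φ 0 x := by
        intro i
        refine Fin.cases ?_ (fun j => ?_) i
        · simp [ψ]
        · simp [ψ, hgf hxA, f]
      rw [h1, h1] at hk
      exact hφW i x (by linarith [φ.nonneg k x])
    · push Not at hxA
      have h1 : ∀ i, |φ i x - φ 0 x| < ε := by
        intro i
        refine Fin.cases ?_ (fun j => ?_) i
        · simpa using hε0
        · exact (PiLp.norm_apply_le (f x) j).trans_lt hxA
      have h2 : (1 : ℝ) ≤ (m + 2) * (φ 0 x + ε) := by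
        calc (1 : ℝ) = ∑ i, φ i x := (hφsum x).symm
          _ ≤ ∑ i : Fin (m + 2), (φ 0 x + ε) :=
            Finset.sum_le_sum fun i _ => by linarith [(abs_lt.1 (h1 i)).2]
          _ = _ := by simp; ring
      have h3 : (m + 2) * ε = 1 / 2 := by rw [hε]; field_simp
      have h4 : ε ≤ φ 0 x := by
        have : (m + 2) * ε ≤ (m + 2) * φ 0 x := by linarith
        exact le_of_mul_le_mul_left this (by positivity)
      exact hφW i x (by linarith [(abs_lt.1 (h1 i)).1])
  · refine eq_univ_of_forall fun x => ?_
    obtain ⟨j, hj⟩ : ∃ j, g x j ≠ 0 := by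
      by_contra! h
      exact hg0 x (by ext j; simpa using h j)
    have : ψ j.succ x ≠ ψ 0 x := by simpa [ψ] using hj
    rcases this.lt_or_gt with h | h
    · exact mem_iUnion.2 ⟨0, _, h⟩
    · exact mem_iUnion.2 ⟨j.succ, _, h⟩
  · refine eq_empty_of_forall_notMem fun x hx => ?_
    obtain ⟨i, hi⟩ := Finite.exists_min fun i => ψ i x
    obtain ⟨k, hk⟩ := mem_iInter.1 hx i
    exact (hi k).not_gt hk

theorem exists_shrinking_finset {m : ℕ}
    (H : ∀ (f : C(X, EuclideanSpace ℝ (Fin (m + 1)))) (A : Set X), IsClosed A →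
      (∀ x ∈ A, f x ≠ 0) → IsInessential f A univ)
    {ι : Type*} (V : ι → Set X) (hV : ∀ i, IsOpen (V i))
    (hcov : (⋃ i, V i) = univ) (S : Finset ι) (hS : S.card = m + 2) :
    ∃ V' : ι → Set X, (∀ i, IsOpen (V' i)) ∧ (∀ i, V' i ⊆ V i) ∧
      (⋃ i, V' i) = univ ∧ (⋂ i ∈ S, V' i) = ∅ := by
  classical
  let e : S ≃ Fin (m + 2) := S.equivFinOfCardEq hS
  let W : Fin (m + 2) → Set X := fun i => V (e.symm i) ∪ (if i = 0 then ⋃ j ∉ S, V j else ∅)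
  obtain ⟨W', hW'o, hW'W, hW'c, hW'e⟩ := exists_shrinking_of_isInessential H W
    (fun i => (hV _).union (by
      split_ifs
      · exact isOpen_biUnion fun j _ => hV j
      · exact isOpen_empty))
    (eq_univ_of_forall fun x => by
      obtain ⟨j, hj⟩ := mem_iUnion.1 (hcov.ge (mem_univ x))
      by_cases hjS : j ∈ S
      · exact mem_iUnion.2 ⟨e ⟨j, hjS⟩, Or.inl (by simpa using hj)⟩
      · exact mem_iUnion.2 ⟨0, Or.inr (by simpa using ⟨j, hjS, hj⟩)⟩)
  refine ⟨fun j => if h : j ∈ S then W' (e ⟨j, h⟩) ∩ V j else V j, fun j => ?_, fun j => ?_, ?_, ?_⟩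
  · dsimp only
    split_ifs
    exacts [(hW'o _).inter (hV j), hV j]
  · dsimp only
    split_ifs
    exacts [inter_subset_right, subset_rfl]
  · refine eq_univ_of_forall fun x => ?_
    obtain ⟨i, hi⟩ := mem_iUnion.1 (hW'c.ge (mem_univ x))
    rcases hW'W i hi with h | h
    · refine mem_iUnion.2 ⟨e.symm i, ?_⟩
      simp [hi, h]
    · split_ifs at h
      · obtain ⟨j, hj, hx⟩ := mem_iUnion₂.1 h
        refine mem_iUnion.2 ⟨j, ?_⟩
        simpa [hj] using hx
      · exact h.elim
  · refine eq_empty_of_forall_notMem fun x hx => ?_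
    have hx' : x ∈ ⋂ i, W' i := mem_iInter.2 fun i => by
      have := mem_iInter₂.1 hx (e.symm i) (e.symm i).2
      simp only [Finset.coe_mem, dite_true, Subtype.coe_eta, Equiv.apply_symm_apply] at this
      exact this.1
    rw [hW'e] at hx'
    exact hx'

theorem exists_shrinking_finset_family {m : ℕ}
    (H : ∀ (f : C(X, EuclideanSpace ℝ (Fin (m + 1)))) (A : Set X), IsClosed A →
      (∀ x ∈ A, f x ≠ 0) → IsInessential f A univ)
    {ι : Type*} (V : ι → Set X) (hV : ∀ i, IsOpen (V i))
    (hcov : (⋃ i, V i) = univ) (𝒮 : Finset (Finset ι)) (h𝒮 : ∀ S ∈ 𝒮, S.card = m + 2) :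
    ∃ V' : ι → Set X, (∀ i, IsOpen (V' i)) ∧ (∀ i, V' i ⊆ V i) ∧
      (⋃ i, V' i) = univ ∧ ∀ S ∈ 𝒮, (⋂ i ∈ S, V' i) = ∅ := by
  classical
  induction 𝒮 using Finset.induction_on with
  | empty => exact ⟨V, hV, fun _ => subset_rfl, hcov, by simp⟩
  | insert S 𝒮 _ ih =>
    obtain ⟨V₁, h₁o, h₁s, h₁c, h₁e⟩ := ih fun T hT => h𝒮 T (Finset.mem_insert_of_mem hT)
    obtain ⟨V₂, h₂o, h₂s, h₂c, h₂e⟩ := exists_shrinking_finset H V₁ h₁o h₁c S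
      (h𝒮 S (Finset.mem_insert_self _ _))
    refine ⟨V₂, h₂o, fun i => (h₂s i).trans (h₁s i), h₂c, fun T hT => ?_⟩
    rcases Finset.mem_insert.1 hT with rfl | hT
    · exact h₂e
    · exact subset_empty_iff.1 ((iInter₂_mono fun i _ => h₂s i).trans (h₁e T hT).le)

/-- If `X` does not have covering dimension at most `m`, some map from a closed subset of `X` to
the `m`-sphere is essential. -/
theorem exists_not_isInessential {m : ℕ} (hX : ¬ CovDimLE X m) :
    ∃ (f : C(X, EuclideanSpace ℝ (Fin (m + 1)))) (A : Set X), IsClosed A ∧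
      (∀ x ∈ A, f x ≠ 0) ∧ ¬ IsInessential f A univ := by
  classical
  by_contra! H
  refine hX fun ι _ U hU hcov => ?_
  have := Fintype.ofFinite ι
  obtain ⟨V, hVo, hVU, hVc, hVe⟩ := exists_shrinking_finset_family H U hU hcov
    (Finset.univ.powersetCard (m + 2)) (fun S hS => (Finset.mem_powersetCard.1 hS).2)
  refine ⟨ι, V, hVo, hVc, fun j => ⟨j, hVU j⟩, fun x => ?_⟩
  by_contra! hlt
  rw [Set.encard_eq_coe_toFinset_card, Nat.cast_lt] at hlt
  obtain ⟨S, hS, hSc⟩ := Finset.exists_subset_card_eq (Nat.succ_le_of_lt hlt)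
  have hx : x ∈ ⋂ i ∈ S, V i := mem_iInter₂.2 fun i hi => by simpa using hS hi
  rw [hVe S (Finset.mem_powersetCard.2 ⟨Finset.subset_univ S, hSc⟩)] at hx
  exact hx

end Shrinking

section Dimension

theorem CovDimLE.exists_fintype_refinement {Y : Type*} [TopologicalSpace Y] [CompactSpace Y]
    {m : ℕ} (hY : CovDimLE Y m) (U : Y → Set Y) (hU : ∀ y, IsOpen (U y)) (hyU : ∀ y, y ∈ U y) :
    ∃ (κ : Type) (_ : Fintype κ) (V : κ → Set Y), (∀ j, IsOpen (V j)) ∧ (⋃ j, V j) = univ ∧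
      (∀ j, ∃ c, V j ⊆ U c) ∧ ∀ (y : Y) (S : Finset κ), (∀ j ∈ S, y ∈ V j) → S.card ≤ m + 1 := by
  obtain ⟨t, ht⟩ := CompactSpace.elim_nhds_subcover U fun y => (hU y).mem_nhds (hyU y)
  obtain ⟨κ, V, hVo, hVc, hVU, hV⟩ := hY (Fin t.card) inferInstance
    (fun i => U (t.equivFin.symm i)) (fun i => hU _) (eq_univ_of_forall fun y => by
      obtain ⟨c, hc, hy⟩ := mem_iUnion₂.1 (ht.ge (mem_univ y))
      exact mem_iUnion.2 ⟨t.equivFin ⟨c, hc⟩, by simpa using hy⟩)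
  obtain ⟨s, hs⟩ := isCompact_univ.elim_finite_subcover V hVo hVc.ge
  refine ⟨s, inferInstance, fun j => V j, fun j => hVo _, eq_univ_of_forall fun y => ?_,
    fun j => ?_, fun y S hS => ?_⟩
  · obtain ⟨j, hj, hy⟩ := mem_iUnion₂.1 (hs (mem_univ y))
    exact mem_iUnion.2 ⟨⟨j, hj⟩, hy⟩
  · obtain ⟨i, hi⟩ := hVU j
    exact ⟨_, hi⟩
  · have h1 : ((S.map (Function.Embedding.subtype _) : Finset κ) : Set κ) ⊆ {j | y ∈ V j} := by
      intro j hj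
      obtain ⟨k, hk, rfl⟩ := Finset.mem_map.1 (Finset.mem_coe.1 hj)
      exact hS k hk
    have h2 := (encard_le_encard h1).trans (hV y)
    rw [encard_coe_eq_coe_finsetCard, Finset.card_map] at h2
    exact_mod_cast h2

theorem CovDimLE.exists_perturbation {Y E : Type*} [TopologicalSpace Y] [CompactSpace Y]
    [T2Space Y] [NormedAddCommGroup E] [NormedSpace ℝ E] [FiniteDimensional ℝ E] {m : ℕ}
    (hY : CovDimLE Y m) (hm : m + 1 < Module.finrank ℝ E) (g₁ g₂ : C(Y, E)) {ε : ℝ}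
    (hε : 0 < ε) :
    ∃ g₁' g₂' : C(Y, E), (∀ y, dist (g₁' y) (g₁ y) < ε) ∧ (∀ y, dist (g₂' y) (g₂ y) < ε) ∧
      ∀ y, ∀ t : ℝ, (1 - t) • g₁' y + t • g₂' y ≠ 0 := by
  classical
  obtain ⟨κ, _, V, hVo, hVc, hVU, hV⟩ := hY.exists_fintype_refinement
    (fun c => {y | dist (g₁ c) (g₁ y) < ε / 2 ∧ dist (g₂ c) (g₂ y) < ε / 2})
    (fun c => IsOpen.and (isOpen_lt (by fun_prop) continuous_const)
      (isOpen_lt (by fun_prop) continuous_const)) (fun c => by simp [hε])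
  choose c hc using hVU
  obtain ⟨ρ, hρ⟩ := PartitionOfUnity.exists_isSubordinate isClosed_univ V hVo hVc.ge
  have hρV : ∀ j y, ρ j y ≠ 0 → y ∈ V j := fun j y h => hρ j (subset_tsupport _ h)
  have hsum : ∀ y, ∑ j, ρ j y = 1 := fun y => by
    rw [← finsum_eq_sum_of_fintype]; exact ρ.sum_eq_one (mem_univ y)
  have happrox : ∀ g : C(Y, E), (∀ j, ∀ y ∈ V j, dist (g (c j)) (g y) < ε / 2) →
      ∀ y, dist (∑ j, ρ j y • g (c j)) (g y) < ε / 2 := by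
    intro g hg y
    rw [← finsum_eq_sum_of_fintype]
    exact ρ.finsum_smul_mem_convex (t := ball (g y) (ε / 2)) (g := fun j _ => g (c j))
      (mem_univ y) (fun j hj => hg j y (hρV j y hj)) (convex_ball _ _)
  let F : (p : Finset κ × κ) → ((p.1.erase p.2 → ℝ) × ℝ) → E := fun p q =>
    ((1 - q.2) • g₁ (c p.2) + q.2 • g₂ (c p.2)) + ∑ j : p.1.erase p.2, q.1 j •
      (((1 - q.2) • g₁ (c j) + q.2 • g₂ (c j)) - ((1 - q.2) • g₁ (c p.2) + q.2 • g₂ (c p.2)))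
  let P := {p : Finset κ × κ // p.1.card ≤ m + 1 ∧ p.2 ∈ p.1}
  have hF : Dense (⋃ p : P, range (F p))ᶜ := by
    refine dense_compl_of_dimH_lt_finrank ?_
    rw [dimH_iUnion]
    refine (iSup_le (a := ((m + 1 : ℕ) : ENNReal)) fun p => ?_).trans_lt (by exact_mod_cast hm)
    refine (ContDiff.dimH_range_le (f := F p) ?_).trans ?_
    · simp only [F]; fun_prop
    · have h1 := Finset.card_erase_of_mem p.2.2
      have h2 := p.2.1
      have h3 := Finset.card_pos.2 ⟨_, p.2.2⟩
      rw [Module.finrank_prod, Module.finrank_fintype_fun_eq_card, Module.finrank_self,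
        Fintype.card_coe, h1]
      exact_mod_cast (by omega)
  obtain ⟨v, hv, hvε⟩ := hF.exists_dist_lt (0 : E) (half_pos hε)
  rw [dist_zero_left] at hvε
  have hshift : ∀ a b : E, dist a b < ε / 2 → dist (a - v) b < ε := by
    intro a b h
    have : dist (a - v) a = ‖v‖ := by simp
    linarith [dist_triangle (a - v) a b]
  have hVc : ∀ j, ∀ y ∈ V j, dist (g₁ (c j)) (g₁ y) < ε / 2 ∧ dist (g₂ (c j)) (g₂ y) < ε / 2 :=
    fun j y hy => hc j hy
  refine ⟨⟨fun y => ∑ j, ρ j y • g₁ (c j) - v, by fun_prop⟩,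
    ⟨fun y => ∑ j, ρ j y • g₂ (c j) - v, by fun_prop⟩,
    fun y => hshift _ _ (happrox g₁ (fun j y hy => (hVc j y hy).1) y),
    fun y => hshift _ _ (happrox g₂ (fun j y hy => (hVc j y hy).2) y), fun y t h0 => hv ?_⟩
  let S : Finset κ := Finset.univ.filter fun j => ρ j y ≠ 0
  have hSsum : ∑ j ∈ S, ρ j y = 1 := by
    rw [Finset.sum_filter_ne_zero]; exact hsum y
  obtain ⟨i, hi⟩ : S.Nonempty := by
    by_contra h
    rw [Finset.not_nonempty_iff_eq_empty.1 h] at hSsum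
    simp at hSsum
  refine mem_iUnion.2 ⟨⟨(S, i), hV y S fun j hj => hρV j y (Finset.mem_filter.1 hj).2, hi⟩,
    (fun j => ρ j y, t), ?_⟩
  have hv : v = ∑ j, ρ j y • ((1 - t) • g₁ (c j) + t • g₂ (c j)) := by
    simp only [ContinuousMap.coe_mk] at h0
    have h1 : (1 - t) • (∑ j, ρ j y • g₁ (c j)) + t • (∑ j, ρ j y • g₂ (c j)) = v := by
      rw [← sub_eq_zero, ← h0]; module
    rw [← h1, Finset.smul_sum, Finset.smul_sum, ← Finset.sum_add_distrib]
    exact Finset.sum_congr rfl fun j _ => by module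
  have hvS : v = ∑ j ∈ S, ρ j y • ((1 - t) • g₁ (c j) + t • g₂ (c j)) := by
    rw [hv, Finset.sum_filter_of_ne]
    exact fun j _ h h' => h (by rw [h', zero_smul])
  simp only [F]
  rw [Finset.sum_coe_sort (S.erase i) fun j => ρ j y •
      (((1 - t) • g₁ (c j) + t • g₂ (c j)) - ((1 - t) • g₁ (c i) + t • g₂ (c i))),
    Finset.sum_erase _ (by simp), hvS]
  simp_rw [smul_sub]
  rw [Finset.sum_sub_distrib, ← Finset.sum_smul, hSsum, one_smul]
  abel

end Dimension

section Gluing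

variable {X E : Type*} [TopologicalSpace X] [CompactSpace X] [T2Space X] [NormedAddCommGroup E]
  [InnerProductSpace ℝ E]

omit [CompactSpace X] [T2Space X] in
theorem IsNullDeformation.mono {f g : C(X, E)} {A K K' : Set X} (h : IsNullDeformation f A K g)
    (hK : K' ⊆ K) : IsNullDeformation f A K' g :=
  ⟨fun x hx => h.1 x (hK hx), fun x hx => h.2 x ⟨hx.1, hK hx.2⟩⟩

theorem IsNullDeformation.exists_eqOn {f g g' : C(X, E)} {A K C : Set X} (hA : IsClosed A)
    (hC : IsClosed C) (h : IsNullDeformation f A K g)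
    (hseg : ∀ x ∈ C, ∀ t ∈ Icc (0 : ℝ) 1, (1 - t) • g x + t • g' x ≠ 0)
    (hpos : ∀ x ∈ A ∩ C, 0 < inner ℝ (f x) (g' x)) :
    ∃ g'' : C(X, E), IsNullDeformation f A K g'' ∧ EqOn g'' g' C := by
  let D₁ : Set X := Prod.fst '' {p : X × I | (1 - (p.2 : ℝ)) • g p.1 + (p.2 : ℝ) • g' p.1 = 0}
  let D₂ : Set X := A ∩ {x | inner ℝ (f x) (g' x) ≤ 0}
  have hD₁ : IsClosed D₁ := isClosedMap_fst_of_compactSpace _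
    (isClosed_eq (by fun_prop) continuous_const)
  have hD₂ : IsClosed D₂ := hA.inter (isClosed_le (by fun_prop) continuous_const)
  obtain ⟨θ, hθ0, hθ1, hθ⟩ := exists_continuous_zero_one_of_isClosed (hD₁.union hD₂) hC
    (disjoint_left.2 fun x hx hxC => by
      rcases hx with ⟨⟨y, t⟩, hy, rfl⟩ | hx
      · exact hseg y hxC t t.2 hy
      · exact (hpos x ⟨hx.1, hxC⟩).not_ge hx.2)
  refine ⟨⟨fun x => (1 - θ x) • g x + θ x • g' x, by fun_prop⟩, ⟨fun x hx h0 => ?_,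
    fun x hx => ?_⟩, fun x hx => ?_⟩
  · simp only [ContinuousMap.coe_mk] at h0
    have : θ x = 0 := hθ0 (Or.inl ⟨(x, ⟨θ x, hθ x⟩), h0, rfl⟩)
    simp only [this, sub_zero, one_smul, zero_smul, add_zero] at h0
    exact h.1 x hx h0
  · simp only [ContinuousMap.coe_mk, inner_add_right, inner_smul_right]
    have h1 := h.2 x hx
    by_cases h2 : inner ℝ (f x) (g' x) ≤ 0
    · have : θ x = 0 := hθ0 (Or.inr ⟨hx.1, h2⟩)
      simpa [this] using h1
    · push Not at h2
      rcases (hθ x).1.eq_or_lt with h3 | h3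
      · simpa [← h3] using h1
      · nlinarith [mul_nonneg (sub_nonneg.2 (hθ x).2) h1.le, mul_pos h3 h2]
  · have : θ x = 1 := hθ1 hx
    simp [this]

omit [T2Space X] in
theorem IsNullDeformation.exists_pos {f g : C(X, E)} {A C : Set X} (hA : IsClosed A)
    (hC : IsClosed C) (h : IsNullDeformation f A C g) :
    ∃ ε > 0, ∀ g' : C(X, E), (∀ x ∈ C, dist (g' x) (g x) < ε) → IsNullDeformation f A C g' ∧
      ∀ x ∈ C, ∀ t ∈ Icc (0 : ℝ) 1, (1 - t) • g x + t • g' x ≠ 0 := by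
  obtain ⟨ε₁, hε₁, h₁⟩ := hC.isCompact.exists_forall_le' (f := fun x => ‖g x‖) (a := 0)
    (by fun_prop) (fun x hx => norm_pos_iff.2 (h.1 x hx))
  obtain ⟨ε₂, hε₂, h₂⟩ := (hA.inter hC).isCompact.exists_forall_le'
    (f := fun x => inner ℝ (f x) (g x) / (‖f x‖ + 1)) (a := 0)
    (Continuous.continuousOn ((by fun_prop : Continuous fun x => inner ℝ (f x) (g x)).div
      (by fun_prop) fun x => by positivity))
    (fun x hx => div_pos (h.2 x hx) (by positivity))
  refine ⟨min ε₁ ε₂, lt_min hε₁ hε₂, fun g' hg' => ?_⟩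
  have hseg : ∀ x ∈ C, ∀ t ∈ Icc (0 : ℝ) 1, (1 - t) • g x + t • g' x ≠ 0 := by
    intro x hx t ht h0
    have h3 : g x = t • (g x - g' x) := by
      rw [← sub_eq_zero, ← h0]; module
    have h4 := (hg' x hx).trans_le (min_le_left _ _)
    rw [dist_eq_norm, norm_sub_rev] at h4
    have h5 : ‖g x‖ = t * ‖g x - g' x‖ := by
      conv_lhs => rw [h3]
      rw [norm_smul, Real.norm_of_nonneg ht.1]
    nlinarith [h₁ x hx, mul_le_mul_of_nonneg_right ht.2 (norm_nonneg (g x - g' x))]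
  refine ⟨⟨fun x hx => by simpa using hseg x hx 1 (by simp), fun x hx => ?_⟩, hseg⟩
  have h3 := (hg' x hx.2).trans_le (min_le_right _ _)
  have h4 := h₂ x hx
  rw [le_div_iff₀ (by positivity)] at h4
  have h5 : inner ℝ (f x) (g' x) = inner ℝ (f x) (g x) + inner ℝ (f x) (g' x - g x) := by
    rw [← inner_add_right]; congr 1; abel
  have h6 := (abs_le.1 (abs_real_inner_le_norm (f x) (g' x - g x))).1
  rw [dist_eq_norm] at h3
  nlinarith [mul_le_mul_of_nonneg_left h3.le (norm_nonneg (f x))]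

variable [FiniteDimensional ℝ E]

theorem exists_perturbation_of_covDimLE {C : Set X} (hC : IsClosed C) {m : ℕ}
    (hdim : CovDimLE C m) (hm : m + 1 < Module.finrank ℝ E) (g₁ g₂ : C(X, E)) {ε : ℝ}
    (hε : 0 < ε) :
    ∃ g₁' g₂' : C(X, E), (∀ y ∈ C, dist (g₁' y) (g₁ y) < ε) ∧
      (∀ y ∈ C, dist (g₂' y) (g₂ y) < ε) ∧
      ∀ y ∈ C, ∀ t : ℝ, (1 - t) • g₁' y + t • g₂' y ≠ 0 := by
  have := isCompact_iff_compactSpace.1 hC.isCompact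
  have := TietzeExtension.of_tvs ℝ (E := E)
  obtain ⟨G₁, G₂, h₁, h₂, h₁₂⟩ := hdim.exists_perturbation hm (g₁.restrict C) (g₂.restrict C) hε
  obtain ⟨g₁', rfl⟩ := ContinuousMap.exists_restrict_eq hC G₁
  obtain ⟨g₂', rfl⟩ := ContinuousMap.exists_restrict_eq hC G₂
  exact ⟨g₁', g₂', fun y hy => h₁ ⟨y, hy⟩, fun y hy => h₂ ⟨y, hy⟩, fun y hy => h₁₂ ⟨y, hy⟩⟩

theorem isInessential_of_covDimLE {C : Set X} (hC : IsClosed C) {m : ℕ} (hdim : CovDimLE C m)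
    (hm : m + 1 < Module.finrank ℝ E) {f : C(X, E)} {A : Set X} (hA : IsClosed A)
    (hf : ∀ x ∈ A, f x ≠ 0) : IsInessential f A C := by
  obtain ⟨ε, hε, h⟩ := IsNullDeformation.exists_pos (f := f) (g := f) hA (hA.inter hC)
    ⟨fun x hx => hf x hx.1, fun x hx => real_inner_self_pos.2 (hf x hx.1)⟩
  obtain ⟨g₁, g₂, h₁, -, h₁₂⟩ := exists_perturbation_of_covDimLE hC hdim hm f f hε
  exact ⟨g₁, fun x hx => by simpa using h₁₂ x hx 0,
    fun x hx => (h g₁ fun y hy => h₁ y hy.2).1.2 x ⟨hx.1, hx⟩⟩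

theorem IsInessential.union {f : C(X, E)} {A K₁ K₂ : Set X} (hA : IsClosed A)
    (hK₁ : IsClosed K₁) (hK₂ : IsClosed K₂) (h₁ : IsInessential f A K₁)
    (h₂ : IsInessential f A K₂) {m : ℕ} (hdim : CovDimLE (K₁ ∩ K₂ : Set X) m)
    (hm : m + 1 < Module.finrank ℝ E) : IsInessential f A (K₁ ∪ K₂) := by
  classical
  obtain ⟨g₁, h₁⟩ := h₁
  obtain ⟨g₂, h₂⟩ := h₂
  have hC := hK₁.inter hK₂
  have h₂C := h₂.mono (inter_subset_right (s := K₁))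
  obtain ⟨ε₁, hε₁, H₁⟩ := (h₁.mono (inter_subset_left (t := K₂))).exists_pos hA hC
  obtain ⟨ε₂, hε₂, H₂⟩ := h₂C.exists_pos hA hC
  obtain ⟨g₁', g₂', hg₁', hg₂', hseg⟩ :=
    exists_perturbation_of_covDimLE hC hdim hm g₁ g₂ (lt_min hε₁ hε₂)
  obtain ⟨h₁', s₁⟩ := H₁ g₁' fun y hy => (hg₁' y hy).trans_le (min_le_left _ _)
  obtain ⟨h₂', s₂⟩ := H₂ g₂' fun y hy => (hg₂' y hy).trans_le (min_le_right _ _)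
  obtain ⟨G₁, hG₁, e₁⟩ := h₁.exists_eqOn hA hC s₁ h₁'.2
  obtain ⟨G₂, hG₂, e₂⟩ := hG₁.exists_eqOn hA hC
    (fun x hx t _ => by rw [e₁ hx]; exact hseg x hx t) h₂'.2
  obtain ⟨G₃, hG₃, e₃⟩ := hG₂.exists_eqOn hA hC (g' := g₂)
    (fun x hx t ht => by
      rw [e₂ hx]
      have := s₂ x hx (1 - t) ⟨by linarith [ht.2], by linarith [ht.1]⟩
      rwa [sub_sub_cancel, add_comm] at this) h₂C.2
  have := TietzeExtension.of_tvs ℝ (E := E)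
  have hcont : ContinuousOn (K₁.piecewise G₃ g₂) (K₁ ∪ K₂) :=
    (G₃.continuous.continuousOn.congr fun x hx => piecewise_eq_of_mem _ _ _ hx).union_of_isClosed
      (g₂.continuous.continuousOn.congr fun x hx => by
        by_cases hx₁ : x ∈ K₁
        · rw [piecewise_eq_of_mem _ _ _ hx₁, e₃ ⟨hx₁, hx⟩]
        · exact piecewise_eq_of_notMem _ _ _ hx₁) hK₁ hK₂
  obtain ⟨g, hg⟩ := ContinuousMap.exists_restrict_eq (hK₁.union hK₂) ⟨_, hcont.domRestrict⟩
  have hg' : ∀ x ∈ K₁ ∪ K₂, g x = K₁.piecewise G₃ g₂ x := fun x hx =>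
    DFunLike.congr_fun hg ⟨x, hx⟩
  refine ⟨g, fun x hx => ?_, fun x hx => ?_⟩
  · rw [hg' x hx]
    by_cases hx₁ : x ∈ K₁
    · rw [piecewise_eq_of_mem _ _ _ hx₁]; exact hG₃.1 x hx₁
    · rw [piecewise_eq_of_notMem _ _ _ hx₁]; exact h₂.1 x (hx.resolve_left hx₁)
  · rw [hg' x hx.2]
    by_cases hx₁ : x ∈ K₁
    · rw [piecewise_eq_of_mem _ _ _ hx₁]; exact hG₃.2 x ⟨hx.1, hx₁⟩
    · rw [piecewise_eq_of_notMem _ _ _ hx₁]; exact h₂.2 x ⟨hx.1, hx.2.resolve_left hx₁⟩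

end Gluing

section Separation

theorem CovDimLE.of_isClosedEmbedding {Y Z : Type*} [TopologicalSpace Y] [TopologicalSpace Z]
    {m : ℕ} (hZ : CovDimLE Z m) {e : Y → Z} (he : IsClosedEmbedding e) : CovDimLE Y m := by
  intro ι _ U hU hUc
  choose W hW hWU using fun i => he.isInducing.isOpen_iff.1 (hU i)
  obtain ⟨κ, V, hVo, hVc, hVW, hV⟩ := hZ (Option ι) inferInstance
    (fun i => i.elim (range e)ᶜ W) (by
      rintro (_ | i)
      exacts [he.isClosed_range.isOpen_compl, hW i]) (eq_univ_of_forall fun z => by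
      by_cases hz : z ∈ range e
      · obtain ⟨y, rfl⟩ := hz
        obtain ⟨i, hi⟩ := mem_iUnion.1 (hUc.ge (mem_univ y))
        rw [← hWU i] at hi
        exact mem_iUnion.2 ⟨some i, hi⟩
      · exact mem_iUnion.2 ⟨none, hz⟩)
  refine ⟨{j // ∃ i, V j ⊆ W i}, fun j => e ⁻¹' V j, fun j => (hVo j).preimage he.continuous,
    eq_univ_of_forall fun y => ?_, fun ⟨j, i, hi⟩ => ⟨i, by rw [← hWU i]; exact preimage_mono hi⟩,
    fun y => ?_⟩
  · obtain ⟨j, hj⟩ := mem_iUnion.1 (hVc.ge (mem_univ (e y)))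
    refine mem_iUnion.2 ⟨⟨j, ?_⟩, hj⟩
    obtain ⟨_ | i, hi⟩ := hVW j
    · exact (hi hj ⟨y, rfl⟩).elim
    · exact ⟨i, hi⟩
  · refine le_trans ?_ (hV (e y))
    rw [← (Subtype.val_injective (p := fun j => ∃ i, V j ⊆ W i)).encard_image]
    exact encard_le_encard (by rintro _ ⟨j, hj, rfl⟩; exact hj)

variable {X : Type*} [MetricSpace X] [CompactSpace X]

theorem false_of_homeomorph_images (hhom : ∀ x y : X, ∃ h : X ≃ₜ X, h x = y) {K W₁ W₂ : Set X}
    (hK : K.Nonempty) (hW₁ : IsOpen W₁) (hW₂ : IsOpen W₂) {x : X} (hx₁ : x ∈ closure W₁)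
    (hx₂ : x ∈ closure W₂)
    (h₁₂ : ∀ h : X ≃ₜ X, ∀ k₁ ∈ K, ∀ k₂ ∈ K, h k₁ ∈ W₁ → h k₂ ∈ W₂ → False)
    (hcov : ∀ h : X ≃ₜ X, ∃ k ∈ K, h k ∈ W₁ ∪ W₂) : False := by
  have push : ∀ {W W' : Set X}, IsOpen W → x ∈ closure W' → ∀ z ∈ W,
      ∃ g : X ≃ₜ X, g z ∈ W ∧ g x ∈ W' := by
    intro W W' hW hx z hz
    obtain ⟨ε, hε, hball⟩ := Metric.isOpen_iff.1 hW z hz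
    obtain ⟨δ, hδ, hpush⟩ := exists_small_homeomorph hhom hε
    obtain ⟨x', hx', hxx'⟩ := Metric.mem_closure_iff.1 hx δ hδ
    obtain ⟨g, rfl, hg⟩ := hpush x x' hxx'
    exact ⟨g, hball (hg z), hx'⟩
  obtain ⟨k, hk⟩ := hK
  obtain ⟨h, rfl⟩ := hhom k x
  obtain ⟨k', hk', hW | hW⟩ := hcov h
  · obtain ⟨g, hg, hg'⟩ := push hW₁ hx₂ _ hW
    exact h₁₂ (h.trans g) k' hk' k hk hg hg'
  · obtain ⟨g, hg, hg'⟩ := push hW₂ hx₁ _ hW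
    exact h₁₂ (h.trans g) k hk k' hk' hg' hg

theorem not_covDimLE_of_separates [ConnectedSpace X] (hhom : ∀ x y : X, ∃ h : X ≃ₜ X, h x = y)
    {d m : ℕ} (hX : ¬ CovDimLE X d) (hmd : m < d) {X₁ X₂ : Set X} (hX₁ : IsClosed X₁)
    (hX₂ : IsClosed X₂) (h₁ : X₁ ≠ univ) (h₂ : X₂ ≠ univ) (hu : X₁ ∪ X₂ = univ) :
    ¬ CovDimLE (X₁ ∩ X₂ : Set X) m := by
  intro hdim
  obtain ⟨f, A, hA, hf, hess⟩ := exists_not_isInessential hX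
  obtain ⟨K, -, hK, hKess, hmin⟩ := exists_minimal_closed (P := IsInessential f A)
    (fun K _ h => h.exists_isOpen hA) isClosed_univ hess
  have hm : m + 1 < Module.finrank ℝ (EuclideanSpace ℝ (Fin (d + 1))) := by simpa
  have hsub : ∀ (h : X ≃ₜ X) (C : Set X), IsClosed C → (∀ x ∈ C, h x ∈ X₁ ∩ X₂) →
      CovDimLE C m := fun h C hC hCX => by
    have := isCompact_iff_compactSpace.1 hC.isCompact
    refine hdim.of_isClosedEmbedding (e := fun x : C => ⟨h x, hCX x x.2⟩)
      (Continuous.isClosedEmbedding (by fun_prop) fun a b hab => ?_)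
    exact Subtype.ext (h.injective (congr_arg Subtype.val hab))
  have hcl : closure X₁ᶜ ⊆ X₂ :=
    closure_minimal (fun x hx => (hu.ge (mem_univ x)).resolve_left hx) hX₂
  obtain ⟨x, hx⟩ : (frontier (closure X₁ᶜ)).Nonempty := by
    refine nonempty_frontier_iff.2 ⟨?_, fun h => h₂ (univ_subset_iff.1 (h.symm.le.trans hcl))⟩
    exact (nonempty_compl.2 h₁).closure
  rw [frontier_eq_closure_inter_closure, closure_closure] at hx
  refine false_of_homeomorph_images hhom (K := K) ?_ isClosed_closure.isOpen_compl
    hX₁.isOpen_compl hx.2 hx.1 (fun h k₁ hk₁ k₂ hk₂ hh₁ hh₂ => hKess ?_) fun h => ?_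
  · by_contra hKe
    rw [not_nonempty_iff_eq_empty] at hKe
    exact hKess ⟨f, by simp [hKe], by simp [hKe]⟩
  · have c₁ : IsClosed (K ∩ h ⁻¹' closure X₁ᶜ) := hK.inter (isClosed_closure.preimage h.continuous)
    have c₂ : IsClosed (K ∩ h ⁻¹' X₁) := hK.inter (hX₁.preimage h.continuous)
    have hKu : K = K ∩ h ⁻¹' closure X₁ᶜ ∪ K ∩ h ⁻¹' X₁ := by
      rw [← inter_union_distrib_left, ← preimage_union, eq_comm, inter_eq_left]
      exact fun z _ => (em (h z ∈ X₁)).symm.imp (fun hz => subset_closure hz) id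
    rw [hKu]
    refine IsInessential.union hA c₁ c₂ (hmin _ ⟨inter_subset_left, fun hs => hh₁ (hs hk₁).2⟩ c₁)
      (hmin _ ⟨inter_subset_left, fun hs => hh₂ (hs hk₂).2⟩ c₂)
      (hsub h _ (c₁.inter c₂) fun z hz => ⟨hz.2.2, hcl hz.1.2⟩) hm
  · by_contra! hk
    refine hKess (isInessential_of_covDimLE hK (hsub h K hK fun z hz => ?_) hm hA hf)
    have := hk z hz
    simp only [mem_union, mem_compl_iff, not_or, not_not] at this
    exact ⟨this.2, hcl this.1⟩

end Separation

section Cochains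

variable {X : Type*}

/-- The simplicial coboundary of a cochain with coefficients in `ZMod 2`, where simplices are
given by the lists of their vertices. -/
def cobd : (List X → ZMod 2) → List X → ZMod 2
  | _, [] => 0
  | c, x :: l => c l + cobd (fun m => c (x :: m)) l

/-- The prism operator between the chain maps induced by `f` and `g`. -/
def prism (f g : X → X) : (List X → ZMod 2) → List X → ZMod 2
  | _, [] => 0
  | c, x :: l => c (f x :: g x :: l.map g) + prism f g (fun m => c (f x :: m)) l

/-- Alternating cochains on simplices with `j` vertices. -/
structure IsCochain (j : ℕ) (c : List X → ZMod 2) : Prop where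
  perm : ∀ l l', l.Perm l' → c l = c l'
  dup : ∀ x l, c (x :: x :: l) = 0
  length : ∀ l, l.length ≠ j → c l = 0

@[simp] theorem cobd_nil (c : List X → ZMod 2) : cobd c [] = 0 := rfl

theorem cobd_cons (c : List X → ZMod 2) (x : X) (l : List X) :
    cobd c (x :: l) = c l + cobd (fun m => c (x :: m)) l := rfl

theorem cobd_congr {c c' : List X → ZMod 2} {l : List X}
    (h : ∀ m : List X, m.Sublist l → m.length + 1 = l.length → c m = c' m) :
    cobd c l = cobd c' l := by
  induction l generalizing c c' with
  | nil => rfl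
  | cons x l ih =>
    rw [cobd_cons, cobd_cons, h l (List.sublist_cons_self x l) rfl,
      ih fun m hm hml => h _ (hm.cons_cons x) (by simp [hml])]

@[simp] theorem cobd_zero : cobd (0 : List X → ZMod 2) = 0 := by
  funext l
  induction l with
  | nil => rfl
  | cons x l ih => rw [cobd_cons]; simpa [Pi.zero_def] using ih

theorem cobd_eq_zero {c : List X → ZMod 2} {l : List X}
    (h : ∀ m : List X, m.Sublist l → m.length + 1 = l.length → c m = 0) : cobd c l = 0 :=
  (cobd_congr (c' := 0) h).trans (by simp)

theorem cobd_add (c c' : List X → ZMod 2) : cobd (c + c') = cobd c + cobd c' := by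
  funext l
  induction l generalizing c c' with
  | nil => simp
  | cons x l ih =>
    have := ih (fun m => c (x :: m)) fun m => c' (x :: m)
    simp only [Pi.add_apply] at this ⊢
    rw [cobd_cons, cobd_cons, cobd_cons, show (fun m => (c + c') (x :: m)) =
      (fun m => c (x :: m)) + fun m => c' (x :: m) from rfl, this, Pi.add_apply]
    abel

theorem cobd_cobd (c : List X → ZMod 2) : cobd (cobd c) = 0 := by
  funext l
  induction l generalizing c with
  | nil => rfl
  | cons x l ih =>
    rw [cobd_cons, show (fun m => cobd c (x :: m)) = c + cobd (fun m => c (x :: m)) from rfl,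
      cobd_add, Pi.add_apply, ih, ← add_assoc, CharTwo.add_self_eq_zero]
    simp

theorem cobd_comp_map (c : List X → ZMod 2) (f : X → X) :
    cobd (c ∘ List.map f) = cobd c ∘ List.map f := by
  funext l
  induction l generalizing c with
  | nil => rfl
  | cons x l ih =>
    have := ih fun m => c (f x :: m)
    simp only [Function.comp_apply, List.map_cons, cobd_cons] at this ⊢
    rw [← this]
    rfl

theorem prism_add (f g : X → X) (c c' : List X → ZMod 2) :
    prism f g (c + c') = prism f g c + prism f g c' := by
  funext l
  induction l generalizing c c' with
  | nil => simp [prism]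
  | cons x l ih =>
    have := ih (fun m => c (f x :: m)) fun m => c' (f x :: m)
    simp only [Pi.add_apply, prism] at this ⊢
    rw [show (fun m => c (f x :: m) + c' (f x :: m)) =
      (fun m => c (f x :: m)) + fun m => c' (f x :: m) from rfl, this]
    abel

theorem prism_eq_zero {f g : X → X} {c : List X → ZMod 2} {l : List X}
    (h : ∀ m : List X, m.length = l.length + 1 → (∀ x ∈ m, ∃ y ∈ l, x = f y ∨ x = g y) → c m = 0) :
    prism f g c l = 0 := by
  induction l generalizing c with
  | nil => rfl
  | cons x l ih =>
    rw [prism, h _ (by simp) (by simp; grind), ih, add_zero]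
    intro m hm hml
    exact h _ (by simp [hm]) (by simp; grind)

theorem cobd_prism_add_prism_cobd (f g : X → X) (c : List X → ZMod 2) (l : List X) :
    cobd (prism f g c) l + prism f g (cobd c) l = c (l.map f) + c (l.map g) := by
  induction l generalizing c with
  | nil => simp [prism, CharTwo.add_self_eq_zero]
  | cons x l ih =>
    have h1 := ih fun m => c (f x :: m)
    have h2 : cobd (fun m => prism f g c (x :: m)) l =
        cobd (fun m => c (f x :: g x :: m)) (l.map g) +
          cobd (prism f g fun m => c (f x :: m)) l := by
      rw [← Function.comp_apply (f := cobd _), ← cobd_comp_map, ← Pi.add_apply, ← cobd_add]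
      rfl
    have h3 : prism f g (fun m => cobd c (f x :: m)) l =
        prism f g c l + prism f g (cobd fun m => c (f x :: m)) l := by
      rw [← Pi.add_apply, ← prism_add]
      rfl
    rw [cobd_cons, prism, h2, h3, cobd_cons, cobd_cons, List.map_cons, List.map_cons]
    generalize cobd (fun m => c (f x :: g x :: m)) (l.map g) = a at *
    generalize prism f g c l = b at *
    have ha := CharTwo.add_self_eq_zero a
    have hb := CharTwo.add_self_eq_zero b
    have hc := CharTwo.add_self_eq_zero (c (f x :: l.map g))
    linear_combination h1 + ha + hb + hc

namespace IsCochain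

variable {j : ℕ} {c c' : List X → ZMod 2}

theorem zero : IsCochain j (0 : List X → ZMod 2) := ⟨by simp, by simp, by simp⟩

theorem add (h : IsCochain j c) (h' : IsCochain j c') : IsCochain j (c + c') where
  perm l l' hl := by simp [h.perm l l' hl, h'.perm l l' hl]
  dup x l := by simp [h.dup, h'.dup]
  length l hl := by simp [h.length l hl, h'.length l hl]

theorem eq_zero_of_not_nodup (h : IsCochain j c) {l : List X} (hl : ¬ l.Nodup) : c l = 0 := by
  obtain ⟨x, hx⟩ := List.exists_duplicate_iff_not_nodup.2 hl
  rw [List.duplicate_iff_sublist] at hx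
  obtain ⟨m, hm⟩ := hx.exists_perm_append
  rw [h.perm _ _ hm]
  exact h.dup x m

theorem comp_map (h : IsCochain j c) (f : X → X) : IsCochain j (c ∘ List.map f) where
  perm l l' hl := h.perm _ _ (hl.map f)
  dup x l := h.dup _ _
  length l hl := h.length _ (by simpa)

theorem cobd (h : IsCochain j c) : IsCochain (j + 1) (cobd c) where
  perm l l' hl := by
    replace h := h.perm
    induction hl generalizing c with
    | nil => rfl
    | cons x hl ih =>
      rw [cobd_cons, cobd_cons, h _ _ hl, ih fun m m' hm => h _ _ (hm.cons x)]
    | swap x y l =>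
      have : (fun m => c (x :: y :: m)) = fun m => c (y :: x :: m) :=
        funext fun m => h _ _ (.swap _ _ _)
      simp only [cobd_cons]
      rw [this]
      abel
    | trans _ _ ih₁ ih₂ => rw [ih₁ h, ih₂ h]
  dup x l := by
    have : (fun m => c (x :: x :: m)) = 0 := funext fun m => h.dup x m
    simp [cobd_cons, this, CharTwo.add_self_eq_zero]
  length l hl := cobd_eq_zero fun m _ hm => h.length m (by omega)

end IsCochain

theorem exists_canonical_sort (X : Type*) : ∃ s : List X → List X, (∀ l, (s l).Perm l) ∧
    (∀ l l' : List X, l.Perm l' → s l = s l') ∧ ∀ l m : List X, m.Sublist (s l) → s m = m := by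
  classical
  let := linearOrderOfSTO (WellOrderingRel (α := X))
  have hs := fun l : List X => List.pairwise_insertionSort (· ≤ ·) l
  refine ⟨List.insertionSort (· ≤ ·), List.perm_insertionSort _, fun l l' h => ?_, fun l m h => ?_⟩
  · exact ((List.perm_insertionSort _ l).trans
      (h.trans (List.perm_insertionSort _ l').symm)).eq_of_pairwise'
      (hs l) (hs l')
  · exact ((hs l).sublist h).insertionSort_eq

/-- A choice of ordering of the vertices of every simplex, compatible with faces. -/
noncomputable def canonicalSort : List X → List X := (exists_canonical_sort X).choose

theorem canonicalSort_perm (l : List X) : (canonicalSort l).Perm l :=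
  (exists_canonical_sort X).choose_spec.1 l

theorem canonicalSort_eq_of_perm {l l' : List X} (h : l.Perm l') :
    canonicalSort l = canonicalSort l' :=
  (exists_canonical_sort X).choose_spec.2.1 l l' h

theorem canonicalSort_eq_self {l m : List X} (h : m.Sublist (canonicalSort l)) :
    canonicalSort m = m :=
  (exists_canonical_sort X).choose_spec.2.2 l m h

theorem IsCochain.ext_sorted {j : ℕ} {c c' : List X → ZMod 2} (hc : IsCochain j c)
    (hc' : IsCochain j c')
    (h : ∀ l, (canonicalSort l).Nodup → c (canonicalSort l) = c' (canonicalSort l)) : c = c' := by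
  funext l
  rw [← hc.perm _ _ (canonicalSort_perm l), ← hc'.perm _ _ (canonicalSort_perm l)]
  by_cases hl : (canonicalSort l).Nodup
  · exact h l hl
  · rw [hc.eq_zero_of_not_nodup hl, hc'.eq_zero_of_not_nodup hl]

open Classical in
/-- The prism operator on alternating cochains. -/
noncomputable def altPrism (f g : X → X) (c : List X → ZMod 2) (l : List X) : ZMod 2 :=
  if l.Nodup then prism f g c (canonicalSort l) else 0

theorem altPrism_eq_zero {f g : X → X} {c : List X → ZMod 2} {l : List X}
    (h : ∀ m : List X, (∀ x ∈ m, ∃ y ∈ l, x = f y ∨ x = g y) → c m = 0) :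
    altPrism f g c l = 0 := by
  unfold altPrism
  split_ifs with hl
  · refine prism_eq_zero fun m _ hm => h m fun x hx => ?_
    simpa only [(canonicalSort_perm l).mem_iff] using hm x hx
  · rfl

theorem IsCochain.altPrism {j : ℕ} {c : List X → ZMod 2} (hc : IsCochain (j + 1) c)
    (f g : X → X) : IsCochain j (altPrism f g c) where
  perm l l' hl := by
    classical exact if_congr hl.nodup_iff (by rw [canonicalSort_eq_of_perm hl]) rfl
  dup x l := by simp [_root_.altPrism]
  length l hl := by
    unfold _root_.altPrism
    split_ifs
    · refine prism_eq_zero fun m hm _ => hc.length m ?_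
      rw [(canonicalSort_perm l).length_eq] at hm
      omega
    · rfl

theorem IsCochain.cobd_altPrism_add {j : ℕ} {c : List X → ZMod 2} (hc : IsCochain (j + 1) c)
    (f g : X → X) : _root_.cobd (_root_.altPrism f g c) + _root_.altPrism f g (_root_.cobd c) =
      c ∘ List.map f + c ∘ List.map g := by
  refine ((hc.altPrism f g).cobd.add (hc.cobd.altPrism f g)).ext_sorted
    ((hc.comp_map f).add (hc.comp_map g)) fun l hl => ?_
  have h : ∀ (c : List X → ZMod 2) (m : List X), m.Sublist (canonicalSort l) →
      _root_.altPrism f g c m = prism f g c m := fun c m hm => by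
    rw [_root_.altPrism, if_pos (hl.sublist hm), canonicalSort_eq_self hm]
  simp only [Pi.add_apply, Function.comp_apply]
  rw [cobd_congr fun m hm _ => h c m hm, h _ _ (List.Sublist.refl _),
    cobd_prism_add_prism_cobd]

end Cochains

section LocalCochains

variable {X : Type*} [MetricSpace X]

/-- Simplices with vertices in `S` and diameter less than `ε`. -/
def IsSmall (ε : ℝ) (S : Set X) (l : List X) : Prop :=
  (∀ x ∈ l, x ∈ S) ∧ ∀ x ∈ l, ∀ y ∈ l, dist x y < ε

/-- The cochain `c` vanishes on all sufficiently small simplices of `S`. -/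
def LocZero (S : Set X) (c : List X → ZMod 2) : Prop :=
  ∃ ε > 0, ∀ l, IsSmall ε S l → c l = 0

theorem IsSmall.of_subset {ε : ℝ} {S : Set X} {l m : List X} (h : IsSmall ε S l) (hm : m ⊆ l) :
    IsSmall ε S m :=
  ⟨fun x hx => h.1 x (hm hx), fun x hx y hy => h.2 x (hm hx) y (hm hy)⟩

theorem IsSmall.mono {ε ε' : ℝ} {S S' : Set X} {l : List X} (h : IsSmall ε S l) (hε : ε ≤ ε')
    (hS : ∀ x ∈ l, x ∈ S → x ∈ S') : IsSmall ε' S' l :=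
  ⟨fun x hx => hS x hx (h.1 x hx), fun x hx y hy => (h.2 x hx y hy).trans_le hε⟩

theorem IsSmall.map {ε ε' : ℝ} {S S' : Set X} {l : List X} (h : IsSmall ε S l) {f : X → X}
    (hf : MapsTo f S S') (hε : ∀ x ∈ S, ∀ y ∈ S, dist x y < ε → dist (f x) (f y) < ε') :
    IsSmall ε' S' (l.map f) := by
  simp only [IsSmall, List.forall_mem_map]
  exact ⟨fun x hx => hf (h.1 x hx), fun x hx y hy => hε x (h.1 x hx) y (h.1 y hy) (h.2 x hx y hy)⟩

namespace LocZero

variable {S S' : Set X} {c c' : List X → ZMod 2}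

theorem zero : LocZero S (0 : List X → ZMod 2) := ⟨1, one_pos, fun _ _ => rfl⟩

theorem mono (h : LocZero S c) (hS : S' ⊆ S) : LocZero S' c := by
  obtain ⟨ε, hε, h⟩ := h
  exact ⟨ε, hε, fun l hl => h l (hl.mono le_rfl fun x _ hx => hS hx)⟩

theorem add (h : LocZero S c) (h' : LocZero S c') : LocZero S (c + c') := by
  obtain ⟨ε, hε, h⟩ := h
  obtain ⟨ε', hε', h'⟩ := h'
  refine ⟨min ε ε', lt_min hε hε', fun l hl => ?_⟩
  simp [h l (hl.mono (min_le_left _ _) fun _ _ => id),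
    h' l (hl.mono (min_le_right _ _) fun _ _ => id)]

theorem cobd (h : LocZero S c) : LocZero S (cobd c) := by
  obtain ⟨ε, hε, h⟩ := h
  exact ⟨ε, hε, fun l hl => cobd_eq_zero fun m hm _ => h m (hl.of_subset hm.subset)⟩

theorem congr (h : LocZero S c) (hc : ∀ l : List X, (∀ x ∈ l, x ∈ S) → c l = c' l) :
    LocZero S c' := by
  obtain ⟨ε, hε, h⟩ := h
  exact ⟨ε, hε, fun l hl => (hc l hl.1).symm.trans (h l hl)⟩

theorem comp_map (h : LocZero S c) {f : X → X} (hf : MapsTo f S' S)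
    (hfu : UniformContinuousOn f S') : LocZero S' (c ∘ List.map f) := by
  obtain ⟨ε, hε, h⟩ := h
  obtain ⟨η, hη, hfη⟩ := Metric.uniformContinuousOn_iff.1 hfu ε hε
  exact ⟨η, hη, fun l hl => h _ (hl.map hf hfη)⟩

end LocZero

/-- `f` and `g` map pairs of points of `S` at distance less than `η` to quadruples of points of
diameter less than `ε`. -/
def AreClose (f g : X → X) (S : Set X) (η ε : ℝ) : Prop :=
  ∀ x ∈ S, ∀ y ∈ S, dist x y < η →
    dist (f x) (f y) < ε ∧ dist (f x) (g y) < ε ∧ dist (g x) (g y) < ε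

theorem AreClose.mono {f g : X → X} {S S' : Set X} {η ε : ℝ} (h : AreClose f g S η ε)
    (hS : S' ⊆ S) : AreClose f g S' η ε :=
  fun x hx y hy => h x (hS hx) y (hS hy)

theorem AreClose.altPrism_eq_zero {f g : X → X} {S D : Set X} {η ε : ℝ}
    (h : AreClose f g S η ε) (hf : MapsTo f S D) (hg : MapsTo g S D) {c : List X → ZMod 2}
    (hc : ∀ l, IsSmall ε D l → c l = 0) {l : List X} (hl : IsSmall η S l) :
    altPrism f g c l = 0 := by
  refine _root_.altPrism_eq_zero fun m hm => hc m ⟨fun x hx => ?_, fun x hx y hy => ?_⟩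
  · obtain ⟨y, hy, rfl | rfl⟩ := hm x hx
    exacts [hf (hl.1 y hy), hg (hl.1 y hy)]
  · obtain ⟨u, hu, rfl | rfl⟩ := hm x hx <;> obtain ⟨v, hv, rfl | rfl⟩ := hm y hy <;>
      have h₁ := h u (hl.1 u hu) v (hl.1 v hv) (hl.2 u hu v hv) <;>
      have h₂ := h v (hl.1 v hv) u (hl.1 u hu) (hl.2 v hv u hu)
    exacts [h₁.1, h₁.2.1, dist_comm (g u) (f v) ▸ h₂.2.1, h₁.2.2]

theorem AreClose.of_dist_lt {f g : X → X} {S : Set X} {η ε : ℝ}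
    (hf : ∀ x ∈ S, ∀ y ∈ S, dist x y < η → dist (f x) (f y) < ε)
    (hfg : ∀ x ∈ S, dist (f x) (g x) < ε) : AreClose f g S η (3 * ε) := by
  intro x hx y hy hxy
  have h₁ := hf x hx y hy hxy
  have h₂ := hfg x hx
  have h₃ := hfg y hy
  have h₄ := dist_triangle (f x) (f y) (g y)
  have h₅ := dist_triangle_left (g x) (g y) (f x)
  have := dist_nonneg.trans_lt h₂
  exact ⟨by linarith, by linarith, by linarith⟩

theorem AreClose.cobd_altPrism {f g : X → X} {S D : Set X} {η ε : ℝ} {j : ℕ}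
    (h : AreClose f g S η ε) (hf : MapsTo f S D) (hg : MapsTo g S D) {c : List X → ZMod 2}
    (hcj : IsCochain (j + 1) c) (hc : ∀ l, IsSmall ε D l → cobd c l = 0) {l : List X}
    (hl : IsSmall η S l) :
    cobd (altPrism f g c) l = c (l.map f) + c (l.map g) := by
  have := congr_fun (hcj.cobd_altPrism_add f g) l
  simpa [h.altPrism_eq_zero hf hg hc hl] using this

/-- Cocycles of `K` relative to `A`, of dimension `i`. -/
structure IsCocycle (i : ℕ) (K A : Set X) (c : List X → ZMod 2) : Prop where
  cochain : IsCochain (i + 1) c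
  cobd : LocZero K (cobd c)
  rel : LocZero (A ∩ K) c

/-- The cochain `c` is a coboundary of `K` relative to `A`. -/
def IsTrivialOn (i : ℕ) (K A : Set X) (c : List X → ZMod 2) : Prop :=
  ∃ b, IsCochain i b ∧ LocZero K (c + cobd b) ∧ LocZero (A ∩ K) b

variable {i : ℕ} {K A K' A' : Set X} {c : List X → ZMod 2}

theorem IsCocycle.isTrivialOn_of_subset (hc : IsCocycle i K A c) (h : K ⊆ A) :
    IsTrivialOn i K A c :=
  ⟨0, .zero, by simpa [inter_eq_self_of_subset_right h] using hc.rel, .zero⟩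

theorem IsCocycle.comp_map (hc : IsCocycle i K A c) {f : X → X} (hfK : MapsTo f K' K)
    (hfA : MapsTo f (A' ∩ K') A) (hf : UniformContinuousOn f K') :
    IsCocycle i K' A' (c ∘ List.map f) where
  cochain := hc.cochain.comp_map f
  cobd := by
    rw [cobd_comp_map]
    exact hc.cobd.comp_map hfK hf
  rel := hc.rel.comp_map (fun x hx => ⟨hfA hx, hfK hx.2⟩) (hf.mono inter_subset_right)

theorem IsTrivialOn.comp_map (hc : IsTrivialOn i K A c) {f : X → X} (hfK : MapsTo f K' K)
    (hfA : MapsTo f (A' ∩ K') A) (hf : UniformContinuousOn f K') :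
    IsTrivialOn i K' A' (c ∘ List.map f) := by
  obtain ⟨b, hb, h₁, h₂⟩ := hc
  refine ⟨b ∘ List.map f, hb.comp_map f, ?_,
    h₂.comp_map (fun x hx => ⟨hfA hx, hfK hx.2⟩) (hf.mono inter_subset_right)⟩
  rw [cobd_comp_map]
  exact h₁.comp_map hfK hf

theorem IsTrivialOn.congr {c' : List X → ZMod 2} (hc : IsTrivialOn i K A c)
    (h : ∀ l : List X, (∀ x ∈ l, x ∈ K) → c l = c' l) : IsTrivialOn i K A c' := by
  obtain ⟨b, hb, h₁, h₂⟩ := hc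
  exact ⟨b, hb, h₁.congr fun l hl => by simp [h l hl], h₂⟩

theorem IsCocycle.exists_isOpen_isTrivialOn (hA : IsClosed A) (hc : IsCocycle i K' A c)
    (hK : K ⊆ K') (h : IsTrivialOn i K A c) :
    ∃ O, IsOpen O ∧ K ⊆ O ∧ ∀ L ⊆ O, L ⊆ K' → IsTrivialOn i L A c := by
  classical
  obtain ⟨b, hb, ⟨ε₁, hε₁, h₁⟩, ε₂, hε₂, h₂⟩ := h
  obtain ⟨ε₃, hε₃, h₃⟩ := hc.cobd
  obtain ⟨ε₄, hε₄, h₄⟩ := hc.rel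
  obtain ⟨η, hη, hη'⟩ : ∃ η > 0, 3 * η ≤ min (min ε₁ ε₂) (min ε₃ ε₄) :=
    ⟨min (min ε₁ ε₂) (min ε₃ ε₄) / 3, by positivity, by linarith⟩
  simp only [le_min_iff] at hη'
  let ρ : X → X := fun x => if hx : x ∈ thickening η (A ∩ K) then (mem_thickening_iff.1 hx).choose
    else if hx : x ∈ thickening η K then (mem_thickening_iff.1 hx).choose else x
  have hρA : ∀ x ∈ thickening η (A ∩ K), ρ x ∈ A ∩ K := fun x hx => by
    simp only [ρ, dif_pos hx]
    exact (mem_thickening_iff.1 hx).choose_spec.1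
  have hρK : ∀ x ∈ thickening η K, ρ x ∈ K := fun x hx => by
    by_cases hxA : x ∈ thickening η (A ∩ K)
    · exact (hρA x hxA).2
    · simp only [ρ, dif_neg hxA, dif_pos hx]
      exact (mem_thickening_iff.1 hx).choose_spec.1
  have hρ : ∀ x, dist x (ρ x) < η := fun x => by
    simp only [ρ]
    split_ifs with hx hx
    · exact (mem_thickening_iff.1 hx).choose_spec.2
    · exact (mem_thickening_iff.1 hx).choose_spec.2
    · simpa
  have hclose : AreClose id ρ univ η (3 * η) :=
    .of_dist_lt (fun _ _ _ _ => id) fun x _ => hρ x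
  refine ⟨thickening η K ∩ (Aᶜ ∪ thickening η (A ∩ K)), isOpen_thickening.inter
    (hA.isOpen_compl.union isOpen_thickening), fun x hx => ⟨self_subset_thickening hη _ hx,
      (em (x ∈ A)).symm.imp id fun hxA => self_subset_thickening hη _ ⟨hxA, hx⟩⟩,
    fun L hLO hLK => ⟨b ∘ List.map ρ + altPrism id ρ c,
      (hb.comp_map ρ).add (hc.cochain.altPrism id ρ), ⟨η, hη, fun l hl => ?_⟩,
      η, hη, fun l hl => ?_⟩⟩
  · have e₁ := (hclose.mono (subset_univ L)).cobd_altPrism (fun x hx => hLK hx)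
      (fun x hx => hK (hρK x (hLO hx).1)) hc.cochain
      (fun m hm => h₃ m (hm.mono hη'.2.1 fun _ _ => id)) hl
    have e₂ := h₁ (l.map ρ) (hl.map (fun x hx => hρK x (hLO hx).1)
      fun x _ y _ hxy => (hclose x trivial y trivial hxy).2.2.trans_le hη'.1.1)
    rw [List.map_id] at e₁
    simp only [Pi.add_apply] at e₂ ⊢
    rw [cobd_add, cobd_comp_map, Pi.add_apply, e₁, Function.comp_apply]
    linear_combination e₂ + CharTwo.add_self_eq_zero (c l)
  · have hLA : ∀ x ∈ A ∩ L, ρ x ∈ A ∩ K := fun x hx =>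
      hρA x ((hLO hx.2).2.resolve_left (not_not.2 hx.1))
    have e₁ := (hclose.mono (subset_univ (A ∩ L))).altPrism_eq_zero (D := A ∩ K')
      (fun x hx => ⟨hx.1, hLK hx.2⟩) (fun x hx => ⟨(hLA x hx).1, hK (hLA x hx).2⟩)
      (fun m hm => h₄ m (hm.mono hη'.2.2 fun _ _ => id)) hl
    have e₂ := h₂ (l.map ρ) (hl.map hLA
      fun x _ y _ hxy => (hclose x trivial y trivial hxy).2.2.trans_le hη'.1.2)
    simp [e₁, e₂]

end LocalCochains

section Membranes

variable {X : Type*} [MetricSpace X] {i : ℕ} {K A : Set X} {c : List X → ZMod 2}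

/-- All cocycles of dimension `i` relative to closed subsets are coboundaries. -/
def CohomologyVanishes (i : ℕ) (X : Type*) [MetricSpace X] : Prop :=
  ∀ (A : Set X) (c : List X → ZMod 2), IsClosed A → IsCocycle i univ A c → IsTrivialOn i univ A c

theorem not_cohomologyVanishes_zero [Nonempty X] : ¬ CohomologyVanishes 0 X := by
  classical
  intro h
  obtain ⟨b, hb, ⟨ε, hε, h₁⟩, ε', hε', h₂⟩ := h ∅ (fun l => if l.length = 1 then 1 else 0)
    isClosed_empty
    { cochain :=
        { perm l l' hl := by simp [hl.length_eq]
          dup x l := by simp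
          length l hl := by simpa using hl }
      cobd := ⟨1, one_pos, fun l _ => by
        match l with
        | [] => rfl
        | [x] => simp [cobd_cons]
        | [x, y] => simp [cobd_cons, CharTwo.add_self_eq_zero]
        | x :: y :: z :: l => exact cobd_eq_zero fun m _ hm => by simp at hm ⊢; omega⟩
      rel := ⟨1, one_pos, fun l hl => by
        cases l with
        | nil => simp
        | cons x l => exact absurd (hl.1 x (by simp)) (by simp)⟩ }
  obtain ⟨x⟩ := ‹Nonempty X›
  have e₁ := h₁ [x] (by simp [IsSmall, hε])
  have e₂ := h₂ [] (by simp [IsSmall])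
  simp [cobd_cons, e₂] at e₁

theorem cohomologyVanishes_of_covDimLE [CompactSpace X] [Nonempty X] {n : ℕ}
    (hX : CovDimLE X n) (hi : n < i) :
    CohomologyVanishes i X := by
  classical
  intro A c hA hc
  obtain ⟨ε₁, hε₁, h₁⟩ := hc.cobd
  obtain ⟨ε₂, hε₂, h₂⟩ := hc.rel
  obtain ⟨ε, hε, hε'⟩ : ∃ ε > 0, 3 * (2 * ε) ≤ min ε₁ ε₂ :=
    ⟨min ε₁ ε₂ / 6, by positivity, by linarith⟩
  rw [le_min_iff] at hε'
  obtain ⟨κ, _, V, hVo, hVc, hVU, hV⟩ := hX.exists_fintype_refinement (fun x => ball x ε)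
    (fun x => isOpen_ball) fun x => mem_ball_self hε
  obtain ⟨η, hη, hleb⟩ := lebesgue_number_lemma_of_metric isCompact_univ hVo hVc.ge
  choose v hv using fun x => hleb x (mem_univ x)
  have hvx : ∀ x, x ∈ V (v x) := fun x => hv x (mem_ball_self hη)
  have hp : ∀ j, ∃ p : X, ((V j).Nonempty → p ∈ V j) ∧ ((A ∩ V j).Nonempty → p ∈ A ∩ V j) := by
    intro j
    by_cases hj : (A ∩ V j).Nonempty
    · exact ⟨hj.some, fun _ => hj.some_mem.2, fun _ => hj.some_mem⟩
    · by_cases hj' : (V j).Nonempty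
      · exact ⟨hj'.some, fun _ => hj'.some_mem, fun h => (hj h).elim⟩
      · exact ⟨Classical.arbitrary X, fun h => (hj' h).elim, fun h => (hj h).elim⟩
  choose p hpV hpA using hp
  have hdist : ∀ x, dist x (p (v x)) < 2 * ε := fun x => by
    obtain ⟨y, hy⟩ := hVU (v x)
    have e₁ := hy (hvx x)
    have e₂ := hy (hpV (v x) ⟨x, hvx x⟩)
    rw [mem_ball] at e₁ e₂
    linarith [dist_triangle_right x (p (v x)) y]
  have hpA' : ∀ x ∈ A, p (v x) ∈ A := fun x hx => (hpA (v x) ⟨x, hx, hvx x⟩).1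
  have hclose : AreClose id (p ∘ v) univ (2 * ε) (3 * (2 * ε)) :=
    .of_dist_lt (fun _ _ _ _ => id) fun x _ => hdist x
  refine ⟨altPrism id (p ∘ v) c, hc.cochain.altPrism _ _, ⟨min (2 * ε) η,
    lt_min (by positivity) hη, fun l hl => ?_⟩, 2 * ε, by positivity, fun l hl => ?_⟩
  · have e₁ := hclose.cobd_altPrism (mapsTo_univ _ _) (mapsTo_univ _ _) hc.cochain
      (fun m hm => h₁ m (hm.mono hε'.1 fun _ _ => id))
      (hl.mono (min_le_left _ _) fun _ _ => id)
    have e₂ : c (l.map (p ∘ v)) = 0 := by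
      by_cases hlen : l.length = i + 1
      · refine hc.cochain.eq_zero_of_not_nodup fun hnd => ?_
        rw [← List.map_map] at hnd
        have hnd' := List.Nodup.of_map _ hnd
        obtain ⟨x, hx⟩ : ∃ x, x ∈ l := List.exists_mem_of_length_pos (by omega)
        have := hV x (l.map v).toFinset fun j hj => by
          obtain ⟨y, hy, rfl⟩ := List.mem_map.1 (List.mem_toFinset.1 hj)
          exact hv y ((hl.2 x hx y hy).trans_le (min_le_right _ _))
        rw [List.toFinset_card_of_nodup hnd', List.length_map] at this
        omega
      · exact hc.cochain.length _ (by simpa using hlen)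
    rw [e₂, List.map_id, add_zero] at e₁
    rw [Pi.add_apply, e₁, CharTwo.add_self_eq_zero]
  · exact (hclose.mono (subset_univ _)).altPrism_eq_zero (D := A ∩ univ) (fun x hx => hx)
      (fun x hx => ⟨hpA' x hx.1, trivial⟩)
      (fun m hm => h₂ m (hm.mono hε'.2 fun _ _ => id)) hl

theorem exists_chain_homotopy [CompactSpace X] (hc : IsCochain (i + 1) c) {ε : ℝ} (hε : 0 < ε)
    {A D : Set X} (h₁ : ∀ l, IsSmall (3 * ε) univ l → cobd c l = 0)
    (h₂ : ∀ l, IsSmall (3 * ε) D l → c l = 0) (h : ℕ → X → X) (hh : ∀ s, Continuous (h s))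
    (hstep : ∀ s x, dist (h s x) (h (s + 1) x) < ε) (hAD : ∀ s, MapsTo (h s) A D) (N : ℕ) :
    ∃ b, IsCochain i b ∧ LocZero univ (c ∘ List.map (h 0) + c ∘ List.map (h N) + cobd b) ∧
      LocZero A b := by
  induction N with
  | zero => exact ⟨0, .zero, ⟨1, one_pos, fun l _ => by simp [CharTwo.add_self_eq_zero]⟩, .zero⟩
  | succ N ih =>
    obtain ⟨b, hb, hb₁, hb₂⟩ := ih
    obtain ⟨η, hη, hu⟩ := Metric.uniformContinuous_iff.1
      (CompactSpace.uniformContinuous_of_continuous (hh N)) ε hε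
    have hclose : AreClose (h N) (h (N + 1)) univ η (3 * ε) :=
      .of_dist_lt (fun x _ y _ hxy => hu hxy) fun x _ => hstep N x
    refine ⟨b + altPrism (h N) (h (N + 1)) c, hb.add (hc.altPrism _ _), ?_, hb₂.add
      ⟨η, hη, fun l hl => (hclose.mono (subset_univ A)).altPrism_eq_zero (hAD N) (hAD (N + 1)) h₂
        hl⟩⟩
    have : LocZero univ (c ∘ List.map (h N) + c ∘ List.map (h (N + 1)) +
        cobd (altPrism (h N) (h (N + 1)) c)) :=
      ⟨η, hη, fun l hl => by
        simp [hclose.cobd_altPrism (mapsTo_univ _ _) (mapsTo_univ _ _) hc h₁ hl,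
          CharTwo.add_self_eq_zero]⟩
    convert hb₁.add this using 1
    funext l
    simp only [cobd_add, Pi.add_apply]
    linear_combination - CharTwo.add_self_eq_zero ((c ∘ List.map (h N)) l)

end Membranes

section MinimalCarriers

variable {X : Type*} [MetricSpace X] {i : ℕ} {K K₁ A : Set X} {c : List X → ZMod 2}

open Classical in
/-- Restriction of a cochain to the simplices of `S`, extended by zero. -/
noncomputable def cutoff {X : Type*} (S : Set X) (c : List X → ZMod 2) (l : List X) : ZMod 2 :=
  if ∀ x ∈ l, x ∈ S then c l else 0

omit [MetricSpace X] in
theorem cutoff_of_mem {S : Set X} {l : List X} (h : ∀ x ∈ l, x ∈ S) : cutoff S c l = c l :=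
  if_pos h

omit [MetricSpace X] in
theorem cutoff_eq_zero {S : Set X} {l : List X} (h : (∀ x ∈ l, x ∈ S) → c l = 0) :
    cutoff S c l = 0 := by
  unfold cutoff
  split_ifs with hl
  exacts [h hl, rfl]

omit [MetricSpace X] in
theorem cobd_cutoff_of_mem {S : Set X} {l : List X} (h : ∀ x ∈ l, x ∈ S) :
    cobd (cutoff S c) l = cobd c l :=
  cobd_congr fun _ hm _ => cutoff_of_mem fun x hx => h x (hm.subset hx)

omit [MetricSpace X] in
theorem IsCochain.cutoff {j : ℕ} (h : IsCochain j c) (S : Set X) : IsCochain j (cutoff S c) where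
  perm l l' hl := by
    classical
    exact if_congr (by simp only [hl.mem_iff]) (h.perm l l' hl) rfl
  dup x l := cutoff_eq_zero fun _ => h.dup x l
  length l hl := cutoff_eq_zero fun _ => h.length l hl

theorem exists_cohomologous_isCocycle (hc : IsCocycle i K A c) (hK₁ : A ∩ K ⊆ K₁)
    (h : IsTrivialOn i K₁ A c) :
    ∃ b, IsCochain i b ∧ LocZero (A ∩ K) b ∧ IsCocycle i K A (c + cobd b) ∧
      LocZero K₁ (c + cobd b) := by
  obtain ⟨b, hb, h₁, h₂⟩ := h
  refine ⟨b, hb, h₂.mono (subset_inter inter_subset_left hK₁),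
    ⟨hc.cochain.add hb.cobd, ?_, h₁.mono hK₁⟩, h₁⟩
  rw [cobd_add, cobd_cobd, add_zero]
  exact hc.cobd

theorem exists_localization (hc : IsCocycle i K A c) (hnt : ¬ IsTrivialOn i K A c)
    {p : X} {r : ℝ} (hr : 0 < r) (hA : Disjoint A (ball p r))
    (h : IsTrivialOn i (K \ ball p (r / 2)) A c) :
    ∃ c', IsCocycle i (K ∩ closedBall p r) (ball p (r / 2))ᶜ c' ∧
      ¬ IsTrivialOn i (K ∩ closedBall p r) (ball p (r / 2))ᶜ c' := by
  have hA' : ∀ x ∈ A, x ∉ ball p (r / 2) := fun x hx hx' =>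
    disjoint_left.1 hA hx (ball_subset_ball (by linarith) hx')
  obtain ⟨b, hb, hbA, hc', hcK⟩ := exists_cohomologous_isCocycle hc (K₁ := K \ ball p (r / 2))
    (fun x hx => ⟨hx.2, hA' x hx.1⟩) h
  refine ⟨c + cobd b, ⟨hc'.cochain, hc'.cobd.mono inter_subset_left,
    hcK.mono fun x hx => ⟨hx.2.1, hx.1⟩⟩, fun ⟨b', hb', ⟨ε₁, hε₁, h₁⟩, ε₂, hε₂, h₂⟩ => hnt ?_⟩
  obtain ⟨ε₃, hε₃, h₃⟩ := hcK
  refine ⟨b + cutoff (closedBall p r) b', hb.add (hb'.cutoff _), ?_, hbA.add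
    ⟨ε₂, hε₂, fun l hl => cutoff_eq_zero fun hl' => h₂ l (hl.mono le_rfl fun x hx hxK =>
      ⟨hA' x hxK.1, hxK.2, hl' x hx⟩)⟩⟩
  rw [cobd_add, ← add_assoc]
  refine ⟨min (min ε₁ ε₂) (min ε₃ (r / 2)), by positivity, fun l hl => ?_⟩
  rw [Pi.add_apply]
  by_cases hlr : ∀ x ∈ l, x ∈ closedBall p r
  · rw [cobd_cutoff_of_mem hlr]
    exact h₁ l (hl.mono ((min_le_left _ _).trans (min_le_left _ _)) fun x hx hxK => ⟨hxK, hlr x hx⟩)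
  · push Not at hlr
    obtain ⟨x, hx, hxr⟩ := hlr
    have hout : ∀ y ∈ l, y ∉ ball p (r / 2) := fun y hy hyp => by
      have e₁ := (hl.2 x hx y hy).trans_le ((min_le_right _ _).trans (min_le_right _ _))
      rw [mem_closedBall] at hxr
      rw [mem_ball] at hyp
      linarith [dist_triangle x y p]
    rw [h₃ l (hl.mono ((min_le_right _ _).trans (min_le_left _ _)) fun y hy hyK =>
      ⟨hyK, hout y hy⟩), zero_add]
    exact cobd_eq_zero fun m hm _ => cutoff_eq_zero fun hmr => h₂ m
      ((hl.of_subset hm.subset).mono ((min_le_left _ _).trans (min_le_right _ _)) fun y hy hyK =>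
        ⟨hout y (hm.subset hy), hyK, hmr y hy⟩)

variable [CompactSpace X]

/-- A minimal closed set carrying a nontrivial relative cocycle is a neighbourhood of each of its
points off the boundary. -/
theorem mem_nhds_of_minimal (hhom : ∀ x y : X, ∃ h : X ≃ₜ X, h x = y)
    (hchain : ∀ ε > 0, ∃ δ > 0, ∀ g : X → X, Continuous g → (∀ z, dist (g z) z < δ) →
      IsChainJoined ε g)
    (hvan : CohomologyVanishes (i + 1) X) (hK : IsClosed K) (hA : IsClosed A)
    (hc : IsCocycle i K A c) (hnt : ¬ IsTrivialOn i K A c)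
    (hmin : ∀ K' ⊂ K, IsClosed K' → IsTrivialOn i K' A c) {p : X} (hpK : p ∈ K) (hpA : p ∉ A) :
    K ∈ 𝓝 p := by
  by_contra hKp
  obtain ⟨r, hr, hrA⟩ : ∃ r > 0, ∀ x ∈ A, 2 * r ≤ dist x p := by
    obtain ⟨s, hs, hsA⟩ := Metric.isOpen_iff.1 hA.isOpen_compl p hpA
    refine ⟨s / 2, half_pos hs, fun x hx => ?_⟩
    by_contra! hlt
    exact hsA (mem_ball.2 (by linarith)) hx
  obtain ⟨δ, hδ, hδr⟩ := hchain r hr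
  obtain ⟨δ', hδ', hpush⟩ := exists_small_homeomorph hhom hδ
  obtain ⟨q, hqp, hqK⟩ : ∃ q, dist q p < δ' ∧ q ∉ K := by
    by_contra! hq
    exact hKp (Metric.mem_nhds_iff.2 ⟨δ', hδ', hq⟩)
  obtain ⟨h, hhq, hhδ⟩ := hpush q p hqp
  obtain ⟨r₁, hr₁, hr₁r, hKr₁⟩ : ∃ r₁ > 0, r₁ ≤ r ∧ MapsTo h K (ball p r₁)ᶜ := by
    have hp : p ∈ (h '' K)ᶜ := by
      rintro ⟨z, hz, hzp⟩
      rw [← hhq] at hzp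
      exact hqK (h.injective hzp ▸ hz)
    obtain ⟨s, hs, hsK⟩ := Metric.isOpen_iff.1 (h.isClosedMap K hK).isOpen_compl p hp
    exact ⟨min s r, lt_min hs hr, min_le_right _ _, fun z hz hzs =>
      hsK (ball_subset_ball (min_le_left _ _) hzs) ⟨z, hz, rfl⟩⟩
  have hrA' : ∀ x ∈ A, x ∉ ball p r₁ := fun x hx hxp => by
    have := hrA x hx
    rw [mem_ball] at hxp
    linarith
  have hball : ball p (r₁ / 2) ⊆ ball p r₁ := ball_subset_ball (by linarith)
  obtain ⟨b, hb, hbA, hc', ε₁, hε₁, h₁⟩ := exists_cohomologous_isCocycle hc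
    (K₁ := K \ ball p (r₁ / 2))
    (fun x hx => ⟨hx.2, fun hxp => hrA' x hx.1 (hball hxp)⟩)
    (hmin _ ⟨sdiff_subset, fun hs => (hs hpK).2 (mem_ball_self (half_pos hr₁))⟩
      (hK.sdiff isOpen_ball))
  set c' := c + cobd b with hc'_def
  have hu := hc'.cochain.cutoff K
  have hδu : LocZero ((K ∪ (ball p r₁)ᶜ) ∩ univ) (cobd (cutoff K c')) := by
    obtain ⟨ε₂, hε₂, h₂⟩ := hc'.cobd
    refine ⟨min (min ε₁ ε₂) (r₁ / 2), by positivity, fun l hl => ?_⟩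
    by_cases hlK : ∀ x ∈ l, x ∈ K
    · rw [cobd_cutoff_of_mem hlK]
      exact h₂ l (hl.mono ((min_le_left _ _).trans (min_le_right _ _)) fun x hx _ => hlK x hx)
    · push Not at hlK
      obtain ⟨x, hx, hxK⟩ := hlK
      have hxp : x ∉ ball p r₁ := (hl.1 x hx).1.resolve_left hxK
      refine cobd_eq_zero fun m hm _ => cutoff_eq_zero fun hmK => h₁ m ((hl.of_subset
        hm.subset).mono ((min_le_left _ _).trans (min_le_left _ _)) fun y hy _ =>
          ⟨hmK y hy, fun hyp => hxp ?_⟩)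
      have e₁ := (hl.2 x hx y (hm.subset hy)).trans_le (min_le_right _ _)
      rw [mem_ball] at hyp ⊢
      linarith [dist_triangle x y p]
  obtain ⟨e, he, heδ, heA⟩ := hvan (K ∪ (ball p r₁)ᶜ) (cobd (cutoff K c'))
    (hK.union isOpen_ball.isClosed_compl)
    ⟨hu.cobd, by rw [cobd_cobd]; exact .zero, hδu⟩
  rw [inter_univ] at heA
  rw [← cobd_add] at heδ
  set w := cutoff K c' + e with hw_def
  have hw : IsCochain (i + 1) w := hu.add he
  have hwB : LocZero (ball p r₁)ᶜ w :=
    LocZero.add ⟨ε₁, hε₁, fun l hl => cutoff_eq_zero fun hlK => h₁ l (hl.mono le_rfl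
      fun x hx hxp => ⟨hlK x hx, fun hxp' => hxp (hball hxp')⟩)⟩ (heA.mono subset_union_right)
  have hwK : LocZero K (c' + w) := by
    refine (heA.mono subset_union_left).congr fun l hl => ?_
    rw [Pi.add_apply, hw_def, Pi.add_apply, cutoff_of_mem hl]
    linear_combination -CharTwo.add_self_eq_zero (c' l)
  have hwg : LocZero K (w ∘ List.map h) := hwB.comp_map hKr₁
    (CompactSpace.uniformContinuous_of_continuous h.continuous).uniformContinuousOn
  obtain ⟨ε₂, hε₂, h₂⟩ := heδ
  obtain ⟨ε₃, hε₃, h₃⟩ := hwB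
  obtain ⟨ε, hε, hε'⟩ : ∃ ε > 0, 3 * ε ≤ min ε₂ ε₃ :=
    ⟨min ε₂ ε₃ / 3, by positivity, by linarith⟩
  rw [le_min_iff] at hε'
  obtain ⟨N, H, hH₀, hHN, hHc, hHr, hHε⟩ := hδr h h.continuous hhδ ε hε
  obtain ⟨b', hb', hb'w, hb'A⟩ := exists_chain_homotopy hw hε (A := A) (D := (ball p r₁)ᶜ)
    (fun l hl => h₂ l (hl.mono hε'.1 fun _ _ => id))
    (fun l hl => h₃ l (hl.mono hε'.2 fun _ _ => id)) H hHc hHε (fun s x hx hxp => by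
      have e₁ := hHr s x
      have e₂ := hrA x hx
      rw [mem_ball] at hxp
      linarith [dist_triangle_left x p (H s x)]) N
  refine hnt ⟨b + b', hb.add hb', ?_, hbA.add (hb'A.mono inter_subset_left)⟩
  convert (hwK.add (hb'w.mono (subset_univ K))).add hwg using 1
  funext l
  simp only [hH₀, hHN, cobd_add, Pi.add_apply, hc'_def, Function.comp_apply, List.map_id]
  linear_combination -CharTwo.add_self_eq_zero (w l) - CharTwo.add_self_eq_zero (w (l.map h))

end MinimalCarriers

section Domain

variable {X : Type*} [MetricSpace X] [CompactSpace X] {i : ℕ} {K A : Set X} {c : List X → ZMod 2}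

theorem exists_minimal_nontrivial (hK : IsClosed K) (hA : IsClosed A) (hc : IsCocycle i K A c)
    (hnt : ¬ IsTrivialOn i K A c) :
    ∃ K' ⊆ K, IsClosed K' ∧ IsCocycle i K' A c ∧ ¬ IsTrivialOn i K' A c ∧
      (∀ L ⊂ K', IsClosed L → IsTrivialOn i L A c) ∧ ∃ p ∈ K', p ∉ A := by
  obtain ⟨K', hK'K, hK', hnt', hmin⟩ := exists_minimal_closed
    (P := fun L => IsTrivialOn i (L ∩ K) A c) (fun L _ hL => by
      obtain ⟨O, hO, hLO, h⟩ := hc.exists_isOpen_isTrivialOn hA inter_subset_right hL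
      refine ⟨O ∪ Kᶜ, hO.union hK.isOpen_compl, fun x hx => ?_, fun L' _ hL' =>
        h _ (fun x hx => (hL' hx.1).resolve_right (not_not.2 hx.2)) inter_subset_right⟩
      by_cases hxK : x ∈ K
      exacts [.inl (hLO ⟨hx, hxK⟩), .inr hxK]) hK (by rwa [inter_self])
  rw [inter_eq_self_of_subset_left hK'K] at hnt'
  have hc' : IsCocycle i K' A c :=
    ⟨hc.cochain, hc.cobd.mono hK'K, hc.rel.mono (inter_subset_inter_right A hK'K)⟩
  refine ⟨K', hK'K, hK', hc', hnt', fun L hL hLc => ?_, ?_⟩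
  · simpa [inter_eq_self_of_subset_left (hL.subset.trans hK'K)] using hmin L hL hLc
  · by_contra! h
    exact hnt' (hc'.isTrivialOn_of_subset h)

/-- Nontrivial relative cocycles can be found on minimal closed sets in every neighbourhood of every
point. -/
theorem exists_minimal_nontrivial_near (hhom : ∀ x y : X, ∃ h : X ≃ₜ X, h x = y)
    (hvan : ¬ CohomologyVanishes i X) {x : X} {U : Set X} (hU : U ∈ 𝓝 x) :
    ∃ (K A : Set X) (c : List X → ZMod 2), IsClosed K ∧ IsClosed A ∧ IsCocycle i K A c ∧
      ¬ IsTrivialOn i K A c ∧ (∀ L ⊂ K, IsClosed L → IsTrivialOn i L A c) ∧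
      ∃ (q : X) (f : X ≃ₜ X), q ∈ K ∧ q ∉ A ∧ f q = x ∧ MapsTo f K U := by
  simp only [CohomologyVanishes, not_forall] at hvan
  obtain ⟨A, c, hA, hc, hnt⟩ := hvan
  obtain ⟨K, -, hK, hc, hnt, hmin, p, hpK, hpA⟩ := exists_minimal_nontrivial isClosed_univ hA hc hnt
  obtain ⟨ε, hε, hεU⟩ := Metric.mem_nhds_iff.1 hU
  obtain ⟨δ, hδ, hpush⟩ := exists_small_homeomorph hhom (half_pos hε)
  obtain ⟨h, rfl⟩ := hhom p x
  obtain ⟨r₁, hr₁, hr₁A⟩ := Metric.isOpen_iff.1 hA.isOpen_compl p hpA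
  obtain ⟨r₂, hr₂, hr₂h⟩ := Metric.mem_nhds_iff.1
    (h.continuous.continuousAt.preimage_mem_nhds (ball_mem_nhds (h p) (lt_min hδ (half_pos hε))))
  obtain ⟨r, hr, hrr⟩ : ∃ r > 0, r < min r₁ r₂ := exists_between (lt_min hr₁ hr₂)
  rw [lt_min_iff] at hrr
  obtain ⟨c', hc', hnt'⟩ := exists_localization hc hnt hr
    (disjoint_right.2 fun y hy => hr₁A (ball_subset_ball hrr.1.le hy))
    (hmin _ ⟨sdiff_subset, fun hs => (hs hpK).2 (mem_ball_self (half_pos hr))⟩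
      (hK.sdiff isOpen_ball))
  have hA' : IsClosed (ball p (r / 2))ᶜ := isOpen_ball.isClosed_compl
  obtain ⟨K', hK'K, hK', hc', hnt', hmin', q, hqK, hqA⟩ :=
    exists_minimal_nontrivial (hK.inter isClosed_closedBall) hA' hc' hnt'
  have hKh : ∀ y ∈ K', dist (h y) (h p) < min δ (ε / 2) := fun y hy =>
    hr₂h (closedBall_subset_ball hrr.2 (hK'K hy).2)
  obtain ⟨g, hgq, hg⟩ := hpush (h q) (h p) ((hKh q hqK).trans_le (min_le_left _ _))
  refine ⟨K', _, c', hK', hA', hc', hnt', hmin', q, h.trans g, hqK, hqA, hgq, fun y hy => hεU ?_⟩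
  have e₁ := (hKh y hy).trans_le (min_le_right _ _)
  have e₂ := hg (h y)
  rw [Homeomorph.trans_apply, mem_ball]
  linarith [dist_triangle (g (h y)) (h y) (h p)]

theorem mem_nhds_image_of_minimal (hhom : ∀ x y : X, ∃ h : X ≃ₜ X, h x = y)
    (hchain : ∀ ε > 0, ∃ δ > 0, ∀ g : X → X, Continuous g → (∀ z, dist (g z) z < δ) →
      IsChainJoined ε g)
    (hvan : CohomologyVanishes (i + 1) X) (hK : IsClosed K) (hA : IsClosed A)
    (hc : IsCocycle i K A c) (hnt : ¬ IsTrivialOn i K A c)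
    (hmin : ∀ L ⊂ K, IsClosed L → IsTrivialOn i L A c) {q : X} (hqK : q ∈ K) (hqA : q ∉ A)
    {F : X → X} (hF : ContinuousOn F K) (hFi : InjOn F K) : F '' K ∈ 𝓝 (F q) := by
  have : Nonempty X := ⟨q⟩
  set G := Function.invFunOn F K with hG
  have hGF : ∀ x ∈ K, G (F x) = x := fun x hx => hFi.leftInvOn_invFunOn hx
  have hFK : IsCompact (F '' K) := hK.isCompact.image_of_continuousOn hF
  have hFA : IsClosed (F '' (A ∩ K)) :=
    ((hA.inter hK).isCompact.image_of_continuousOn (hF.mono inter_subset_right)).isClosed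
  have hGK : MapsTo G (F '' K) K := by
    rintro _ ⟨x, hx, rfl⟩
    rwa [hGF x hx]
  have hGA : MapsTo G (F '' (A ∩ K)) A := by
    rintro _ ⟨x, hx, rfl⟩
    rw [hGF x hx.2]
    exact hx.1
  have hFG : ∀ y ∈ F '' K, F (G y) = y := by
    rintro _ ⟨x, hx, rfl⟩
    rw [hGF x hx]
  have hGc : ContinuousOn G (F '' K) := by
    rw [continuousOn_iff_isClosed]
    intro t ht
    refine ⟨F '' (t ∩ K), ((ht.inter hK).isCompact.image_of_continuousOn
      (hF.mono inter_subset_right)).isClosed, Subset.antisymm ?_ ?_⟩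
    · rintro y ⟨hyt, hy⟩
      exact ⟨⟨G y, ⟨hyt, hGK hy⟩, hFG y hy⟩, hy⟩
    · rintro y ⟨⟨x, hx, rfl⟩, hy⟩
      exact ⟨mem_preimage.2 ((hGF x hx.2).symm ▸ hx.1), hy⟩
  have hGu := hFK.uniformContinuousOn_of_continuous hGc
  have hFu := hK.isCompact.uniformContinuousOn_of_continuous hF
  refine mem_nhds_of_minimal hhom hchain hvan hFK.isClosed hFA
    (hc.comp_map hGK (hGA.mono_left inter_subset_left) hGu) (fun h => hnt ?_) (fun L hL hLc => ?_)
    (mem_image_of_mem F hqK) ?_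
  · refine (h.comp_map (mapsTo_image F K) (fun x hx => mem_image_of_mem F hx) hFu).congr
      fun l hl => ?_
    simp only [Function.comp_apply, List.map_map]
    rw [List.map_congr_left (f := G ∘ F) (g := id) fun x hx => hGF x (hl x hx), List.map_id]
  · have hsub : G '' L ⊆ K := (hGK.mono_left hL.subset).image_subset
    refine IsTrivialOn.comp_map (hmin (G '' L) ⟨hsub, fun hs => hL.2 ?_⟩
      (hLc.isCompact.image_of_continuousOn (hGc.mono hL.subset)).isClosed) (mapsTo_image G L)
      (hGA.mono_left inter_subset_left) (hGu.mono hL.subset)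
    rintro _ ⟨x, hx, rfl⟩
    obtain ⟨y, hy, rfl⟩ := hs hx
    rwa [hFG y (hL.subset hy)]
  · rintro ⟨x, hx, hxq⟩
    exact hqA (hFi hx.2 hqK hxq ▸ hx.1)

theorem isOpen_of_homeomorph (hhom : ∀ x y : X, ∃ h : X ≃ₜ X, h x = y)
    (hchain : ∀ ε > 0, ∃ δ > 0, ∀ g : X → X, Continuous g → (∀ z, dist (g z) z < δ) →
      IsChainJoined ε g)
    {n : ℕ} (hdim : CovDimLE X n) {U V : Set X} (φ : U ≃ₜ V) (hU : IsOpen U) : IsOpen V := by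
  classical
  refine isOpen_iff_mem_nhds.2 fun y hy => ?_
  have : Nonempty X := ⟨y⟩
  obtain ⟨i, hi, hi'⟩ : ∃ i, ¬ CohomologyVanishes i X ∧ CohomologyVanishes (i + 1) X := by
    by_contra! h
    have hall : ∀ i, ¬ CohomologyVanishes i X := fun i => by
      induction i with
      | zero => exact not_cohomologyVanishes_zero
      | succ i ih => exact h i ih
    exact hall _ (cohomologyVanishes_of_covDimLE hdim n.lt_succ_self)
  obtain ⟨⟨x, hx⟩, hxy⟩ := φ.surjective ⟨y, hy⟩
  obtain ⟨K, A, c, hK, hA, hc, hnt, hmin, q, f, hqK, hqA, rfl, hfK⟩ :=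
    exists_minimal_nontrivial_near hhom hi (hU.mem_nhds hx)
  let Φ : X → X := fun z => if hz : z ∈ U then φ ⟨z, hz⟩ else z
  have hΦ : ∀ z (hz : z ∈ U), Φ z = φ ⟨z, hz⟩ := fun z hz => dif_pos hz
  have hΦc : ContinuousOn Φ U := by
    rw [continuousOn_iff_continuous_domRestrict]
    exact (continuous_subtype_val.comp φ.continuous).congr fun z => (hΦ z z.2).symm
  have key := mem_nhds_image_of_minimal hhom hchain hi' hK hA hc hnt hmin hqK hqA (F := Φ ∘ f)
    (hΦc.comp f.continuous.continuousOn hfK) fun a ha b hb hab => f.injective <| by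
      simp only [Function.comp_apply, hΦ _ (hfK ha), hΦ _ (hfK hb)] at hab
      exact congr_arg Subtype.val (φ.injective (Subtype.ext hab))
  rw [Function.comp_apply, hΦ _ hx, hxy] at key
  refine Filter.mem_of_superset key ?_
  rintro _ ⟨z, hz, rfl⟩
  rw [Function.comp_apply, hΦ _ (hfK hz)]
  exact Subtype.coe_prop _

end Domain

/-- (Lysko) A connected, compact, homogeneous metric ANR of finite covering
dimension `n` is an `n`-dimensional Cantor manifold and possesses the
invariance of domain property. -/
theorem lysko_cantor_invariance (n : ℕ) (X : Type*) [MetricSpace X]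
    [ConnectedSpace X] [CompactSpace X]
    (hhom : IsHomogeneousSpace X) (hanr : IsANR X) (hdim : CovDimEq X n) :
    IsCantorManifold n X ∧ InvarianceOfDomain X := by
  have hchain : ∀ ε > 0, ∃ δ > 0, ∀ g : X → X, Continuous g → (∀ z, dist (g z) z < δ) →
      IsChainJoined ε g := fun ε hε => hanr.exists_isChainJoined hε
  refine ⟨⟨‹_›, hdim, fun X₁ X₂ hX₁ hX₂ h₁ h₂ hu => ⟨?_, fun m hm => ?_⟩⟩, fun U V ⟨φ⟩ =>
    ⟨isOpen_of_homeomorph hhom hchain hdim.1 φ, isOpen_of_homeomorph hhom hchain hdim.1 φ.symm⟩⟩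
  · have hne : ∀ {Y Z : Set X}, Y ≠ univ → Y ∪ Z = univ → (univ ∩ Z).Nonempty := fun hY hYZ => by
      obtain ⟨x, hx⟩ := (ne_univ_iff_exists_notMem _).1 hY
      exact ⟨x, trivial, (hYZ.ge (mem_univ x)).resolve_left hx⟩
    simpa using isPreconnected_closed_iff.1 isPreconnected_univ X₁ X₂ hX₁ hX₂ hu.ge
      (hne h₂ (union_comm X₁ X₂ ▸ hu)) (hne h₁ hu)
  · exact not_covDimLE_of_separates hhom (hdim.2 (n - 1) (by omega)) (by omega) hX₁ hX₂ h₁ h₂ hu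
end

section
/- (Krupski) Let X be a homogeneous, locally compact, separable metric ANR whose covering dimension is greater than 2. Then X has the disjoint (0,2)-cells property: for every ε > 0, every point p ∈ X, and every continuous map g : B² → X of the closed 2-disk, there exist a point p' ∈ X and a continuous map g' : B² → X with d(p,p') < ε, sup-distance d(g,g') < ε, and p' ∉ g'(B²). -/
open Set Metric Topology unitInterval

/-- The closed unit 2-disk. -/
def Disk2 : Set (EuclideanSpace ℝ (Fin 2)) := Metric.closedBall 0 1

/-- A path is monotone when its fibres are order-convex. -/
def MonotonePath {X : Type*} [TopologicalSpace X] (c : C(I, X)) : Prop :=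
  ∀ s t u : I, s ≤ t → t ≤ u → c s = c u → c t = c s

/-- Any path can be replaced by a monotone path with the same endpoints, running inside the
original one. -/
theorem exists_monotonePath {X : Type*} [MetricSpace X] (c : C(I, X)) :
    ∃ c' : C(I, X), MonotonePath c' ∧ c' 0 = c 0 ∧ c' 1 = c 1 ∧ range c' ⊆ range c := by
  let S : Set (Set I) := {K | IsClosed K ∧ 0 ∈ K ∧ 1 ∈ K ∧
    ∀ a ∈ K, ∀ b ∈ K, a < b → K ∩ Ioo a b = ∅ → c a = c b}
  obtain ⟨K, hK⟩ : ∃ K, Minimal (· ∈ S) K := by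
    refine zorn_superset S fun C hCS hC => ?_
    rcases C.eq_empty_or_nonempty with rfl | hne
    · refine ⟨univ, ⟨isClosed_univ, trivial, trivial, ?_⟩, by simp⟩
      intro a _ b _ hab h
      obtain ⟨x, hx⟩ := exists_between hab
      rw [univ_inter] at h
      exact absurd (h ▸ (show x ∈ Ioo a b from hx)) (notMem_empty x)
    refine ⟨⋂₀ C, ⟨isClosed_sInter fun K hK => (hCS hK).1, fun K hK => (hCS hK).2.1,
      fun K hK => (hCS hK).2.2.1, ?_⟩, fun K hK => sInter_subset_of_mem hK⟩
    intro a ha b hb hab hgap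
    have key : ∀ a' b', a < a' → a' < b' → b' < b →
        ∃ x ∈ Icc a a', ∃ y ∈ Icc b' b, c x = c y := by
      intro a' b' h1 h2 h3
      obtain ⟨K, hKC, hKe⟩ : ∃ K ∈ C, K ∩ Icc a' b' = ∅ := by
        by_contra! hcon
        have : Nonempty C := hne.to_subtype
        have := IsCompact.nonempty_iInter_of_directed_nonempty_isCompact_isClosed
          (fun K : C => (K : Set I) ∩ Icc a' b')
          (by
            intro K L
            rcases hC.total K.2 L.2 with h | h
            · exact ⟨K, Subset.rfl, inter_subset_inter_left _ h⟩
            · exact ⟨L, inter_subset_inter_left _ h, Subset.rfl⟩)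
          (fun K => hcon K K.2)
          (fun K => ((hCS K.2).1.inter isClosed_Icc).isCompact)
          (fun K => (hCS K.2).1.inter isClosed_Icc)
        obtain ⟨x, hx⟩ := this
        rw [mem_iInter] at hx
        have hxK : x ∈ ⋂₀ C := fun K hK => (hx ⟨K, hK⟩).1
        have hxI : x ∈ Icc a' b' := (hx ⟨_, hne.some_mem⟩).2
        have : x ∈ ⋂₀ C ∩ Ioo a b := ⟨hxK, h1.trans_le hxI.1, hxI.2.trans_lt h3⟩
        rw [hgap] at this
        exact this
      obtain ⟨hcl, -, -, hg⟩ := hCS hKC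
      have hcA : IsCompact (K ∩ Iic a') := (hcl.inter isClosed_Iic).isCompact
      have hcB : IsCompact (K ∩ Ici b') := (hcl.inter isClosed_Ici).isCompact
      obtain ⟨x, hx, hxm⟩ := hcA.exists_isGreatest ⟨a, ha K hKC, h1.le⟩
      obtain ⟨y, hy, hym⟩ := hcB.exists_isLeast ⟨b, hb K hKC, h3.le⟩
      refine ⟨x, ⟨hxm ⟨ha K hKC, h1.le⟩, hx.2⟩, y, ⟨hy.2, hym ⟨hb K hKC, h3.le⟩⟩,
        hg x hx.1 y hy.1 (hx.2.trans_lt (h2.trans_le hy.2)) ?_⟩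
      rw [eq_empty_iff_forall_notMem]
      rintro z ⟨hzK, hz1, hz2⟩
      rcases le_or_gt z a' with h | h
      · exact absurd (hxm ⟨hzK, h⟩) (not_le.2 hz1)
      rcases le_or_gt b' z with h' | h'
      · exact absurd (hym ⟨hzK, h'⟩) (not_le.2 hz2)
      have : z ∈ K ∩ Icc a' b' := ⟨hzK, h.le, h'.le⟩
      rw [hKe] at this
      exact this
    refine eq_of_forall_dist_le fun ε hε => ?_
    obtain ⟨δ, hδ, hu⟩ := Metric.uniformContinuous_iff.1
      (CompactSpace.uniformContinuous_of_continuous c.continuous) (ε / 2) (half_pos hε)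
    have hab' : (a : ℝ) < b := hab
    have ha0 := a.2.1
    have hb1 := b.2.2
    let m := min (δ / 2) ((b - a : ℝ) / 3)
    have hm : 0 < m := lt_min (by linarith) (by linarith)
    have hm1 : m ≤ δ / 2 := min_le_left _ _
    have hm2 : m ≤ (b - a : ℝ) / 3 := min_le_right _ _
    obtain ⟨x, hx, y, hy, hxy⟩ := key ⟨a + m, by linarith, by linarith⟩
      ⟨b - m, by linarith, by linarith⟩ (Subtype.mk_lt_mk.2 (by linarith))
      (Subtype.mk_lt_mk.2 (by linarith)) (Subtype.mk_lt_mk.2 (by linarith))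
    have hx1 : (a : ℝ) ≤ x := hx.1
    have hx2 : (x : ℝ) ≤ a + m := hx.2
    have hy1 : (b : ℝ) - m ≤ y := hy.1
    have hy2 : (y : ℝ) ≤ b := hy.2
    have d1 : dist (c a) (c x) < ε / 2 := hu (by
      rw [Subtype.dist_eq, Real.dist_eq, abs_lt]; constructor <;> linarith)
    have d2 : dist (c y) (c b) < ε / 2 := hu (by
      rw [Subtype.dist_eq, Real.dist_eq, abs_lt]; constructor <;> linarith)
    calc dist (c a) (c b) ≤ dist (c a) (c x) + dist (c x) (c b) := dist_triangle _ _ _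
      _ ≤ ε := by rw [← hxy] at d2; linarith
  obtain ⟨⟨hcl, h0, h1, hgap⟩, hmin⟩ := hK
  have hinj : ∀ a ∈ K, ∀ b ∈ K, a < b → c a = c b → K ∩ Ioo a b = ∅ := by
    intro a ha b hb hab hc
    have hS : K \ Ioo a b ∈ S := by
      refine ⟨hcl.sdiff isOpen_Ioo, ⟨h0, fun h => absurd h.1 (not_lt.2 bot_le)⟩,
        ⟨h1, fun h => absurd h.2 (not_lt.2 le_top)⟩, ?_⟩
      intro x hx y hy hxy hg
      by_cases hE : K ∩ Ioo x y = ∅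
      · exact hgap x hx.1 y hy.1 hxy hE
      obtain ⟨z, hzK, hz⟩ := nonempty_iff_ne_empty.2 hE
      have hzab : z ∈ Ioo a b := by
        by_contra hcon
        have : z ∈ (K \ Ioo a b) ∩ Ioo x y := ⟨⟨hzK, hcon⟩, hz⟩
        rw [hg] at this
        exact this
      have hxa : x ≤ a := by
        by_contra! hcon
        exact hx.2 ⟨hcon, hz.1.trans hzab.2⟩
      have hby : b ≤ y := by
        by_contra! hcon
        exact hy.2 ⟨hzab.1.trans hz.2, hcon⟩
      have hxa' : x = a := by
        by_contra hne
        have : a ∈ (K \ Ioo a b) ∩ Ioo x y :=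
          ⟨⟨ha, fun h => lt_irrefl _ h.1⟩, lt_of_le_of_ne hxa hne, hab.trans_le hby⟩
        rw [hg] at this
        exact this
      have hby' : b = y := by
        by_contra hne
        have : b ∈ (K \ Ioo a b) ∩ Ioo x y :=
          ⟨⟨hb, fun h => lt_irrefl _ h.2⟩, hxa.trans_lt hab, lt_of_le_of_ne hby hne⟩
        rw [hg] at this
        exact this
      rw [hxa', ← hby', hc]
    have := hmin hS sdiff_subset
    rw [eq_empty_iff_forall_notMem]
    rintro z ⟨hz, hz'⟩
    exact (this hz).2 hz'
  have hl : ∀ t : I, ∃ l, IsGreatest (K ∩ Iic t) l := fun t =>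
    ((hcl.inter isClosed_Iic).isCompact).exists_isGreatest ⟨0, h0, t.2.1⟩
  have hr : ∀ t : I, ∃ r, IsLeast (K ∩ Ici t) r := fun t =>
    ((hcl.inter isClosed_Ici).isCompact).exists_isLeast ⟨1, h1, t.2.2⟩
  choose l hl using hl
  choose r hr using hr
  have hlr : ∀ t, c (l t) = c (r t) := by
    intro t
    rcases ((hl t).1.2.trans (hr t).1.2 : l t ≤ r t).eq_or_lt with h | h
    · rw [h]
    refine hgap _ (hl t).1.1 _ (hr t).1.1 h ?_
    rw [eq_empty_iff_forall_notMem]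
    rintro z ⟨hz, hz1, hz2⟩
    rcases le_total z t with h | h
    · exact absurd ((hl t).2 ⟨hz, h⟩) (not_le.2 hz1)
    · exact absurd ((hr t).2 ⟨hz, h⟩) (not_le.2 hz2)
  have hmono : ∀ s t, s ≤ t → l s ≤ l t := fun s t h =>
    (hl t).2 ⟨(hl s).1.1, (hl s).1.2.trans h⟩
  have hosc : ∀ s t, s ≤ t → ∃ u ∈ Icc s t, ∃ v ∈ Icc s t,
      dist (c (l s)) (c (l t)) = dist (c u) (c v) := by
    intro s t hst
    by_cases hE : (K ∩ Icc s t).Nonempty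
    · obtain ⟨z, hz, hz1, hz2⟩ := hE
      refine ⟨r s, ⟨(hr s).1.2, ((hr s).2 ⟨hz, hz1⟩).trans hz2⟩, l t,
        ⟨hz1.trans ((hl t).2 ⟨hz, hz2⟩), (hl t).1.2⟩, by rw [hlr s]⟩
    · refine ⟨s, ⟨le_rfl, hst⟩, s, ⟨le_rfl, hst⟩, ?_⟩
      have : l t ≤ s := by
        by_contra! hcon
        exact hE ⟨l t, (hl t).1.1, hcon.le, (hl t).1.2⟩
      rw [le_antisymm (hmono s t hst) ((hl s).2 ⟨(hl t).1.1, this⟩), dist_self, dist_self]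
  have hcont : Continuous fun t => c (l t) := by
    refine UniformContinuous.continuous (Metric.uniformContinuous_iff.2 fun ε hε => ?_)
    obtain ⟨δ, hδ, hu⟩ := Metric.uniformContinuous_iff.1
      (CompactSpace.uniformContinuous_of_continuous c.continuous) ε hε
    have aux : ∀ s t : I, s ≤ t → dist s t < δ → dist (c (l s)) (c (l t)) < ε := by
      intro s t hst hd
      obtain ⟨u, hu1, v, hv1, he⟩ := hosc s t hst
      rw [he]
      refine hu ?_
      have e1 : (s : ℝ) ≤ u := hu1.1
      have e2 : (u : ℝ) ≤ t := hu1.2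
      have e3 : (s : ℝ) ≤ v := hv1.1
      have e4 : (v : ℝ) ≤ t := hv1.2
      rw [Subtype.dist_eq, Real.dist_eq, abs_lt] at hd ⊢
      constructor <;> linarith
    refine ⟨δ, hδ, fun {s t} hd => ?_⟩
    rcases le_total s t with h | h
    · exact aux s t h hd
    · rw [dist_comm]; exact aux t s h (by rwa [dist_comm])
  refine ⟨⟨fun t => c (l t), hcont⟩, ?_, ?_, ?_, ?_⟩
  · intro s t u hst htu hc
    change c (l s) = c (l u) at hc
    change c (l t) = c (l s)
    have h1 := hmono s t hst
    have h2 := hmono t u htu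
    rcases h1.eq_or_lt with h1 | h1
    · rw [h1]
    rcases h2.eq_or_lt with h2 | h2
    · rw [h2, hc]
    have : l t ∈ K ∩ Ioo (l s) (l u) := ⟨(hl t).1.1, h1, h2⟩
    rw [hinj _ (hl s).1.1 _ (hl u).1.1 (h1.trans h2) hc] at this
    exact absurd this (notMem_empty _)
  · change c (l 0) = c 0
    rw [show l 0 = 0 from le_antisymm (hl 0).1.2 (l 0).2.1]
  · change c (l 1) = c 1
    rw [show l 1 = 1 from le_antisymm (hl 1).1.2 ((hl 1).2 ⟨h1, mem_Iic.2 le_rfl⟩)]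
  · rintro _ ⟨t, rfl⟩
    exact ⟨l t, rfl⟩

/-- A set is thin when it is covered by countably many monotone paths. -/
def Thin {X : Type*} [TopologicalSpace X] (A : Set X) : Prop :=
  ∃ c : ℕ → C(I, X), (∀ n, MonotonePath (c n)) ∧ A ⊆ ⋃ n, range (c n)

theorem Thin.mono {X : Type*} [TopologicalSpace X] {A B : Set X} (hB : Thin B) (h : A ⊆ B) :
    Thin A := by
  obtain ⟨c, hc, hs⟩ := hB
  exact ⟨c, hc, h.trans hs⟩

theorem Thin.iUnion {X : Type*} [TopologicalSpace X] {ι : Type*} [Countable ι] [Nonempty ι]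
    {A : ι → Set X} (hA : ∀ i, Thin (A i)) : Thin (⋃ i, A i) := by
  choose c hc hs using hA
  obtain ⟨f, hf⟩ := exists_surjective_nat (ι × ℕ)
  refine ⟨fun n => c (f n).1 (f n).2, fun n => hc _ _, iUnion_subset fun i x hx => ?_⟩
  obtain ⟨m, hm⟩ := mem_iUnion.1 (hs i hx)
  obtain ⟨n, hn⟩ := hf (i, m)
  exact mem_iUnion.2 ⟨n, by simpa only [hn] using hm⟩

theorem MonotonePath.thin_range {X : Type*} [TopologicalSpace X] {c : C(I, X)}
    (hc : MonotonePath c) : Thin (range c) :=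
  ⟨fun _ => c, fun _ => hc, subset_iUnion (fun _ : ℕ => range c) 0⟩

theorem Thin.image_homeomorph {X : Type*} [TopologicalSpace X] {A : Set X} (hA : Thin A)
    (h : X ≃ₜ X) : Thin (h '' A) := by
  obtain ⟨c, hc, hs⟩ := hA
  refine ⟨fun n => (ContinuousMap.mk h h.continuous).comp (c n), fun n s t u hst htu he => ?_, ?_⟩
  · exact congrArg h (hc n s t u hst htu (h.injective he))
  · rintro _ ⟨x, hx, rfl⟩
    obtain ⟨n, t, ht⟩ := mem_iUnion.1 (hs hx)
    exact mem_iUnion.2 ⟨n, t, congrArg h ht⟩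

/-- Points of `M` have small open neighborhoods whose frontiers miss `M`. -/
def ZeroDimSet {X : Type*} [TopologicalSpace X] (M : Set X) : Prop :=
  ∀ x ∈ M, ∀ W ∈ 𝓝 x, ∃ O : Set X, IsOpen O ∧ x ∈ O ∧ O ⊆ W ∧ Disjoint (frontier O) M

theorem exists_disjoint_open_refinement {X : Type*} [TopologicalSpace X] (O : ℕ → Set X)
    (hO : ∀ n, IsOpen (O n)) :
    ∃ V : ℕ → Set X, (∀ n, IsOpen (V n)) ∧ (∀ n, V n ⊆ O n) ∧
      (∀ x m n, x ∈ V m → x ∈ V n → m = n) ∧ (⋃ n, O n) \ ⋃ n, frontier (O n) ⊆ ⋃ n, V n := by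
  classical
  refine ⟨fun n => O n \ ⋃ m ∈ Finset.range n, closure (O m), fun n => (hO n).sdiff ?_,
    fun n => sdiff_subset, ?_, ?_⟩
  · exact isClosed_biUnion_finset fun _ _ => isClosed_closure
  · have key : ∀ x m n, m < n → x ∈ O m \ ⋃ k ∈ Finset.range m, closure (O k) →
        x ∉ O n \ ⋃ k ∈ Finset.range n, closure (O k) := by
      intro x m n hmn hm hn
      exact hn.2 (mem_iUnion₂.2 ⟨m, Finset.mem_range.2 hmn, subset_closure hm.1⟩)
    intro x m n hm hn
    rcases lt_trichotomy m n with h | h | h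
    · exact absurd hn (key x m n h hm)
    · exact h
    · exact absurd hm (key x n m h hn)
  · rintro x ⟨hx, hf⟩
    have hex := mem_iUnion.1 hx
    refine mem_iUnion.2 ⟨Nat.find hex, Nat.find_spec hex, fun hcon => ?_⟩
    obtain ⟨m, hm, hxm⟩ := mem_iUnion₂.1 hcon
    have hnot := Nat.find_min hex (Finset.mem_range.1 hm)
    exact hf (mem_iUnion.2 ⟨m, hxm, by rwa [(hO m).interior_eq]⟩)

theorem exists_nat_subcover {X : Type*} [TopologicalSpace X] [SecondCountableTopology X]
    {M : Set X} (hM : M.Nonempty) (f : X → Set X) (hf : ∀ x ∈ M, f x ∈ 𝓝 x) :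
    ∃ u : ℕ → X, (∀ n, u n ∈ M) ∧ M ⊆ ⋃ n, f (u n) := by
  obtain ⟨t, htM, htc, ht⟩ := TopologicalSpace.countable_cover_nhdsWithin
    (fun x hx => mem_nhdsWithin_of_mem_nhds (hf x hx))
  have hne : t.Nonempty := by
    obtain ⟨x, hx⟩ := hM
    obtain ⟨y, hy, -⟩ := mem_iUnion₂.1 (ht hx)
    exact ⟨y, hy⟩
  obtain ⟨u, rfl⟩ := htc.exists_eq_range hne
  exact ⟨u, fun n => htM ⟨n, rfl⟩, fun x hx => by simpa using ht hx⟩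

theorem ZeroDimSet.exists_refinement {X : Type*} [TopologicalSpace X] [SecondCountableTopology X]
    {M : Set X} (hM : ZeroDimSet M) {ι : Type*} [Nonempty ι] (U : ι → Set X)
    (hU : ∀ i, IsOpen (U i)) (hc : M ⊆ ⋃ i, U i) :
    ∃ V : ℕ → Set X, (∀ n, IsOpen (V n)) ∧ (∀ n, ∃ i, V n ⊆ U i) ∧
      (∀ x m n, x ∈ V m → x ∈ V n → m = n) ∧ M ⊆ ⋃ n, V n := by
  rcases M.eq_empty_or_nonempty with rfl | hne
  · exact ⟨fun _ => ∅, fun _ => isOpen_empty, fun _ => ⟨Classical.arbitrary ι, empty_subset _⟩,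
      fun x m n h => h.elim, empty_subset _⟩
  have : ∀ x, ∃ O : Set X, x ∈ M →
      (IsOpen O ∧ x ∈ O ∧ (∃ i, O ⊆ U i) ∧ Disjoint (frontier O) M) := by
    intro x
    by_cases hx : x ∈ M
    · obtain ⟨i, hi⟩ := mem_iUnion.1 (hc hx)
      obtain ⟨O, h1, h2, h3, h4⟩ := hM x hx (U i) ((hU i).mem_nhds hi)
      exact ⟨O, fun _ => ⟨h1, h2, ⟨i, h3⟩, h4⟩⟩
    · exact ⟨∅, fun h => absurd h hx⟩
  choose O hO using this
  obtain ⟨u, hu, hcov⟩ := exists_nat_subcover hne O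
    fun x hx => (hO x hx).1.mem_nhds (hO x hx).2.1
  obtain ⟨V, hV, hVO, hd, hVc⟩ := exists_disjoint_open_refinement (fun n => O (u n))
    fun n => (hO _ (hu n)).1
  refine ⟨V, hV, fun n => ?_, hd, fun x hx => hVc ⟨hcov hx, fun hcon => ?_⟩⟩
  · obtain ⟨i, hi⟩ := (hO _ (hu n)).2.2.1
    exact ⟨i, (hVO n).trans hi⟩
  · obtain ⟨n, hn⟩ := mem_iUnion.1 hcon
    exact disjoint_left.1 (hO _ (hu n)).2.2.2 hn hx

theorem ZeroDimSet.exists_partition_step {Y : Type*} [TopologicalSpace Y] [NormalSpace Y]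
    [SecondCountableTopology Y] {N : Set Y} (hN : ZeroDimSet N) (hNc : IsClosed N) {A B : Set Y}
    (hA : IsClosed A) (hB : IsClosed B) (hAB : Disjoint A B) :
    ∃ G H : Set Y, IsOpen G ∧ IsOpen H ∧ A ⊆ G ∧ B ⊆ H ∧ Disjoint (closure G) (closure H) ∧
      N ⊆ G ∪ H := by
  obtain ⟨V, hV, hVs, hd, hcov⟩ := hN.exists_refinement (fun b : Bool => bif b then Bᶜ else Aᶜ)
    (by rintro (_ | _); exacts [hA.isOpen_compl, hB.isOpen_compl])
    (by
      intro x _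
      by_cases hx : x ∈ A
      · exact mem_iUnion.2 ⟨true, disjoint_left.1 hAB hx⟩
      · exact mem_iUnion.2 ⟨false, hx⟩)
  let P := ⋃ n ∈ {n | V n ⊆ Bᶜ}, V n
  let Q := ⋃ n ∈ {n | ¬ V n ⊆ Bᶜ}, V n
  have hP : IsOpen P := isOpen_biUnion fun n _ => hV n
  have hQ : IsOpen Q := isOpen_biUnion fun n _ => hV n
  have hPB : ∀ x ∈ P, x ∉ B := by
    intro x hx
    obtain ⟨n, hn, hxn⟩ := mem_iUnion₂.1 hx
    exact hn hxn
  have hQA : ∀ x ∈ Q, x ∉ A := by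
    intro x hx
    obtain ⟨n, hn, hxn⟩ := mem_iUnion₂.1 hx
    obtain ⟨_ | _, hi⟩ := hVs n
    · exact hi hxn
    · exact absurd hi hn
  have hPQ : ∀ x ∈ P, x ∉ Q := by
    intro x hx hx'
    obtain ⟨n, hn, hxn⟩ := mem_iUnion₂.1 hx
    obtain ⟨m, hm, hxm⟩ := mem_iUnion₂.1 hx'
    exact hm (hd x n m hxn hxm ▸ hn)
  have hNPQ : ∀ x ∈ N, x ∉ Q → x ∈ P := by
    intro x hx hxQ
    obtain ⟨n, hn⟩ := mem_iUnion.1 (hcov hx)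
    by_cases h : V n ⊆ Bᶜ
    · exact mem_iUnion₂.2 ⟨n, h, hn⟩
    · exact absurd (mem_iUnion₂.2 ⟨n, h, hn⟩) hxQ
  obtain ⟨G, hG, hAG, hGs⟩ := normal_exists_closure_subset (s := A ∪ N \ Q)
    (t := (B ∪ N \ P)ᶜ) (hA.union (hNc.sdiff hQ)) (hB.union (hNc.sdiff hP)).isOpen_compl (by
      rintro x (hx | hx) (hx' | hx')
      · exact disjoint_left.1 hAB hx hx'
      · exact hx'.2 (hNPQ x hx'.1 fun h => hQA x h hx)
      · exact hPB x (hNPQ x hx.1 hx.2) hx'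
      · exact hx'.2 (hNPQ x hx.1 hx.2))
  obtain ⟨H, hH, hBH, hHs⟩ := normal_exists_closure_subset (s := B ∪ N \ P)
    (t := (closure G)ᶜ) (hB.union (hNc.sdiff hP)) isClosed_closure.isOpen_compl
    (fun x hx hx' => hGs hx' hx)
  refine ⟨G, H, hG, hH, subset_union_left.trans hAG, subset_union_left.trans hBH,
    disjoint_left.2 fun x hx hx' => hHs hx' hx, fun x hx => ?_⟩
  by_cases h : x ∈ P
  · exact Or.inl (hAG (Or.inr ⟨hx, hPQ x h⟩))
  · exact Or.inr (hBH (Or.inr ⟨hx, h⟩))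

theorem exists_isClopen_of_closed_zeroDimSet {Y : Type*} [TopologicalSpace Y] [T4Space Y]
    [SecondCountableTopology Y] (N : ℕ → Set Y) (hN : ∀ n, ZeroDimSet (N n))
    (hNc : ∀ n, IsClosed (N n)) (hcov : ⋃ n, N n = univ) (x : Y) (W : Set Y) (hW : W ∈ 𝓝 x) :
    ∃ C : Set Y, IsClopen C ∧ x ∈ C ∧ C ⊆ W := by
  let T := {p : Set Y × Set Y // IsClosed p.1 ∧ IsClosed p.2 ∧ Disjoint p.1 p.2}
  have step : ∀ (n : ℕ) (p : T), ∃ q : T, p.1.1 ⊆ interior q.1.1 ∧ p.1.2 ⊆ interior q.1.2 ∧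
      N n ⊆ q.1.1 ∪ q.1.2 := by
    intro n p
    obtain ⟨G, H, h1, h2, h3, h4, h5, h6⟩ :=
      (hN n).exists_partition_step (hNc n) p.2.1 p.2.2.1 p.2.2.2
    exact ⟨⟨(closure G, closure H), isClosed_closure, isClosed_closure, h5⟩,
      h3.trans (interior_maximal subset_closure h1), h4.trans (interior_maximal subset_closure h2),
      h6.trans (union_subset_union subset_closure subset_closure)⟩
  choose next hn1 hn2 hn3 using step
  let p0 : T := ⟨({x}, (interior W)ᶜ), isClosed_singleton, isOpen_interior.isClosed_compl,
    disjoint_left.2 fun y hy hy' => hy' (by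
      rw [mem_singleton_iff.1 hy]; exact mem_interior_iff_mem_nhds.2 hW)⟩
  let s : ℕ → T := fun n => Nat.rec p0 (fun n p => next n p) n
  have hs1 : Monotone fun n => (s n).1.1 :=
    monotone_nat_of_le_succ fun n => (hn1 n (s n)).trans interior_subset
  have hs2 : Monotone fun n => (s n).1.2 :=
    monotone_nat_of_le_succ fun n => (hn2 n (s n)).trans interior_subset
  have ho1 : IsOpen (⋃ n, (s n).1.1) := isOpen_iff_mem_nhds.2 fun y hy => by
    obtain ⟨n, hn⟩ := mem_iUnion.1 hy
    exact Filter.mem_of_superset (mem_interior_iff_mem_nhds.1 (hn1 n (s n) hn))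
      (subset_iUnion (fun n => (s n).1.1) (n + 1))
  have ho2 : IsOpen (⋃ n, (s n).1.2) := isOpen_iff_mem_nhds.2 fun y hy => by
    obtain ⟨n, hn⟩ := mem_iUnion.1 hy
    exact Filter.mem_of_superset (mem_interior_iff_mem_nhds.1 (hn2 n (s n) hn))
      (subset_iUnion (fun n => (s n).1.2) (n + 1))
  have hdis : ∀ y, y ∈ (⋃ n, (s n).1.1) → y ∉ ⋃ n, (s n).1.2 := by
    intro y hy hy'
    obtain ⟨n, hn⟩ := mem_iUnion.1 hy
    obtain ⟨m, hm⟩ := mem_iUnion.1 hy'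
    exact disjoint_left.1 (s (max n m)).2.2.2 (hs1 (le_max_left n m) hn)
      (hs2 (le_max_right n m) hm)
  have hcompl : (⋃ n, (s n).1.1) = (⋃ n, (s n).1.2)ᶜ := by
    refine Subset.antisymm hdis fun y hy => ?_
    obtain ⟨n, hn⟩ := mem_iUnion.1 (hcov.symm ▸ mem_univ y : y ∈ ⋃ n, N n)
    rcases hn3 n (s n) hn with h | h
    · exact mem_iUnion.2 ⟨n + 1, h⟩
    · exact absurd (mem_iUnion.2 ⟨n + 1, h⟩) hy
  refine ⟨⋃ n, (s n).1.1, ⟨hcompl ▸ ho2.isClosed_compl, ho1⟩, mem_iUnion.2 ⟨0, rfl⟩,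
    fun y hy => ?_⟩
  by_contra hcon
  exact hdis y hy (mem_iUnion.2 ⟨0, fun h => hcon (interior_subset h)⟩)

theorem Set.Countable.zeroDimSet {X : Type*} [MetricSpace X] {Q : Set X} (hQ : Q.Countable) :
    ZeroDimSet Q := by
  intro x _ W hW
  obtain ⟨ε, hε, hb⟩ := Metric.mem_nhds_iff.1 hW
  obtain ⟨r, hr, hr0, hr1⟩ := ((hQ.image fun y => dist y x).dense_compl ℝ).exists_between hε
  refine ⟨ball x r, isOpen_ball, mem_ball_self hr0, (ball_subset_ball hr1.le).trans hb,
    disjoint_left.2 fun y hy hyQ => hr ⟨y, hyQ, ?_⟩⟩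
  exact mem_sphere.1 (frontier_ball_subset_sphere hy)

theorem zeroDimSet_of_clopen_basis {X : Type*} [TopologicalSpace X] [CompletelyNormalSpace X]
    {M : Set X} (h : ∀ (x : M) (W : Set M), W ∈ 𝓝 x → ∃ C : Set M, IsClopen C ∧ x ∈ C ∧ C ⊆ W) :
    ZeroDimSet M := by
  intro x hx W hW
  obtain ⟨C, hC, hxC, hCW⟩ := h ⟨x, hx⟩ (Subtype.val ⁻¹' interior W)
    (continuous_subtype_val.continuousAt.preimage_mem_nhds (interior_mem_nhds.2 hW))
  have key : ∀ D : Set M, IsClosed D →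
      Disjoint (closure (Subtype.val '' D)) (Subtype.val '' Dᶜ) := by
    intro D hD
    rw [disjoint_left]
    rintro _ hy ⟨y, hyD, rfl⟩
    rw [← closure_subtype, hD.closure_eq] at hy
    exact hyD hy
  have h2 := key Cᶜ hC.compl.isClosed
  rw [compl_compl] at h2
  obtain ⟨P, Q, hP, hQ, hCP, hCQ, hPQ⟩ :=
    separatedNhds_iff_disjoint.2
      (CompletelyNormalSpace.completely_normal (key C hC.isClosed) h2.symm)
  refine ⟨P ∩ interior W, hP.inter isOpen_interior,
    ⟨hCP ⟨_, hxC, rfl⟩, mem_interior_iff_mem_nhds.2 hW⟩,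
    inter_subset_right.trans interior_subset, disjoint_left.2 fun y hy hyM => ?_⟩
  by_cases hyC : (⟨y, hyM⟩ : M) ∈ C
  · refine hy.2 ?_
    rw [(hP.inter isOpen_interior).interior_eq]
    exact ⟨hCP ⟨_, hyC, rfl⟩, hCW hyC⟩
  · have hyQ : y ∈ Q := hCQ ⟨_, hyC, rfl⟩
    obtain ⟨z, hzQ, hzP, -⟩ := mem_closure_iff.1 (frontier_subset_closure hy) Q hQ hyQ
    exact disjoint_left.1 hPQ hzP hzQ

theorem zeroDimSet_iUnion_range_diff {X : Type*} [MetricSpace X] [SecondCountableTopology X]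
    (c : ℕ → C(I, X)) (hc : ∀ n, MonotonePath (c n)) {D : Set I} (hD : Dense D) (h0 : 0 ∈ D)
    (h1 : 1 ∈ D) : ZeroDimSet ((⋃ n, range (c n)) \ ⋃ n, c n '' D) := by
  set M := (⋃ n, range (c n)) \ ⋃ n, c n '' D with hM
  have huniq : ∀ n s t, c n s = c n t → c n s ∈ M → s = t := by
    have aux : ∀ n s t, s < t → c n s = c n t → c n s ∉ M := by
      intro n s t hst he hm
      obtain ⟨d, hd, hsd, hdt⟩ := hD.exists_between hst
      exact hm.2 (mem_iUnion.2 ⟨n, d, hd, hc n s d t hsd.le hdt.le he⟩)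
    intro n s t he hm
    rcases lt_trichotomy s t with h | h | h
    · exact absurd hm (aux n s t h he)
    · exact h
    · exact absurd (he ▸ hm) (aux n t s h he.symm)
  have hnD : ∀ n t, c n t ∈ M → t ∉ D := fun n t hm ht => hm.2 (mem_iUnion.2 ⟨n, t, ht, rfl⟩)
  refine zeroDimSet_of_clopen_basis fun x W hW =>
    exists_isClopen_of_closed_zeroDimSet (fun n => Subtype.val ⁻¹' range (c n)) ?_
      (fun n => (isCompact_range (c n).continuous).isClosed.preimage continuous_subtype_val)
      ?_ x W hW
  · rintro n ⟨_, hxM⟩ ⟨t, rfl⟩ W hW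
    obtain ⟨W', hW', hWW⟩ := mem_nhds_induced Subtype.val _ W |>.1 hW
    have ht : c n ⁻¹' interior W' ∈ 𝓝 t :=
      (c n).continuous.continuousAt.preimage_mem_nhds (interior_mem_nhds.2 hW')
    have ht0 : 0 < t := lt_of_le_of_ne t.2.1 fun h => hnD n t hxM (h ▸ h0)
    have ht1 : t < 1 := lt_of_le_of_ne t.2.2 fun h => hnD n t hxM (h ▸ h1)
    obtain ⟨l, u, ⟨hl, hu⟩, hlu⟩ := (mem_nhds_iff_exists_Ioo_subset' ⟨0, ht0⟩ ⟨1, ht1⟩).1 ht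
    obtain ⟨r, hrD, hlr, hrt⟩ := hD.exists_between hl
    obtain ⟨s, hsD, hts, hsu⟩ := hD.exists_between hu
    have hC1 : IsClosed (Subtype.val ⁻¹' (c n '' Icc r s) : Set M) :=
      (isCompact_Icc.image (c n).continuous).isClosed.preimage continuous_subtype_val
    have hC2 : IsClosed (Subtype.val ⁻¹' (c n '' (Ioo r s)ᶜ) : Set M) :=
      (isOpen_Ioo.isClosed_compl.isCompact.image (c n).continuous).isClosed.preimage
        continuous_subtype_val
    obtain ⟨O, hO, hCO, hOs⟩ := normal_exists_closure_subset (s := Subtype.val ⁻¹' (c n '' Icc r s))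
      (t := interior W ∩ (Subtype.val ⁻¹' (c n '' (Ioo r s)ᶜ))ᶜ) hC1
      (isOpen_interior.inter hC2.isOpen_compl) (by
        rintro ⟨_, hyM⟩ ⟨a, ha, rfl⟩
        refine ⟨?_, ?_⟩
        · exact interior_maximal ((preimage_mono interior_subset).trans hWW)
            (isOpen_interior.preimage continuous_subtype_val)
            (hlu ⟨hlr.trans_le ha.1, ha.2.trans_lt hsu⟩)
        · rintro ⟨b, hb, he⟩
          have hab := huniq n a b he.symm hyM
          subst hab
          rcases ha.1.eq_or_lt with h | h
          · exact hnD n a hyM (h ▸ hrD)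
          rcases ha.2.eq_or_lt with h' | h'
          · exact hnD n a hyM (h' ▸ hsD)
          exact hb ⟨h, h'⟩)
    refine ⟨O, hO, hCO ⟨t, ⟨hrt.le, hts.le⟩, rfl⟩,
      fun y hy => interior_subset (hOs (subset_closure hy)).1, disjoint_left.2 ?_⟩
    rintro ⟨_, hyM⟩ hy ⟨a, rfl⟩
    by_cases ha : a ∈ Ioo r s
    · refine hy.2 ?_
      rw [hO.interior_eq]
      exact hCO ⟨a, Ioo_subset_Icc_self ha, rfl⟩
    · exact (hOs hy.1).2 ⟨a, ha, rfl⟩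
  · refine eq_univ_of_forall fun y => ?_
    obtain ⟨n, hn⟩ := mem_iUnion.1 y.2.1
    exact mem_iUnion.2 ⟨n, hn⟩

theorem covDimLE_two_of_thin_frontier {X : Type*} [MetricSpace X] [SecondCountableTopology X]
    (h : ∀ x : X, ∀ W ∈ 𝓝 x, ∃ O : Set X, IsOpen O ∧ x ∈ O ∧ O ⊆ W ∧ Thin (frontier O)) :
    CovDimLE X 2 := by
  intro ι _ U hU hcov
  rcases isEmpty_or_nonempty X with hX | hX
  · exact ⟨Empty, Empty.elim, fun j => j.elim, Subsingleton.elim _ _, fun j => j.elim,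
      fun x => isEmptyElim x⟩
  have : ∀ x, ∃ O : Set X, IsOpen O ∧ x ∈ O ∧ (∃ i, O ⊆ U i) ∧ Thin (frontier O) := by
    intro x
    obtain ⟨i, hi⟩ := mem_iUnion.1 (hcov.symm ▸ mem_univ x : x ∈ ⋃ i, U i)
    obtain ⟨O, h1, h2, h3, h4⟩ := h x (U i) ((hU i).mem_nhds hi)
    exact ⟨O, h1, h2, ⟨i, h3⟩, h4⟩
  choose O hO hxO hOU hOt using this
  obtain ⟨u, -, hu⟩ := exists_nat_subcover univ_nonempty O fun x _ => (hO x).mem_nhds (hxO x)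
  obtain ⟨c, hc, hfc⟩ := Thin.iUnion fun n : ℕ => hOt (u n)
  obtain ⟨D, hDc, hDd, hD0, hD1⟩ := exists_countable_dense_bot_top I
  have hι : Nonempty ι := ⟨(hOU (Classical.arbitrary X)).choose⟩
  obtain ⟨V0, hV0, hVO0, hd0, hc0⟩ := exists_disjoint_open_refinement (fun n => O (u n))
    fun n => hO (u n)
  have hQ : (⋃ n, c n '' D).Countable := countable_iUnion fun n => hDc.image _
  obtain ⟨V1, hV1, hVU1, hd1, hc1⟩ := hQ.zeroDimSet.exists_refinement U hU
    (hcov.symm ▸ subset_univ _)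
  obtain ⟨V2, hV2, hVU2, hd2, hc2⟩ := (zeroDimSet_iUnion_range_diff c hc hDd
    (hD0 0 isBot_bot) (hD1 1 isTop_top)).exists_refinement U hU (hcov.symm ▸ subset_univ _)
  refine ⟨Fin 3 × ℕ, fun p => ![V0, V1, V2] p.1 p.2, ?_, ?_, ?_, ?_⟩
  · rintro ⟨j, n⟩
    fin_cases j
    exacts [hV0 n, hV1 n, hV2 n]
  · refine eq_univ_of_forall fun x => ?_
    by_cases hx : x ∈ ⋃ n, c n '' D
    · obtain ⟨n, hn⟩ := mem_iUnion.1 (hc1 hx)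
      exact mem_iUnion.2 ⟨(1, n), hn⟩
    by_cases hx' : x ∈ ⋃ n, range (c n)
    · obtain ⟨n, hn⟩ := mem_iUnion.1 (hc2 ⟨hx', hx⟩)
      exact mem_iUnion.2 ⟨(2, n), hn⟩
    · obtain ⟨n, hn⟩ := mem_iUnion.1 (hc0 ⟨hu (mem_univ x), fun h => hx' (hfc h)⟩)
      exact mem_iUnion.2 ⟨(0, n), hn⟩
  · rintro ⟨j, n⟩
    fin_cases j
    · obtain ⟨i, hi⟩ := hOU (u n)
      exact ⟨i, (hVO0 n).trans hi⟩
    · exact hVU1 n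
    · exact hVU2 n
  · intro x
    have hinj : InjOn Prod.fst {p : Fin 3 × ℕ | x ∈ ![V0, V1, V2] p.1 p.2} := by
      rintro ⟨j, m⟩ hm ⟨j', n⟩ hn hj
      obtain rfl : j = j' := hj
      congr 1
      fin_cases j
      exacts [hd0 x m n hm hn, hd1 x m n hm hn, hd2 x m n hm hn]
    have := encard_le_encard_of_injOn (t := (univ : Set (Fin 3))) (fun _ _ => mem_univ _) hinj
    refine this.trans ?_
    simp [encard_univ]

/-- A continuous map into a normed space with a continuous left inverse defined near its range. -/
structure NbhdRetraction (X E : Type*) [TopologicalSpace X] [NormedAddCommGroup E]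
    [NormedSpace ℝ E] where
  i : C(X, E)
  ρ : E → X
  dom : Set E
  isOpen_dom : IsOpen dom
  i_mem : ∀ x, i x ∈ dom
  continuousOn_ρ : ContinuousOn ρ dom
  ρ_i : ∀ x, ρ (i x) = x

theorem exists_proper_real {X : Type*} [TopologicalSpace X] [T2Space X] [LocallyCompactSpace X]
    [SecondCountableTopology X] [ParacompactSpace X] :
    ∃ φ : C(X, ℝ), IsProperMap φ := by
  let K : CompactExhaustion X := default
  obtain ⟨φ, hφ⟩ := exists_continuous_forall_mem_convex_of_local_const
    (t := fun x : X => Ici (K.find x : ℝ)) (fun x => convex_Ici _) (fun x => by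
      refine ⟨((K.find x + 1 : ℕ) : ℝ), ?_⟩
      filter_upwards [isOpen_interior.mem_nhds
        (K.subset_interior_succ (K.find x) (K.mem_find x))] with y hy
      exact Nat.cast_le (α := ℝ).2 (K.mem_iff_find_le.1 (interior_subset hy)))
  refine ⟨φ, isProperMap_iff_isCompact_preimage.2 ⟨φ.continuous, fun C hC => ?_⟩⟩
  obtain ⟨b, hb⟩ := hC.bddAbove
  obtain ⟨n, hn⟩ := exists_nat_ge b
  refine (K.isCompact n).of_isClosed_subset (hC.isClosed.preimage φ.continuous) fun x hx => ?_
  exact K.mem_iff_find_le.2 (Nat.cast_le (α := ℝ).1 ((hφ x : (K.find x : ℝ) ≤ φ x).trans ((hb hx).trans hn)))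

theorem IsANR.exists_nbhdRetraction {X : Type*} [MetricSpace X] [LocallyCompactSpace X]
    [TopologicalSpace.SeparableSpace X] [Nonempty X] (h : IsANR X) :
    Nonempty (NbhdRetraction X (lp (fun _ : ℕ => ℝ) ⊤ × ℝ)) := by
  classical
  have : SecondCountableTopology X := UniformSpace.secondCountable_of_separable X
  obtain ⟨φ, hφ⟩ := exists_proper_real (X := X)
  have hk := kuratowskiEmbedding.isometry X
  let j : X → lp (fun _ : ℕ => ℝ) ⊤ × ℝ := fun x => (kuratowskiEmbedding X x, φ x)
  have hj : Continuous j := hk.continuous.prodMk φ.continuous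
  let e : X → ULift (lp (fun _ : ℕ => ℝ) ⊤ × ℝ) := fun x => ULift.up (j x)
  have he : Continuous e := continuous_uliftUp.comp hj
  have hp : IsProperMap e := isProperMap_of_comp_of_t2 he
    (continuous_snd.comp continuous_uliftDown) hφ
  have hce : IsClosedEmbedding e := IsClosedEmbedding.of_continuous_injective_isClosedMap he
    (fun x y hxy => hk.injective (congrArg (fun z => z.down.1) hxy)) hp.isClosedMap
  obtain ⟨U, r, hU, hrU, hr, hrr, hfix⟩ := h _ e hce
  have hr' : ∀ z, ∃ x, e x = r z := fun z => hrr ⟨z, rfl⟩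
  choose f hf using hr'
  have hfc : Continuous f := hce.isEmbedding.continuous_iff.2 (by
    have : e ∘ f = r := funext hf
    rwa [this])
  refine ⟨⟨⟨j, hj⟩, fun z => if hz : ULift.up z ∈ U then f ⟨_, hz⟩ else Classical.arbitrary X,
    ULift.up ⁻¹' U, hU.preimage continuous_uliftUp, fun x => hrU ⟨x, rfl⟩, ?_, ?_⟩⟩
  · rw [continuousOn_iff_continuous_domRestrict]
    have : Continuous fun z : (ULift.up ⁻¹' U : Set (lp (fun _ : ℕ => ℝ) ⊤ × ℝ)) =>
        f ⟨ULift.up z.1, z.2⟩ := hfc.comp (by fun_prop)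
    convert this using 1
    ext z
    exact dif_pos z.2
  · intro x
    have hx : ULift.up (j x) ∈ U := hrU ⟨x, rfl⟩
    change (if hz : ULift.up (j x) ∈ U then f ⟨_, hz⟩ else Classical.arbitrary X) = x
    rw [dif_pos hx]
    exact hce.injective ((hf _).trans (hfix ⟨_, hx⟩ ⟨x, rfl⟩))

/-- Over a compact set, points close to `i z` are retracted close to `z`. -/
theorem NbhdRetraction.exists_radius {X E : Type*} [PseudoMetricSpace X] [NormedAddCommGroup E]
    [NormedSpace ℝ E] (R : NbhdRetraction X E) {K : Set X} (hK : IsCompact K) {ε : ℝ}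
    (hε : 0 < ε) :
    ∃ η > 0, ∀ z ∈ K, ∀ e, dist e (R.i z) < η → e ∈ R.dom ∧ dist (R.ρ e) z < ε := by
  have hloc : ∀ z ∈ K, ∃ V ∈ 𝓝[K] z, ∃ η > 0, ∀ y ∈ V, ∀ e, dist e (R.i y) < η →
      e ∈ R.dom ∧ dist (R.ρ e) y < ε := by
    intro z _
    have hc : ContinuousAt R.ρ (R.i z) :=
      R.continuousOn_ρ.continuousAt (R.isOpen_dom.mem_nhds (R.i_mem z))
    have h1 : ∀ᶠ e in 𝓝 (R.i z), e ∈ R.dom ∧ dist (R.ρ e) z < ε / 2 := by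
      refine (R.isOpen_dom.eventually_mem (R.i_mem z)).and ?_
      have := hc.preimage_mem_nhds (ball_mem_nhds (R.ρ (R.i z)) (half_pos hε))
      rwa [R.ρ_i] at this
    obtain ⟨η, hη, hb⟩ := Metric.mem_nhds_iff.1 h1
    refine ⟨R.i ⁻¹' ball (R.i z) (η / 2) ∩ ball z (ε / 2), mem_nhdsWithin_of_mem_nhds
      (Filter.inter_mem (R.i.continuous.continuousAt.preimage_mem_nhds
        (ball_mem_nhds _ (half_pos hη))) (ball_mem_nhds _ (half_pos hε))), η / 2, half_pos hη, ?_⟩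
    intro y hy e he
    have h2 : dist (R.i y) (R.i z) < η / 2 := hy.1
    have h3 : dist y z < ε / 2 := hy.2
    have h4 := hb (show e ∈ ball (R.i z) η from by
      have := dist_triangle e (R.i y) (R.i z)
      exact mem_ball.2 (by linarith))
    refine ⟨h4.1, ?_⟩
    have := dist_triangle_right (R.ρ e) y z
    linarith [h4.2]
  refine hK.induction_on (p := fun K => ∃ η > 0, ∀ z ∈ K, ∀ e, dist e (R.i z) < η →
      e ∈ R.dom ∧ dist (R.ρ e) z < ε) ⟨1, one_pos, fun z hz => hz.elim⟩ ?_ ?_ hloc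
  · rintro s t hst ⟨η, hη, h⟩
    exact ⟨η, hη, fun z hz => h z (hst hz)⟩
  · rintro s t ⟨η, hη, h⟩ ⟨η', hη', h'⟩
    refine ⟨min η η', lt_min hη hη', ?_⟩
    rintro z (hz | hz) e he
    · exact h z hz e (he.trans_le (min_le_left _ _))
    · exact h' z hz e (he.trans_le (min_le_right _ _))

theorem IsHomogeneousSpace.exists_small_homeomorph {X E : Type*} [MetricSpace X]
    [LocallyCompactSpace X] [SecondCountableTopology X] [PseudoMetricSpace E]
    (hhom : IsHomogeneousSpace X) (i : C(X, E)) {K : Set X} (hK : IsCompact K) {η : ℝ}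
    (hη : 0 < η) (x : X) :
    ∃ N : Set X, IsOpen N ∧ x ∈ N ∧ ∀ T : Set X, IsOpen T → T.Nonempty → T ⊆ N →
      ∃ x' ∈ T, ∃ k : X ≃ₜ X, k x' = x ∧ ∀ z ∈ K, dist (i (k z)) (i z) < η := by
  let e : (X ≃ₜ X) → C(X, X) × C(X, X) := fun h =>
    (⟨h, h.continuous⟩, ⟨h.symm, h.symm.continuous⟩)
  let 𝒱 : Set C(X, X) := {k | ∀ z ∈ K, dist (i (k z)) (i z) < η}
  have h𝒱 : 𝒱 ∈ 𝓝 (ContinuousMap.id X) := by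
    have hc : Filter.Tendsto (fun k : C(X, X) => i.comp k) (𝓝 (ContinuousMap.id X))
        (𝓝 (i.comp (ContinuousMap.id X))) := (ContinuousMap.continuous_postcomp i).tendsto _
    have := Metric.tendstoUniformlyOn_iff.1
      (ContinuousMap.tendsto_iff_forall_isCompact_tendstoUniformlyOn.1 hc K hK) η hη
    filter_upwards [this] with k hk z hz
    rw [dist_comm]
    exact hk z hz
  have hloc : ∀ p : C(X, X) × C(X, X), ∃ V : Set (C(X, X) × C(X, X)), p ∈ range e →
      (V ∈ 𝓝 p ∧ ∀ q ∈ V, ∀ q' ∈ V, q'.2.comp q.1 ∈ 𝒱) := by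
    intro p
    by_cases hp : p ∈ range e
    · obtain ⟨h, rfl⟩ := hp
      have hcont : Continuous fun q : (C(X, X) × C(X, X)) × (C(X, X) × C(X, X)) =>
          q.2.2.comp q.1.1 :=
        (continuous_snd.comp continuous_snd).compCM (continuous_fst.comp continuous_fst)
      have hid : (e h).2.comp (e h).1 = ContinuousMap.id X := by
        ext z
        exact h.symm_apply_apply z
      have := hcont.continuousAt.preimage_mem_nhds (x := (e h, e h)) (hid.symm ▸ h𝒱)
      rw [nhds_prod_eq, Filter.mem_prod_same_iff] at this
      obtain ⟨V, hV, hVs⟩ := this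
      exact ⟨V, fun _ => ⟨hV, fun q hq q' hq' => hVs (mk_mem_prod hq hq')⟩⟩
    · exact ⟨∅, fun h => absurd h hp⟩
  choose V hV using hloc
  obtain ⟨u, hu, hcov⟩ := exists_nat_subcover (M := range e) ⟨_, Homeomorph.refl X, rfl⟩ V
    fun p hp => (hV p hp).1
  let Y : ℕ → Set X := fun n => {y | ∃ h : X ≃ₜ X, e h ∈ V (u n) ∧ h x = y}
  have hY : ⋃ n, closure (Y n) = univ := by
    refine eq_univ_of_forall fun y => ?_
    obtain ⟨h, hh⟩ := hhom x y
    obtain ⟨n, hn⟩ := mem_iUnion.1 (hcov ⟨h, rfl⟩)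
    exact mem_iUnion.2 ⟨n, subset_closure ⟨h, hn, hh⟩⟩
  have : Nonempty X := ⟨x⟩
  obtain ⟨n, y, hy⟩ := nonempty_interior_of_iUnion_of_closed (fun n => isClosed_closure) hY
  obtain ⟨_, hz, h, hh, rfl⟩ := mem_closure_iff.1 (interior_subset hy) _ isOpen_interior hy
  refine ⟨h ⁻¹' interior (closure (Y n)), isOpen_interior.preimage h.continuous, hz, ?_⟩
  rintro T hT ⟨t0, ht0⟩ hTN
  obtain ⟨_, ⟨t, ht, rfl⟩, h', hh', he⟩ := mem_closure_iff.1 (interior_subset (hTN ht0)) (h '' T)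
    (h.isOpen_image.2 hT) ⟨t0, ht0, rfl⟩
  refine ⟨t, ht, h.trans h'.symm, ?_, (hV _ (hu n)).2 _ hh _ hh'⟩
  rw [Homeomorph.trans_apply, ← he, Homeomorph.symm_apply_apply]

theorem IsHomogeneousSpace.exists_push {X E : Type*} [MetricSpace X]
    [LocallyCompactSpace X] [SecondCountableTopology X] [NormedAddCommGroup E] [NormedSpace ℝ E]
    (hhom : IsHomogeneousSpace X) (R : NbhdRetraction X E) (x : X) {W : Set X} (hW : W ∈ 𝓝 x) :
    ∃ N : Set X, IsOpen N ∧ x ∈ N ∧ ∀ T : Set X, IsOpen T → T.Nonempty → T ⊆ N →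
      ∃ x' ∈ T, ∃ Ψ : C(X, X), (∀ y ∉ W, Ψ y = y) ∧ (∀ y ∈ W, Ψ y ∈ W) ∧
        ∀ y, Ψ y = x → y = x' := by
  obtain ⟨K0, hK0n, hK0W, hK0⟩ := local_compact_nhds hW
  obtain ⟨κ, hκ, hb⟩ := Metric.nhds_basis_closedBall.mem_iff.1 hK0n
  have hK : IsCompact (closedBall x κ) := hK0.of_isClosed_subset isClosed_closedBall hb
  have hKW : closedBall x κ ⊆ W := hb.trans hK0W
  obtain ⟨η, hη, hR⟩ := R.exists_radius hK (ε := κ / 3) (by positivity)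
  obtain ⟨N, hN, hxN, h⟩ := hhom.exists_small_homeomorph R.i hK hη x
  refine ⟨N, hN, hxN, fun T hT hne hTN => ?_⟩
  obtain ⟨x', hx', k, hk, hkη⟩ := h T hT hne hTN
  let θ : X → ℝ := fun y => max 0 (min 1 (2 - 3 * dist y x / κ))
  have hθc : Continuous θ := by fun_prop
  have hθ0 : ∀ y, 0 ≤ θ y := fun y => le_max_left _ _
  have hθ1 : ∀ y, θ y ≤ 1 := fun y => max_le zero_le_one (min_le_left _ _)
  have hθfar : ∀ y, 2 * κ / 3 ≤ dist y x → θ y = 0 := by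
    intro y hy
    refine max_eq_left ((min_le_right _ _).trans ?_)
    rw [sub_nonpos, le_div_iff₀ hκ]
    linarith
  have hθnear : ∀ y, dist y x ≤ κ / 3 → θ y = 1 := by
    intro y hy
    have : 1 ≤ 2 - 3 * dist y x / κ := by
      have : 3 * dist y x / κ ≤ 1 := by rw [div_le_one hκ]; linarith
      linarith
    change max 0 (min 1 _) = 1
    rw [min_eq_left this, max_eq_right zero_le_one]
  let e : X → E := fun y => R.i y + θ y • (R.i (k y) - R.i y)
  have hec : Continuous e := by
    have := k.continuous
    fun_prop
  have hclose : ∀ y ∈ closedBall x κ, e y ∈ R.dom ∧ dist (R.ρ (e y)) y < κ / 3 := by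
    intro y hy
    refine hR y hy _ ?_
    have h1 := hkη y hy
    rw [dist_eq_norm] at h1 ⊢
    rw [add_sub_cancel_left, norm_smul, Real.norm_of_nonneg (hθ0 y)]
    exact (mul_le_of_le_one_left (norm_nonneg _) (hθ1 y)).trans_lt h1
  have hfix : ∀ y, θ y = 0 → e y = R.i y := fun y hy => by simp [e, hy]
  have hdom : ∀ y, e y ∈ R.dom := by
    intro y
    by_cases hy : y ∈ closedBall x κ
    · exact (hclose y hy).1
    · rw [mem_closedBall, not_le] at hy
      rw [hfix y (hθfar y (by linarith))]
      exact R.i_mem y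
  have hfixR : ∀ y, 2 * κ / 3 ≤ dist y x → R.ρ (e y) = y := fun y hy => by
    rw [hfix y (hθfar y hy), R.ρ_i]
  refine ⟨x', hx', ⟨fun y => R.ρ (e y), R.continuousOn_ρ.comp_continuous hec hdom⟩, ?_, ?_, ?_⟩
  · intro y hy
    refine hfixR y ?_
    by_contra! hcon
    exact hy (hKW (mem_closedBall.2 (by linarith)))
  · intro y hy
    change R.ρ (e y) ∈ W
    rcases le_or_gt (2 * κ / 3) (dist y x) with h1 | h1
    · rwa [hfixR y h1]
    · have h2 := (hclose y (mem_closedBall.2 (by linarith))).2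
      refine hKW (mem_closedBall.2 ?_)
      have := dist_triangle (R.ρ (e y)) y x
      linarith
  · intro y hy
    change R.ρ (e y) = x at hy
    rcases le_or_gt (dist y x) (κ / 3) with h1 | h1
    · have : e y = R.i (k y) := by simp [e, hθnear y h1]
      rw [this, R.ρ_i, ← hk] at hy
      exact k.injective hy
    · exfalso
      rcases le_or_gt (2 * κ / 3) (dist y x) with h2 | h2
      · rw [hfixR y h2] at hy
        rw [hy, dist_self] at h1
        linarith
      · have h3 := (hclose y (mem_closedBall.2 (by linarith))).2
        rw [hy, dist_comm] at h3
        linarith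

/-- If no nonempty open subset of `U` has a thin frontier, then a map into `U` can be moved off any
point of `U`, keeping it fixed on a set with thin image missing that point. -/
theorem IsHomogeneousSpace.exists_avoiding {X E Z : Type*} [MetricSpace X]
    [LocallyCompactSpace X] [SecondCountableTopology X] [NormedAddCommGroup E] [NormedSpace ℝ E]
    [TopologicalSpace Z] [CompactSpace Z]
    (hhom : IsHomogeneousSpace X) (R : NbhdRetraction X E) {U : Set X} (hU : IsOpen U)
    (hthin : ∀ O : Set X, IsOpen O → O ⊆ U → Thin (frontier O) → O = ∅)
    {B : Set Z} (hB : IsClosed B) (F₀ : C(Z, X)) (hF₀ : range F₀ ⊆ U) (hγ : Thin (F₀ '' B))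
    {q : X} (hqU : q ∈ U) (hqB : q ∉ F₀ '' B) :
    ∃ F : C(Z, X), EqOn F F₀ B ∧ range F ⊆ U ∧ q ∉ range F := by
  set γ := F₀ '' B with hγdef
  have hγc : IsClosed γ := (hB.isCompact.image F₀.continuous).isClosed
  have hW : IsOpen (U \ γ) := hU.sdiff hγc
  let A : Set X := {x | x ∈ U \ γ ∧ ∃ F : C(Z, X), EqOn F F₀ B ∧ range F ⊆ U ∧ x ∉ range F}
  have hA : IsOpen A := by
    refine isOpen_iff_mem_nhds.2 ?_
    rintro x ⟨hx, F, h1, h2, h3⟩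
    filter_upwards [hW.mem_nhds hx,
      (isCompact_range F.continuous).isClosed.isOpen_compl.mem_nhds h3] with y hy hy'
    exact ⟨hy, F, h1, h2, hy'⟩
  have hΛ : IsOpen ((U \ γ) \ A) := by
    refine isOpen_iff_mem_nhds.2 ?_
    rintro x ⟨hx, hxA⟩
    obtain ⟨N, hN, hxN, h⟩ := hhom.exists_push R x (hW.mem_nhds hx)
    filter_upwards [hW.mem_nhds hx, hN.mem_nhds hxN] with y hy hyN
    refine ⟨hy, fun hyA => hxA ?_⟩
    obtain ⟨x', hx', Ψ, hΨ1, hΨ2, hΨ3⟩ := h (A ∩ N) (hA.inter hN) ⟨y, hyA, hyN⟩ inter_subset_right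
    obtain ⟨-, F, hF1, hF2, hF3⟩ := hx'.1
    refine ⟨hx, Ψ.comp F, fun z hz => ?_, ?_, ?_⟩
    · have : F z ∉ U \ γ := fun hcon => hcon.2 ⟨z, hz, (hF1 hz).symm⟩
      exact (hΨ1 _ this).trans (hF1 hz)
    · rintro _ ⟨z, rfl⟩
      by_cases hz : F z ∈ U \ γ
      · exact (hΨ2 _ hz).1
      · change Ψ (F z) ∈ U
        rw [hΨ1 _ hz]
        exact hF2 ⟨z, rfl⟩
    · rintro ⟨z, hz⟩
      exact hF3 ⟨z, hΨ3 _ hz⟩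
  have hsub : (U \ γ) \ A ⊆ range F₀ := by
    rintro x ⟨hx, hxA⟩
    by_contra hcon
    exact hxA ⟨hx, F₀, fun _ _ => rfl, hF₀, hcon⟩
  have hfr : frontier ((U \ γ) \ A) ⊆ γ := by
    intro y hy
    have hyU : y ∈ U := hF₀ (closure_minimal hsub (isCompact_range F₀.continuous).isClosed hy.1)
    by_contra hyγ
    by_cases hyA : y ∈ A
    · obtain ⟨z, hzA, hz⟩ := mem_closure_iff.1 hy.1 A hA hyA
      exact hz.2 hzA
    · rw [hΛ.frontier_eq] at hy
      exact hy.2 ⟨⟨hyU, hyγ⟩, hyA⟩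
  have hempty := hthin _ hΛ (sdiff_subset.trans sdiff_subset) (hγ.mono hfr)
  have hqA : q ∈ A := by
    by_contra hcon
    exact notMem_empty q (hempty ▸ ⟨⟨hqU, hqB⟩, hcon⟩)
  exact hqA.2

theorem IsHomogeneousSpace.exists_open_forall_thin_frontier {X : Type*} [MetricSpace X]
    [LocallyCompactSpace X] [SecondCountableTopology X] (hhom : IsHomogeneousSpace X)
    (hdim : ¬ CovDimLE X 2) (p : X) :
    ∃ T : Set X, IsOpen T ∧ p ∈ T ∧
      ∀ O : Set X, IsOpen O → O ⊆ T → Thin (frontier O) → O = ∅ := by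
  suffices h : ∃ T : Set X, IsOpen T ∧ T.Nonempty ∧
      ∀ O : Set X, IsOpen O → O ⊆ T → Thin (frontier O) → O = ∅ by
    obtain ⟨T, hT, ⟨x, hx⟩, h⟩ := h
    obtain ⟨k, rfl⟩ := hhom x p
    refine ⟨k '' T, k.isOpen_image.2 hT, ⟨x, hx, rfl⟩, fun O hO hOT ht => ?_⟩
    have h1 := h (k ⁻¹' O) (hO.preimage k.continuous) (fun y hy => by
      obtain ⟨z, hz, he⟩ := hOT hy
      rwa [← k.injective he]) (by
        rw [← k.preimage_frontier, ← k.image_symm]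
        exact ht.image_homeomorph k.symm)
    rw [← image_preimage_eq O k.surjective, h1, image_empty]
  by_contra! hcon
  refine hdim (covDimLE_two_of_thin_frontier ?_)
  let G : ℕ → Set X := fun n => ⋃₀ {O | IsOpen O ∧ Thin (frontier O) ∧
    ∀ a ∈ O, ∀ b ∈ O, dist a b < 1 / ((n : ℝ) + 1)}
  have hGo : ∀ n, IsOpen (G n) := fun n => isOpen_sUnion fun O hO => hO.1
  have hGd : ∀ n, Dense (G n) := by
    intro n
    refine dense_iff_inter_open.2 fun V hV ⟨x, hx⟩ => ?_
    have hpos : (0 : ℝ) < 1 / ((n : ℝ) + 1) / 2 := by positivity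
    obtain ⟨O, hO, hOs, ht, y, hy⟩ := hcon (V ∩ ball x (1 / ((n : ℝ) + 1) / 2))
      (hV.inter isOpen_ball) ⟨x, hx, mem_ball_self hpos⟩
    refine ⟨y, (hOs hy).1, O, ⟨hO, ht, fun a ha b hb => ?_⟩, hy⟩
    have h1 := mem_ball.1 (hOs ha).2
    have h2 := mem_ball.1 (hOs hb).2
    have := dist_triangle_right a b x
    linarith
  have : Nonempty X := ⟨p⟩
  obtain ⟨x, hx⟩ := (dense_iInter_of_isOpen hGo hGd).nonempty
  intro y W hW
  obtain ⟨k, rfl⟩ := hhom x y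
  obtain ⟨ε, hε, hb⟩ := Metric.mem_nhds_iff.1 (k.continuous.continuousAt.preimage_mem_nhds hW)
  obtain ⟨n, hn⟩ := exists_nat_one_div_lt hε
  obtain ⟨O, ⟨hO, ht, hd⟩, hxO⟩ := mem_iInter.1 hx n
  refine ⟨k '' O, k.isOpen_image.2 hO, ⟨x, hxO, rfl⟩, ?_, ?_⟩
  · rintro _ ⟨z, hz, rfl⟩
    exact hb (mem_ball.2 ((hd z hz x hxO).trans hn))
  · rw [← k.image_frontier]
    exact ht.image_homeomorph k

/-- The map of the plane given by a family of maps of unit squares. -/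
noncomputable def glueSquares {X : Type*} [TopologicalSpace X] (F : ℤ → ℤ → C(I × I, X))
    (w : ℝ × ℝ) : X :=
  F ⌊w.1⌋ ⌊w.2⌋ (⟨Int.fract w.1, Int.fract_nonneg _, (Int.fract_lt_one _).le⟩,
    ⟨Int.fract w.2, Int.fract_nonneg _, (Int.fract_lt_one _).le⟩)

theorem continuous_glueSquares {X : Type*} [TopologicalSpace X] (F : ℤ → ℤ → C(I × I, X))
    (h1 : ∀ i j t, F i j (1, t) = F (i + 1) j (0, t))
    (h2 : ∀ i j s, F i j (s, 1) = F i (j + 1) (s, 0)) : Continuous (glueSquares F) := by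
  have hfl : ∀ (i : ℤ) (x : ℝ), x ∈ Icc (i : ℝ) (i + 1) → (⌊x⌋ = i ∨ (⌊x⌋ = i + 1 ∧ x = i + 1)) := by
    intro i x hx
    rcases hx.2.lt_or_eq with h | h
    · exact Or.inl (Int.floor_eq_iff.2 ⟨hx.1, h⟩)
    · refine Or.inr ⟨Int.floor_eq_iff.2 ⟨?_, ?_⟩, h⟩ <;> push_cast <;> linarith
  have hproj0 : projIcc (0 : ℝ) 1 zero_le_one 0 = 0 := projIcc_left _
  have hproj1 : projIcc (0 : ℝ) 1 zero_le_one 1 = 1 := projIcc_right _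
  have hcell : ∀ (i j : ℤ) (w : ℝ × ℝ), w ∈ Icc (i : ℝ) (i + 1) ×ˢ Icc (j : ℝ) (j + 1) →
      glueSquares F w = F i j (projIcc 0 1 zero_le_one (w.1 - i), projIcc 0 1 zero_le_one (w.2 - j)) := by
    have hf : ∀ x : ℝ, (⟨Int.fract x, Int.fract_nonneg _, (Int.fract_lt_one _).le⟩ : I) =
        projIcc 0 1 zero_le_one (x - ⌊x⌋) := by
      intro x
      rw [Int.self_sub_floor, projIcc_of_mem _ ⟨Int.fract_nonneg _, (Int.fract_lt_one _).le⟩]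
    rintro i j ⟨x, y⟩ ⟨hx, hy⟩
    simp only [glueSquares, hf]
    rcases hfl i x hx with ha | ⟨ha, ha'⟩ <;> rcases hfl j y hy with hb | ⟨hb, hb'⟩ <;>
      rw [ha, hb] <;> (try subst ha') <;> (try subst hb') <;> push_cast <;>
      simp only [sub_self, add_sub_cancel_left, hproj0, hproj1, h1, h2]
  have hlf : LocallyFinite fun p : ℤ × ℤ => Icc (p.1 : ℝ) (p.1 + 1) ×ˢ Icc (p.2 : ℝ) (p.2 + 1) := by
    intro w
    refine ⟨ball w.1 1 ×ˢ ball w.2 1, prod_mem_nhds (ball_mem_nhds _ one_pos)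
      (ball_mem_nhds _ one_pos), ((finite_Icc (⌊w.1⌋ - 2) (⌊w.1⌋ + 2)).prod
        (finite_Icc (⌊w.2⌋ - 2) (⌊w.2⌋ + 2))).subset ?_⟩
    have key : ∀ (i : ℤ) (x y : ℝ), x ∈ Icc (i : ℝ) (i + 1) → x ∈ ball y 1 →
        i ∈ Icc (⌊y⌋ - 2) (⌊y⌋ + 2) := by
      intro i x y hx hxy
      rw [Real.ball_eq_Ioo] at hxy
      have e1 := Int.floor_le y
      have e2 := Int.lt_floor_add_one y
      constructor
      · have : (⌊y⌋ : ℝ) < ((i + 2 : ℤ) : ℝ) := by push_cast; linarith [hx.2, hxy.1]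
        have := Int.cast_lt.1 this
        omega
      · have : (i : ℝ) < ((⌊y⌋ + 2 : ℤ) : ℝ) := by push_cast; linarith [hx.1, hxy.2]
        exact (Int.cast_lt.1 this).le
    rintro ⟨i, j⟩ ⟨⟨x, y⟩, ⟨hx, hy⟩, hx', hy'⟩
    exact ⟨key i x _ hx hx', key j y _ hy hy'⟩
  refine hlf.continuous (iUnion_eq_univ_iff.2 fun w => ⟨(⌊w.1⌋, ⌊w.2⌋),
    ⟨Int.floor_le _, (Int.lt_floor_add_one _).le⟩, ⟨Int.floor_le _, (Int.lt_floor_add_one _).le⟩⟩)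
    (fun p => isClosed_Icc.prod isClosed_Icc) fun p => ContinuousOn.congr ?_ (hcell p.1 p.2)
  have := continuous_projIcc (a := (0 : ℝ)) (b := 1) (h := zero_le_one)
  exact Continuous.continuousOn (by fun_prop)

/-- The boundary of the unit square. -/
def squareBoundary : Set (I × I) := {q | q.1 = 0 ∨ q.1 = 1 ∨ q.2 = 0 ∨ q.2 = 1}

theorem isClosed_squareBoundary : IsClosed squareBoundary :=
  (isClosed_eq continuous_fst continuous_const).union <|
    (isClosed_eq continuous_fst continuous_const).union <|
      (isClosed_eq continuous_snd continuous_const).union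
        (isClosed_eq continuous_snd continuous_const)

theorem IsCompact.exists_dist_lt_of_continuous {X M : Type*} [PseudoMetricSpace X]
    [PseudoMetricSpace M] {K : Set X} (hK : IsCompact K) (j : C(X, M)) {η : ℝ} (hη : 0 < η) :
    ∃ δ > 0, ∀ z ∈ K, ∀ y, dist y z < δ → dist (j y) (j z) < η := by
  have := hK.uniformContinuousAt_of_continuousAt j (fun a _ => j.continuous.continuousAt)
    (Metric.dist_mem_uniformity hη)
  obtain ⟨δ, hδ, h⟩ := Metric.mem_uniformity_dist.1 this
  refine ⟨δ, hδ, fun z hz y hy => ?_⟩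
  rw [dist_comm]
  exact h (by rwa [dist_comm]) hz

section Squares

variable {X E : Type*} [MetricSpace X] [NormedAddCommGroup E] [NormedSpace ℝ E]

theorem NbhdRetraction.exists_monotonePath_near (R : NbhdRetraction X E) {K : Set X}
    (hK : IsCompact K) {r : ℝ} (hr : 0 < r) :
    ∃ η > 0, ∀ z ∈ K, ∀ z', dist z' z < η → ∃ c : C(I, X), MonotonePath c ∧ c 0 = z ∧ c 1 = z' ∧
      ∀ t, dist (R.i (c t)) (R.i z) < r := by
  obtain ⟨δ, hδ, h1⟩ := hK.exists_dist_lt_of_continuous R.i hr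
  obtain ⟨η, hη, h2⟩ := R.exists_radius hK hδ
  obtain ⟨η', hη', h3⟩ := hK.exists_dist_lt_of_continuous R.i hη
  refine ⟨η', hη', fun z hz z' hz' => ?_⟩
  have hball : ∀ t : I, R.i z + (t : ℝ) • (R.i z' - R.i z) ∈ ball (R.i z) η := by
    intro t
    have := h3 z hz z' hz'
    rw [dist_eq_norm] at this
    rw [mem_ball, dist_eq_norm, add_sub_cancel_left, norm_smul, Real.norm_of_nonneg t.2.1]
    exact (mul_le_of_le_one_left (norm_nonneg _) t.2.2).trans_lt this
  obtain ⟨c, hc, hc0, hc1, hcr⟩ := exists_monotonePath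
    (⟨fun t => R.ρ (R.i z + (t : ℝ) • (R.i z' - R.i z)),
      R.continuousOn_ρ.comp_continuous (by fun_prop) fun t => (h2 z hz _ (hball t)).1⟩ : C(I, X))
  refine ⟨c, hc, hc0.trans ?_, hc1.trans ?_, fun t => ?_⟩
  · simp [R.ρ_i]
  · simp [R.ρ_i]
  · obtain ⟨u, hu⟩ := hcr ⟨t, rfl⟩
    rw [← hu]
    exact h1 z hz _ (h2 z hz _ (hball u)).2

theorem NbhdRetraction.exists_filling (R : NbhdRetraction X E) {K : Set X}
    (hK : IsCompact K) {s : ℝ} (hs : 0 < s) :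
    ∃ r > 0, ∀ z ∈ K, ∀ a₀ a₁ b₀ b₁ : C(I, X), a₀ 0 = b₀ 0 → a₀ 1 = b₁ 0 → a₁ 0 = b₀ 1 →
      a₁ 1 = b₁ 1 → (∀ t, dist (R.i (a₀ t)) (R.i z) < r) → (∀ t, dist (R.i (a₁ t)) (R.i z) < r) →
      (∀ t, dist (R.i (b₀ t)) (R.i z) < r) → (∀ t, dist (R.i (b₁ t)) (R.i z) < r) →
      ∃ F : C(I × I, X), (∀ t, F (t, 0) = a₀ t) ∧ (∀ t, F (t, 1) = a₁ t) ∧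
        (∀ t, F (0, t) = b₀ t) ∧ (∀ t, F (1, t) = b₁ t) ∧ ∀ q, dist (F q) z < s := by
  obtain ⟨η, hη, hR⟩ := R.exists_radius hK hs
  refine ⟨η / 3, by positivity, fun z hz a₀ a₁ b₀ b₁ h00 h10 h01 h11 ha₀ ha₁ hb₀ hb₁ => ?_⟩
  let L : ℝ → E → E → E := fun t x y => (1 - t) • x + t • y
  have hL : ∀ (t : I) (x y : E), dist x (R.i z) < η / 3 → dist y (R.i z) < η / 3 →
      dist (L t x y) (R.i z) < η / 3 := fun t x y hx hy =>
    (convex_ball (R.i z) (η / 3)) hx hy (sub_nonneg.2 t.2.2) t.2.1 (sub_add_cancel _ _)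
  let e : I × I → E := fun q => L q.2 (R.i (a₀ q.1)) (R.i (a₁ q.1)) +
    L q.1 (R.i (b₀ q.2)) (R.i (b₁ q.2)) -
      L q.2 (L q.1 (R.i (a₀ 0)) (R.i (a₀ 1))) (L q.1 (R.i (a₁ 0)) (R.i (a₁ 1)))
  have hec : Continuous e := by
    simp only [e, L]
    fun_prop
  have hed : ∀ q, dist (e q) (R.i z) < η := by
    intro q
    have e1 := hL q.2 _ _ (ha₀ q.1) (ha₁ q.1)
    have e2 := hL q.1 _ _ (hb₀ q.2) (hb₁ q.2)
    have e3 := hL q.2 _ _ (hL q.1 _ _ (ha₀ 0) (ha₀ 1)) (hL q.1 _ _ (ha₁ 0) (ha₁ 1))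
    rw [dist_eq_norm] at e1 e2 e3 ⊢
    calc ‖e q - R.i z‖ = ‖(L q.2 (R.i (a₀ q.1)) (R.i (a₁ q.1)) - R.i z) +
        (L q.1 (R.i (b₀ q.2)) (R.i (b₁ q.2)) - R.i z) -
        (L q.2 (L q.1 (R.i (a₀ 0)) (R.i (a₀ 1))) (L q.1 (R.i (a₁ 0)) (R.i (a₁ 1))) - R.i z)‖ := by
          congr 1; simp only [e]; abel
      _ < η := by
        refine (norm_sub_le _ _).trans_lt ?_
        have := norm_add_le (L q.2 (R.i (a₀ q.1)) (R.i (a₁ q.1)) - R.i z)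
          (L q.1 (R.i (b₀ q.2)) (R.i (b₁ q.2)) - R.i z)
        linarith
  refine ⟨⟨fun q => R.ρ (e q), R.continuousOn_ρ.comp_continuous hec
    fun q => (hR z hz _ (hed q)).1⟩, fun t => ?_, fun t => ?_, fun t => ?_, fun t => ?_,
    fun q => (hR z hz _ (hed q)).2⟩
  · have : e (t, 0) = R.i (a₀ t) := by simp [e, L, h00, h10]
    exact (congrArg R.ρ this).trans (R.ρ_i _)
  · have : e (t, 1) = R.i (a₁ t) := by simp [e, L, h01, h11]
    exact (congrArg R.ρ this).trans (R.ρ_i _)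
  · have : e (0, t) = R.i (b₀ t) := by simp [e, L, h00, h01]
    exact (congrArg R.ρ this).trans (R.ρ_i _)
  · have : e (1, t) = R.i (b₁ t) := by simp [e, L, h10, h11]
    exact (congrArg R.ρ this).trans (R.ρ_i _)

theorem NbhdRetraction.exists_grid (R : NbhdRetraction X E) {K : Set X}
    (hK : IsCompact K) {s : ℝ} (hs : 0 < s) :
    ∃ η > 0, ∀ v : ℤ → ℤ → X, (∀ i j, v i j ∈ K) → (∀ i j, dist (v (i + 1) j) (v i j) < η) →
      (∀ i j, dist (v i (j + 1)) (v i j) < η) →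
      ∃ F : ℤ → ℤ → C(I × I, X), (∀ i j t, F i j (1, t) = F (i + 1) j (0, t)) ∧
        (∀ i j t, F i j (t, 1) = F i (j + 1) (t, 0)) ∧ (∀ i j q, dist (F i j q) (v i j) < s) ∧
        ∀ i j, Thin (F i j '' squareBoundary) := by
  obtain ⟨r, hr, hfill⟩ := R.exists_filling hK hs
  obtain ⟨η, hη, hpath⟩ := R.exists_monotonePath_near hK (half_pos hr)
  obtain ⟨η', hη', hi⟩ := hK.exists_dist_lt_of_continuous R.i (half_pos hr)
  refine ⟨min η η', lt_min hη hη', fun v hv hv1 hv2 => ?_⟩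
  choose a ha ha0 ha1 har using fun i j =>
    hpath (v i j) (hv i j) _ ((hv1 i j).trans_le (min_le_left _ _))
  choose b hb hb0 hb1 hbr using fun i j =>
    hpath (v i j) (hv i j) _ ((hv2 i j).trans_le (min_le_left _ _))
  have hnear : ∀ x y z, dist (R.i x) (R.i y) < r / 2 → z ∈ K → dist y z < min η η' →
      dist (R.i x) (R.i z) < r := by
    intro x y z h1 hz h2
    have := hi z hz y (h2.trans_le (min_le_right _ _))
    have := dist_triangle (R.i x) (R.i y) (R.i z)
    linarith
  choose F hF1 hF2 hF3 hF4 hF using fun i j => hfill (v i j) (hv i j) (a i j) (a i (j + 1)) (b i j)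
    (b (i + 1) j) (by rw [ha0, hb0]) (by rw [ha1, hb0]) (by rw [ha0, hb1]) (by rw [ha1, hb1])
    (fun t => (har i j t).trans (half_lt_self hr))
    (fun t => hnear _ _ _ (har i (j + 1) t) (hv i j) (hv2 i j))
    (fun t => (hbr i j t).trans (half_lt_self hr))
    (fun t => hnear _ _ _ (hbr (i + 1) j t) (hv i j) (hv1 i j))
  refine ⟨F, fun i j t => by rw [hF4, hF3], fun i j t => by rw [hF2, hF1], hF, fun i j => ?_⟩
  have hT : Thin (⋃ k : Fin 4, range (![a i j, a i (j + 1), b i j, b (i + 1) j] k)) :=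
    Thin.iUnion fun k => by
      fin_cases k
      exacts [(ha _ _).thin_range, (ha _ _).thin_range, (hb _ _).thin_range, (hb _ _).thin_range]
  refine hT.mono ?_
  rintro _ ⟨⟨x, y⟩, hq, rfl⟩
  rcases hq with h | h | h | h <;> obtain rfl := h
  · exact mem_iUnion.2 ⟨2, y, (hF3 i j y).symm⟩
  · exact mem_iUnion.2 ⟨3, y, (hF4 i j y).symm⟩
  · exact mem_iUnion.2 ⟨0, x, (hF1 i j x).symm⟩
  · exact mem_iUnion.2 ⟨1, x, (hF2 i j x).symm⟩

end Squares

theorem exists_plane_extension {X : Type*} [PseudoMetricSpace X] (g : C(Disk2, X)) :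
    ∃ G : ℝ × ℝ → X, UniformContinuous G ∧ range G ⊆ range g ∧
      ∀ z : Disk2, G (z.1 0, z.1 1) = g z := by
  let r : EuclideanSpace ℝ (Fin 2) → Disk2 := fun z => ⟨(max 1 ‖z‖)⁻¹ • z, by
    have h1 : 0 < max 1 ‖z‖ := one_pos.trans_le (le_max_left _ _)
    rw [Disk2, mem_closedBall_zero_iff, norm_smul, norm_inv, Real.norm_of_nonneg h1.le,
      inv_mul_le_one₀ h1]
    exact le_max_right _ _⟩
  have hr : Continuous r := by
    have h1 : ∀ z : EuclideanSpace ℝ (Fin 2), max 1 ‖z‖ ≠ 0 :=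
      fun z => (one_pos.trans_le (le_max_left _ _)).ne'
    exact Continuous.subtype_mk ((Continuous.inv₀ (by fun_prop) h1).smul continuous_id) _
  have hrz : ∀ z : Disk2, r z = z := by
    intro z
    have hz : ‖z.1‖ ≤ 1 := mem_closedBall_zero_iff.1 z.2
    exact Subtype.ext (by simp [r, max_eq_left hz])
  have h11 : (-1 : ℝ) ≤ 1 := by norm_num
  let H : Icc (-1 : ℝ) 1 × Icc (-1 : ℝ) 1 → X := fun q => g (r !₂[(q.1 : ℝ), (q.2 : ℝ)])
  have hH : UniformContinuous H := by
    refine CompactSpace.uniformContinuous_of_continuous (g.continuous.comp (hr.comp ?_))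
    fun_prop
  have hproj : UniformContinuous (projIcc (-1 : ℝ) 1 h11) :=
    (LipschitzWith.projIcc h11).uniformContinuous
  refine ⟨fun w => H (projIcc (-1) 1 h11 w.1, projIcc (-1) 1 h11 w.2), hH.comp
    ((hproj.comp uniformContinuous_fst).prodMk (hproj.comp uniformContinuous_snd)), ?_, ?_⟩
  · rintro _ ⟨w, rfl⟩
    exact ⟨_, rfl⟩
  · intro z
    have hz : ∀ k, z.1 k ∈ Icc (-1 : ℝ) 1 := fun k => by
      have h1 := (PiLp.norm_apply_le z.1 k).trans (mem_closedBall_zero_iff.1 z.2)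
      exact abs_le.1 h1
    change g (r !₂[(projIcc (-1) 1 h11 (z.1 0) : ℝ), (projIcc (-1) 1 h11 (z.1 1) : ℝ)]) = g z
    rw [projIcc_of_mem h11 (hz 0), projIcc_of_mem h11 (hz 1)]
    have : !₂[z.1 0, z.1 1] = z.1 := by
      ext k
      fin_cases k <;> rfl
    rw [this, hrz]

/-- (Krupski) A homogeneous, locally compact, separable metric ANR of covering
dimension greater than 2 has the disjoint (0,2)-cells property. -/
theorem krupski_disjoint_point_disk (X : Type*) [MetricSpace X]
    [LocallyCompactSpace X] [TopologicalSpace.SeparableSpace X]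
    (hhom : IsHomogeneousSpace X) (hanr : IsANR X) (hdim : ¬ CovDimLE X 2) :
    ∀ ε : ℝ, 0 < ε → ∀ (p : X) (g : C(Disk2, X)),
      ∃ (p' : X) (g' : C(Disk2, X)),
        dist p p' < ε ∧ (∀ q, dist (g q) (g' q) < ε) ∧ p' ∉ Set.range g' := by
  intro ε hε p g
  have : SecondCountableTopology X := UniformSpace.secondCountable_of_separable X
  have : Nonempty X := ⟨p⟩
  have : CompactSpace Disk2 := isCompact_iff_compactSpace.1 (isCompact_closedBall _ _)
  obtain ⟨R⟩ := hanr.exists_nbhdRetraction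
  obtain ⟨T, hT, hpT, hthin⟩ := hhom.exists_open_forall_thin_frontier hdim p
  let U := T ∩ ball p (ε / 4)
  have hU : IsOpen U := hT.inter isOpen_ball
  obtain ⟨s₀, hs₀, hs₀U⟩ := Metric.isOpen_iff.1 hU p ⟨hpT, mem_ball_self (by positivity)⟩
  obtain ⟨s, hs, hss₀, hsε⟩ : ∃ s > 0, s ≤ s₀ / 2 ∧ s ≤ ε / 4 :=
    ⟨min (s₀ / 2) (ε / 4), by positivity, min_le_left _ _, min_le_right _ _⟩
  obtain ⟨G, hG, hGr, hGg⟩ := exists_plane_extension g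
  obtain ⟨η, hη, hgrid⟩ := R.exists_grid (isCompact_range g.continuous) (half_pos hs)
  obtain ⟨δ, hδ, hGδ⟩ := Metric.uniformContinuous_iff.1 hG (min η (ε / 8)) (by positivity)
  obtain ⟨m, hm⟩ := exists_nat_one_div_lt hδ
  set n : ℝ := (m : ℝ) + 1 with hn
  have hn0 : 0 < n := by positivity
  have hcell : ∀ x y x' y' : ℝ, |x - x'| ≤ 1 → |y - y'| ≤ 1 →
      dist (G (x / n, y / n)) (G (x' / n, y' / n)) < min η (ε / 8) := by
    intro x y x' y' hx hy
    have key : ∀ x x' : ℝ, |x - x'| ≤ 1 → dist (x / n) (x' / n) < δ := by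
      intro x x' hx
      rw [Real.dist_eq, ← sub_div, abs_div, abs_of_pos hn0]
      exact (div_le_div_of_nonneg_right hx hn0.le).trans_lt hm
    exact hGδ (max_lt (key x x' hx) (key y y' hy))
  obtain ⟨F, hF1, hF2, hFv, hFt⟩ := hgrid (fun i j => G (i / n, j / n)) (fun i j => hGr ⟨_, rfl⟩)
    (fun i j => (hcell _ _ _ _ (by simp) (by simp)).trans_le (min_le_left _ _))
    (fun i j => (hcell _ _ _ _ (by simp) (by simp)).trans_le (min_le_left _ _))
  obtain ⟨q, hqp, hqF⟩ : ∃ q ∈ ball p s, ∀ i j, q ∉ F i j '' squareBoundary := by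
    by_contra! hcon
    have hΓ : Thin (⋃ k : ℤ × ℤ, F k.1 k.2 '' squareBoundary) := Thin.iUnion fun k => hFt _ _
    have hempty := hthin (ball p (s / 2)) isOpen_ball
      ((ball_subset_ball (by linarith)).trans (hs₀U.trans inter_subset_left))
      (hΓ.mono fun y hy => by
        have h1 := mem_sphere.1 (frontier_ball_subset_sphere hy)
        obtain ⟨i, j, h⟩ := hcon y (mem_ball.2 (by linarith))
        exact mem_iUnion.2 ⟨(i, j), h⟩)
    exact notMem_empty p (hempty ▸ mem_ball_self (half_pos hs))
  have hqU : q ∈ U := hs₀U (ball_subset_ball (by linarith) hqp)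
  have hmod : ∀ i j, ∃ F' : C(I × I, X), EqOn F' (F i j) squareBoundary ∧ q ∉ range F' ∧
      ∀ z, dist (F' z) (F i j z) < ε / 2 := by
    intro i j
    by_cases hq : q ∈ range (F i j)
    · obtain ⟨w, hw⟩ := hq
      have hFU : range (F i j) ⊆ U := by
        rintro _ ⟨z, rfl⟩
        refine hs₀U (mem_ball.2 ?_)
        have h1 := hFv i j z
        have h2 := hFv i j w
        have h3 := dist_triangle_right (F i j z) (F i j w) (G (i / n, j / n))
        have h4 := dist_triangle (F i j z) q p
        rw [hw] at h3 h2
        linarith [mem_ball.1 hqp]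
      obtain ⟨F', h1, h2, h3⟩ := hhom.exists_avoiding R hU
        (fun O hO hOU => hthin O hO (hOU.trans inter_subset_left)) isClosed_squareBoundary (F i j)
        hFU (hFt i j) hqU (hqF i j)
      refine ⟨F', h1, h3, fun z => ?_⟩
      have h4 := mem_ball.1 (h2 ⟨z, rfl⟩).2
      have h5 := mem_ball.1 (hFU ⟨z, rfl⟩).2
      have := dist_triangle_right (F' z) (F i j z) p
      linarith
    · exact ⟨F i j, fun _ _ => rfl, hq, fun z => by rw [dist_self]; positivity⟩
  choose F' hF'b hF'q hF'd using hmod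
  have hf := continuous_glueSquares F'
    (fun i j t => by
      rw [hF'b i j (Or.inr (Or.inl rfl)), hF'b (i + 1) j (Or.inl rfl), hF1])
    (fun i j t => by
      rw [hF'b i j (Or.inr (Or.inr (Or.inr rfl))), hF'b i (j + 1) (Or.inr (Or.inr (Or.inl rfl))),
        hF2])
  refine ⟨q, ⟨fun z => glueSquares F' (n * z.1 0, n * z.1 1), hf.comp (by fun_prop)⟩, ?_, ?_, ?_⟩
  · rw [dist_comm]
    linarith [mem_ball.1 hqp]
  · intro z
    set x := n * z.1 0 with hx
    set y := n * z.1 1 with hy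
    have hgz : g z = G (x / n, y / n) := by
      rw [hx, hy, mul_div_cancel_left₀ _ hn0.ne', mul_div_cancel_left₀ _ hn0.ne', hGg]
    have hfr : ∀ x : ℝ, |x - ⌊x⌋| ≤ 1 := fun x => by
      rw [Int.self_sub_floor, abs_of_nonneg (Int.fract_nonneg _)]
      exact (Int.fract_lt_one _).le
    have h1 := (hcell x y ⌊x⌋ ⌊y⌋ (hfr x) (hfr y)).trans_le (min_le_right _ _)
    rw [← hgz] at h1
    have key : ∀ w, dist (g z) (F' ⌊x⌋ ⌊y⌋ w) < ε := by
      intro w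
      have := dist_triangle4_right (g z) (F' ⌊x⌋ ⌊y⌋ w) (G (⌊x⌋ / n, ⌊y⌋ / n)) (F ⌊x⌋ ⌊y⌋ w)
      have h2 := hF'd ⌊x⌋ ⌊y⌋ w
      have h3 := hFv ⌊x⌋ ⌊y⌋ w
      rw [dist_comm] at h3
      linarith
    exact key _
  · rintro ⟨z, hz⟩
    exact hF'q _ _ ⟨_, hz⟩
end
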